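/- Assume the Riemann Hypothesis. For every T ≥ 2 and every real α, F(α,T) is real, F(−α,T) = F(α,T), and F(α,T) ≥ 0. Moreover, for each fixed ε > 0, uniformly for 0 ≤ α ≤ 1 − ε one has F(α,T) = α + o(1) + (1 + o(1)) T^{−2α} log T as T → ∞. -/

import Mathlib

open Complex Filter MeasureTheory Real Set

noncomputable section

/-- A non-trivial zero of the Riemann zeta function. -/
def ZetaNontrivZero (ρ : ℂ) : Prop := riemannZeta ρ = 0 ∧ 0 < ρ.re ∧ ρ.re < 1

/-- The multiplicity of `ρ` as a zero of `ζ`. -/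
def zetaMult (ρ : ℂ) : ℕ := sInf {n : ℕ | iteratedDeriv n riemannZeta ρ ≠ 0}

/-- The set of non-trivial zeros with ordinate in `(0, T]`. -/
def zerosUpTo (T : ℝ) : Set ℂ := {ρ | ZetaNontrivZero ρ ∧ 0 < ρ.im ∧ ρ.im ≤ T}

/-- Montgomery's pair correlation function `F(x,T) = ∑_{0<γ,γ'≤T} x^{i(γ-γ')} w(γ-γ')`,
zeros counted with multiplicity, where `w(u) = 4/(4+u²)`. -/
def Fxt (x T : ℝ) : ℂ :=
  ∑' p : zerosUpTo T × zerosUpTo T,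
    (zetaMult p.1 * zetaMult p.2 : ℂ) *
      Complex.exp (Complex.I * (((p.1 : ℂ).im - (p.2 : ℂ).im : ℝ) : ℂ) * (Real.log x : ℂ)) *
      ((4 / (4 + ((p.1 : ℂ).im - (p.2 : ℂ).im) ^ 2) : ℝ) : ℂ)

/-- The normalized form `F(α) = F(α, T) = ((T/2π) log T)⁻¹ ∑ T^{iα(γ-γ')} w(γ-γ')`. -/
def FF (α T : ℝ) : ℂ := ((T / (2 * π) * Real.log T : ℝ) : ℂ)⁻¹ * Fxt (T ^ α) T

/-! Part 1 of the proof. -/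
lemma pf_factor_one (f : ℂ → ℂ) (hf : Differentiable ℂ f) (ρ : ℂ) (ho : analyticOrderAt f ρ ≠ ⊤) :
    ∃ g : ℂ → ℂ, Differentiable ℂ g ∧ (∀ s, f s = (s - ρ) ^ (analyticOrderNatAt f ρ) * g s) ∧
      g ρ ≠ 0 := by
  have hfa : AnalyticAt ℂ f ρ := hf.analyticAt ρ
  obtain ⟨g₀, hg₀, hg₀0, hev⟩ := (hfa.analyticOrderAt_ne_top).1 ho
  set n := analyticOrderNatAt f ρ with hn
  refine ⟨Function.update (fun s => f s / (s - ρ) ^ n) ρ (g₀ ρ), ?_, ?_, ?_⟩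
  · intro s
    by_cases hs : s = ρ
    · subst hs
      refine hg₀.differentiableAt.congr_of_eventuallyEq ?_
      filter_upwards [hev] with z hz
      by_cases hzs : z = s
      · subst hzs; simp
      · rw [Function.update_of_ne hzs, hz]
        have : (z - s) ^ n ≠ 0 := pow_ne_zero _ (sub_ne_zero.2 hzs)
        simp only [smul_eq_mul]
        field_simp
    · have h1 : DifferentiableAt ℂ (fun s => f s / (s - ρ) ^ n) s := by
        have : (s - ρ) ^ n ≠ 0 := pow_ne_zero _ (sub_ne_zero.2 hs)
        have := hf s
        fun_prop (disch := assumption)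
      refine h1.congr_of_eventuallyEq ?_
      filter_upwards [isOpen_ne.mem_nhds hs] with z hz
      exact Function.update_of_ne hz _ _
  · intro s
    by_cases hs : s = ρ
    · subst hs
      have := hev.self_of_nhds
      simpa using this
    · rw [Function.update_of_ne hs]
      have : (s - ρ) ^ n ≠ 0 := pow_ne_zero _ (sub_ne_zero.2 hs)
      field_simp
  · simpa using hg₀0

lemma pf_factor (f : ℂ → ℂ) (hf : Differentiable ℂ f) (ho : ∀ ρ, analyticOrderAt f ρ ≠ ⊤)
    (Z : Finset ℂ) :
    ∃ g : ℂ → ℂ, Differentiable ℂ g ∧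
      (∀ s, f s = (∏ ρ ∈ Z, (s - ρ) ^ (analyticOrderNatAt f ρ)) * g s) ∧
      (∀ ρ ∈ Z, g ρ ≠ 0) := by
  classical
  induction Z using Finset.induction_on with
  | empty => exact ⟨f, hf, by simp, by simp⟩
  | insert a Z ha ih =>
    obtain ⟨g, hg, hfg, hg0⟩ := ih
    have hP : Differentiable ℂ (fun s => ∏ ρ ∈ Z, (s - ρ) ^ (analyticOrderNatAt f ρ)) := by
      fun_prop
    have hfe : f = (fun s => ∏ ρ ∈ Z, (s - ρ) ^ (analyticOrderNatAt f ρ)) * g := by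
      funext s; exact hfg s
    have hPa : (∏ ρ ∈ Z, (a - ρ) ^ (analyticOrderNatAt f ρ)) ≠ 0 := by
      refine Finset.prod_ne_zero_iff.2 fun ρ hρ => pow_ne_zero _ (sub_ne_zero.2 ?_)
      rintro rfl; exact ha hρ
    have hord : analyticOrderAt f a = analyticOrderAt g a := by
      have h1 := analyticOrderAt_mul (hP.analyticAt a) (hg.analyticAt a)
      rw [← hfe] at h1
      rw [h1, (hP.analyticAt a).analyticOrderAt_eq_zero.2 hPa, zero_add]
    have hordN : analyticOrderNatAt f a = analyticOrderNatAt g a := by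
      simp [analyticOrderNatAt, hord]
    obtain ⟨g', hg', hgg', hg'0⟩ := pf_factor_one g hg a (hord ▸ ho a)
    refine ⟨g', hg', ?_, ?_⟩
    · intro s
      rw [Finset.prod_insert ha, hfg s, hgg' s, hordN]; ring
    · intro ρ hρ
      rcases Finset.mem_insert.1 hρ with rfl | hρ
      · exact hg'0
      · have := hg0 ρ hρ
        rw [hgg' ρ] at this
        exact right_ne_zero_of_mul this

/-- nonvanishing holomorphic function on a ball, bounded by `exp M`: second derivative bound. -/
lemma pf_log_bound (g : ℂ → ℂ) (hg : Differentiable ℂ g) (R M : ℝ) (hR : 0 < R) (hM : 0 < M)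
    (h0 : ∀ z ∈ Metric.ball (0 : ℂ) R, g z ≠ 0)
    (hb : ∀ z ∈ Metric.ball (0 : ℂ) R, ‖g z‖ ≤ Real.exp M * ‖g 0‖) (s w : ℂ)
    (hs : ‖s‖ < R / 8) (hw : ‖w‖ < R / 8) :
    ‖logDeriv g s - logDeriv g w‖ ≤ 64 * M / R ^ 2 * ‖s - w‖ := by
  have hld : DifferentiableOn ℂ (logDeriv g) (Metric.ball 0 R) := by
    intro z hz
    have h1 : DifferentiableAt ℂ (deriv g) z := (hg.analyticAt z).deriv.differentiableAt
    have : DifferentiableAt ℂ (fun z => deriv g z / g z) z := h1.div (hg z) (h0 z hz)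
    exact this.differentiableWithinAt
  obtain ⟨h, hh⟩ := hld.isExactOn_ball
  -- g = C exp h
  have hconst : ∀ z ∈ Metric.ball (0 : ℂ) R, g z * Complex.exp (-(h z - h 0)) = g 0 := by
    have hd : ∀ z ∈ Metric.ball (0 : ℂ) R,
        HasDerivAt (fun z => g z * Complex.exp (-(h z - h 0))) 0 z := by
      intro z hz
      have h1 := (hg z).hasDerivAt
      have h2 : HasDerivAt (fun z => Complex.exp (-(h z - h 0)))
          (Complex.exp (-(h z - h 0)) * (-logDeriv g z)) z :=
        (((hh z hz).sub_const (h 0)).neg).cexp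
      refine (h1.mul h2).congr_deriv ?_
      have := h0 z hz
      rw [logDeriv_apply]
      field_simp
      ring
    intro z hz
    have hc := (convex_ball (0 : ℂ) R).is_const_of_fderivWithin_eq_zero (𝕜 := ℂ)
      (f := fun z => g z * Complex.exp (-(h z - h 0)))
      (fun z hz => (hd z hz).differentiableAt.differentiableWithinAt) ?_ hz
      (Metric.mem_ball_self hR)
    · simpa using hc
    · intro z hz
      rw [fderivWithin_of_isOpen Metric.isOpen_ball hz, (hd z hz).hasFDerivAt.fderiv]
      ext; simp
  have hdh : DifferentiableOn ℂ (fun z => h z - h 0) (Metric.ball 0 R) := fun z hz =>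
    ((hh z hz).sub_const (h 0)).differentiableAt.differentiableWithinAt
  have hre : MapsTo (fun z => h z - h 0) (Metric.ball 0 R) {z | z.re ≤ M} := by
    intro z hz
    have h1 := hconst z hz
    have h2 : ‖g z‖ * Real.exp (-(h z - h 0).re) = ‖g 0‖ := by
      rw [← h1, norm_mul, Complex.norm_exp]; simp
    have h3 := hb z hz
    have hg00 : 0 < ‖g 0‖ := norm_pos_iff.2 (h0 0 (Metric.mem_ball_self hR))
    have h4 : ‖g z‖ = Real.exp ((h z - h 0).re) * ‖g 0‖ := by
      rw [← h2, Real.exp_neg]; field_simp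
    rw [h4] at h3
    have h5 := le_of_mul_le_mul_right h3 hg00
    exact Real.exp_le_exp.1 h5
  have hbc : ∀ z ∈ Metric.ball (0 : ℂ) (R / 2), ‖h z - h 0‖ ≤ 2 * M := by
    intro z hz
    have hz' : ‖z‖ < R / 2 := by simpa using hz
    have := Complex.borelCaratheodory_zero hM hdh hre hR (z := z)
      (by simpa using by linarith) (by simp)
    refine this.trans ?_
    rw [div_le_iff₀ (by linarith)]
    nlinarith
  -- first derivative
  have hd1 : ∀ z : ℂ, ‖z‖ < R / 4 → ‖logDeriv g z‖ ≤ 8 * M / R := by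
    intro z hz
    have hzb : z ∈ Metric.ball (0 : ℂ) R := by simpa using by linarith
    have h1 : deriv (fun z => h z - h 0) z = logDeriv g z := ((hh z hzb).sub_const (h 0)).deriv
    rw [← h1]
    have hsub : Metric.closedBall z (R / 4) ⊆ Metric.ball 0 (R / 2) := by
      intro y hy
      have hy' : ‖y - z‖ ≤ R / 4 := by simpa [dist_eq_norm] using hy
      have : ‖y‖ ≤ ‖y - z‖ + ‖z‖ := by simpa using norm_add_le (y - z) z
      simpa using by linarith
    have := Complex.norm_deriv_le_of_forall_mem_sphere_norm_le (c := z) (R := R / 4) (C := 2 * M)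
      (f := fun z => h z - h 0) (by positivity) ?_ ?_
    · refine this.trans (le_of_eq ?_); field_simp; norm_num
    · refine DifferentiableOn.diffContOnCl ?_
      rw [closure_ball _ (by positivity)]
      exact hdh.mono (hsub.trans (Metric.ball_subset_ball (by linarith)))
    · intro y hy
      exact hbc y (hsub (Metric.sphere_subset_closedBall hy))
  have hd2 : ∀ z : ℂ, ‖z‖ < R / 8 → ‖deriv (logDeriv g) z‖ ≤ 64 * M / R ^ 2 := by
    intro z hz
    have hsub : Metric.closedBall z (R / 8) ⊆ Metric.ball 0 (R / 4) := by
      intro y hy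
      have hy' : ‖y - z‖ ≤ R / 8 := by simpa [dist_eq_norm] using hy
      have : ‖y‖ ≤ ‖y - z‖ + ‖z‖ := by simpa using norm_add_le (y - z) z
      simpa using by linarith
    have := Complex.norm_deriv_le_of_forall_mem_sphere_norm_le (c := z) (R := R / 8)
      (C := 8 * M / R) (f := logDeriv g) (by positivity) ?_ ?_
    · refine this.trans (le_of_eq ?_); field_simp; norm_num
    · refine DifferentiableOn.diffContOnCl ?_
      rw [closure_ball _ (by positivity)]
      exact hld.mono (hsub.trans (Metric.ball_subset_ball (by linarith)))
    · intro y hy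
      exact hd1 y (by simpa using hsub (Metric.sphere_subset_closedBall hy))
  refine (convex_ball (0 : ℂ) (R / 8)).norm_image_sub_le_of_norm_deriv_le (𝕜 := ℂ) ?_ ?_
    (by simpa using hw) (by simpa using hs)
  · intro z hz
    have hz' : ‖z‖ < R / 8 := by simpa using hz
    exact (hld z (by simpa using by linarith)).differentiableAt
      (Metric.isOpen_ball.mem_nhds (by simpa using by linarith))
  · intro z hz
    exact hd2 z (by simpa using hz)

/-- Partial fractions for an entire function of order `< 2`. -/
theorem pf_main (f : ℂ → ℂ) (hf : Differentiable ℂ f) (hf0 : f 0 ≠ 0) (C R₀ : ℝ)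
    (hC : 0 ≤ C) (hgr : ∀ s : ℂ, R₀ ≤ ‖s‖ → ‖f s‖ ≤ Real.exp (C * ‖s‖ ^ (3 / 2 : ℝ)))
    (Z : ℝ → Finset ℂ) (hZ : ∀ R ρ, ρ ∈ Z R ↔ f ρ = 0 ∧ ‖ρ‖ ≤ R) (s w : ℂ)
    (hs : f s ≠ 0) (hw : f w ≠ 0) :
    Tendsto (fun R : ℝ => ∑ ρ ∈ Z R, (analyticOrderNatAt f ρ : ℂ) * (1 / (s - ρ) - 1 / (w - ρ)))
      atTop (nhds (logDeriv f s - logDeriv f w)) := by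
  have ho : ∀ ρ, analyticOrderAt f ρ ≠ ⊤ := by
    intro ρ htop
    have h1 := analyticOrderAt_eq_top.1 htop
    have h2 : AnalyticOnNhd ℂ f univ := fun z _ => hf.analyticAt z
    have := h2.eqOn_zero_of_preconnected_of_eventuallyEq_zero isPreconnected_univ (mem_univ ρ) h1
    exact hf0 (this (mem_univ 0))
  -- the bound
  set A := |Real.log ‖f 0‖| + 1 with hA
  have hApos : 0 < A := by positivity
  have key : ∀ᶠ R : ℝ in atTop, ‖(logDeriv f s - logDeriv f w) -
      ∑ ρ ∈ Z R, (analyticOrderNatAt f ρ : ℂ) * (1 / (s - ρ) - 1 / (w - ρ))‖ ≤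
        64 * (C * (2 * R) ^ (3 / 2 : ℝ) + A) / R ^ 2 * ‖s - w‖ := by
    filter_upwards [eventually_gt_atTop (8 * ‖s‖), eventually_gt_atTop (8 * ‖w‖),
      eventually_ge_atTop R₀, eventually_gt_atTop 0] with R hRs hRw hR0 hR
    obtain ⟨g, hg, hfg, hg0⟩ := pf_factor f hf ho (Z R)
    have hne : ∀ ρ ∈ Z R, ρ ≠ 0 := by
      rintro ρ hρ rfl
      exact hf0 ((hZ R 0).1 hρ).1
    set n := fun ρ => analyticOrderNatAt f ρ with hn
    set c := ∏ ρ ∈ Z R, ‖ρ‖ ^ n ρ with hc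
    have hcpos : 0 < c := Finset.prod_pos fun ρ hρ => pow_pos (norm_pos_iff.2 (hne ρ hρ)) _
    have hf0g : ‖f 0‖ = c * ‖g 0‖ := by
      rw [hfg 0, norm_mul, norm_prod]; simp [hc, hn]
    have hball : ∀ z ∈ Metric.ball (0 : ℂ) R, g z ≠ 0 := by
      intro z hz hgz
      have : f z = 0 := by rw [hfg z, hgz, mul_zero]
      exact hg0 z ((hZ R z).2 ⟨this, by simpa using (Metric.mem_ball.1 hz).le⟩) hgz
    have hsph : ∀ z : ℂ, ‖z‖ = 2 * R → ‖g z‖ ≤ Real.exp (C * (2 * R) ^ (3 / 2 : ℝ)) / c := by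
      intro z hz
      have h1 := hgr z (by rw [hz]; linarith)
      rw [hfg z, norm_mul, norm_prod, hz] at h1
      have h2 : c ≤ ∏ ρ ∈ Z R, ‖(z - ρ) ^ n ρ‖ := by
        refine Finset.prod_le_prod (fun _ _ => by positivity) fun ρ hρ => ?_
        rw [norm_pow]
        gcongr
        have h3 := ((hZ R ρ).1 hρ).2
        have h4 := norm_sub_norm_le z ρ
        linarith
      rw [le_div_iff₀ hcpos, mul_comm]
      exact (mul_le_mul_of_nonneg_right h2 (norm_nonneg _)).trans h1
    have hb : ∀ z ∈ Metric.ball (0 : ℂ) R, ‖g z‖ ≤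
        Real.exp (C * (2 * R) ^ (3 / 2 : ℝ) + A) * ‖g 0‖ := by
      intro z hz
      have h1 : ‖g z‖ ≤ Real.exp (C * (2 * R) ^ (3 / 2 : ℝ)) / c := by
        refine Complex.norm_le_of_forall_mem_frontier_norm_le (U := Metric.ball 0 (2 * R))
          Metric.isBounded_ball hg.diffContOnCl ?_ ?_
        · intro y hy
          rw [frontier_ball _ (by positivity)] at hy
          exact hsph y (by simpa using hy)
        · refine subset_closure ?_
          have : ‖z‖ < R := by simpa using hz
          simpa using by linarith
      refine h1.trans ?_
      rw [Real.exp_add, div_le_iff₀ hcpos, mul_assoc, mul_assoc]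
      refine le_mul_of_one_le_right (Real.exp_pos _).le ?_
      rw [mul_comm ‖g 0‖, ← hf0g]
      have hp : 0 < ‖f 0‖ := norm_pos_iff.2 hf0
      calc 1 ≤ Real.exp (A + Real.log ‖f 0‖) := by
            apply Real.one_le_exp
            have := neg_abs_le (Real.log ‖f 0‖)
            linarith
        _ = _ := by rw [Real.exp_add, Real.exp_log hp]
    have hgb := pf_log_bound g hg R (C * (2 * R) ^ (3 / 2 : ℝ) + A) hR (by positivity) hball hb s w
      (by linarith) (by linarith)
    have hld : ∀ z : ℂ, f z ≠ 0 → logDeriv f z = ∑ ρ ∈ Z R, (n ρ : ℂ) * (1 / (z - ρ)) +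
        logDeriv g z := by
      intro z hz
      have hfe : f = fun s => (∏ ρ ∈ Z R, (s - ρ) ^ n ρ) * g s := by
        funext s; exact hfg s
      have hzρ : ∀ ρ ∈ Z R, z - ρ ≠ 0 := by
        intro ρ hρ h
        rw [sub_eq_zero.1 h] at hz
        exact hz ((hZ R ρ).1 hρ).1
      have hgz : g z ≠ 0 := by
        intro h; apply hz; rw [hfg z, h, mul_zero]
      conv_lhs => rw [hfe]
      rw [logDeriv_mul z (Finset.prod_ne_zero_iff.2 fun ρ hρ => pow_ne_zero _ (hzρ ρ hρ)) hgz
        (by fun_prop) (hg z)]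
      rw [logDeriv_prod]
      · congr 1
        refine Finset.sum_congr rfl fun ρ hρ => ?_
        rw [logDeriv_fun_pow (by fun_prop)]
        simp [logDeriv_apply]
      · exact fun ρ hρ => pow_ne_zero _ (hzρ ρ hρ)
      · intro ρ hρ; fun_prop
    rw [hld s hs, hld w hw]
    convert hgb using 2
    simp only [mul_sub, Finset.sum_sub_distrib]
    ring
  rw [tendsto_iff_norm_sub_tendsto_zero]
  refine squeeze_zero' (Eventually.of_forall fun _ => norm_nonneg _)
    (key.mono fun R hR => (norm_sub_rev _ _).trans_le hR) ?_
  have h1 : Tendsto (fun R : ℝ => R ^ (-(1 / 2) : ℝ)) atTop (nhds 0) :=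
    tendsto_rpow_neg_atTop (by norm_num)
  have h2 : Tendsto (fun R : ℝ => R ^ (-2 : ℝ)) atTop (nhds 0) :=
    tendsto_rpow_neg_atTop (by norm_num)
  have h3 : Tendsto (fun R : ℝ => (64 * (C * 2 ^ (3 / 2 : ℝ)) * R ^ (-(1 / 2) : ℝ)
      + 64 * A * R ^ (-2 : ℝ)) * ‖s - w‖) atTop (nhds 0) := by
    have := ((h1.const_mul (64 * (C * 2 ^ (3 / 2 : ℝ)))).add (h2.const_mul (64 * A))).mul_const
      ‖s - w‖
    simpa using this
  refine h3.congr' ?_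
  filter_upwards [eventually_gt_atTop 0] with R hR
  congr 1
  rw [Real.mul_rpow (by norm_num) hR.le, add_comm, add_comm (C * _)]
  have e1 : R ^ (-(1 / 2) : ℝ) = R ^ (3 / 2 : ℝ) / R ^ 2 := by
    rw [← Real.rpow_natCast R 2, ← Real.rpow_sub hR]; norm_num
  have e2 : R ^ (-2 : ℝ) = 1 / R ^ 2 := by
    rw [Real.rpow_neg hR.le]; norm_num
  rw [e1, e2]
  field_simp

/-! Part 2 of the proof. -/
/-- term of the continuation series of `(s-1)ζ(s)` -/
def zk (n : ℕ) (s : ℂ) : ℂ :=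
  (s - 1) * ((n : ℂ) + 1) ^ (-s) + ((n : ℂ) + 2) ^ (1 - s) - ((n : ℂ) + 1) ^ (1 - s)

lemma zk_bound (n : ℕ) (s : ℂ) (hs : 0 ≤ s.re) :
    ‖zk n s‖ ≤ ‖s - 1‖ * ‖s‖ * ((n : ℝ) + 1) ^ (-s.re - 1) := by
  have hn1 : (0 : ℝ) < (n : ℝ) + 1 := by positivity
  set a : ℝ := (n : ℝ) + 1 with ha
  have hmem : ∀ x ∈ Icc a (a + 1), 0 < x := fun x hx => lt_of_lt_of_le hn1 hx.1
  have hder : ∀ (r : ℂ) (x : ℝ), 0 < x → HasDerivAt (fun x : ℝ => (x : ℂ) ^ r)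
      (r * (x : ℂ) ^ (r - 1)) x := by
    intro r x hx
    have h := (hasDerivAt_id (x : ℂ)).cpow_const (c := r) (Or.inl (by simpa using hx))
    simpa using h.comp_ofReal
  have step1 : ∀ x ∈ Icc a (a + 1), ‖(x : ℂ) ^ (-s) - (a : ℂ) ^ (-s)‖ ≤
      ‖s‖ * a ^ (-s.re - 1) := by
    intro x hx
    have := (convex_Icc a (a + 1)).norm_image_sub_le_of_norm_hasDerivWithin_le
      (f := fun x : ℝ => (x : ℂ) ^ (-s)) (f' := fun x => (-s) * (x : ℂ) ^ (-s - 1))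
      (C := ‖s‖ * a ^ (-s.re - 1))
      (fun y hy => (hder (-s) y (hmem y hy)).hasDerivWithinAt) ?_
      (left_mem_Icc.2 (by linarith)) hx
    · refine this.trans (mul_le_of_le_one_right (by positivity) ?_)
      rw [Real.norm_eq_abs, abs_le]; constructor <;> linarith [hx.1, hx.2]
    · intro y hy
      rw [norm_mul, norm_neg, Complex.norm_cpow_eq_rpow_re_of_pos (hmem y hy)]
      gcongr
      simp only [sub_re, neg_re, one_re]
      exact Real.rpow_le_rpow_of_nonpos hn1 hy.1 (by linarith)
  have step2 := (convex_Icc a (a + 1)).norm_image_sub_le_of_norm_hasDerivWithin_le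
      (f := fun x : ℝ => (x : ℂ) ^ (1 - s) + (s - 1) * x * (a : ℂ) ^ (-s))
      (f' := fun x => (1 - s) * ((x : ℂ) ^ (-s) - (a : ℂ) ^ (-s)))
      (C := ‖s - 1‖ * (‖s‖ * a ^ (-s.re - 1))) (x := a) (y := a + 1) ?_ ?_
      (left_mem_Icc.2 (by linarith)) (right_mem_Icc.2 (by linarith))
  · have e : zk n s = ((a + 1 : ℝ) : ℂ) ^ (1 - s) + (s - 1) * ((a + 1 : ℝ) : ℂ) * (a : ℂ) ^ (-s)
       - ((a : ℂ) ^ (1 - s) + (s - 1) * a * (a : ℂ) ^ (-s)) := by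
      simp only [zk, ha]; push_cast; ring_nf
    rw [e]
    refine step2.trans (le_of_eq ?_)
    simp; ring
  · intro x hx
    have h1 := hder (1 - s) x (hmem x hx)
    have h2 : HasDerivAt (fun x : ℝ => (s - 1) * (x : ℂ) * (a : ℂ) ^ (-s))
        ((s - 1) * 1 * (a : ℂ) ^ (-s)) x :=
      (((hasDerivAt_id (x : ℂ)).comp_ofReal).const_mul (s - 1)).mul_const _
    refine ((h1.add h2).congr_deriv ?_).hasDerivWithinAt
    ring_nf
  · intro x hx
    rw [norm_mul, norm_sub_rev 1 s]
    gcongr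
    exact step1 x hx

lemma zk_summable_bound {c : ℝ} (hc : 0 < c) : Summable (fun n : ℕ => ((n : ℝ) + 1) ^ (-c - 1)) := by
  have := (summable_nat_add_iff 1).2 (Real.summable_nat_rpow.2 (show -c - 1 < -1 by linarith))
  simpa using this

lemma zeta1_eq (s : ℂ) (hs : 1 / 2 ≤ s.re) : riemannZeta₁ s = 1 + ∑' n, zk n s := by
  set B := ‖s‖ + 3
  set U : Set ℂ := {z | 1 / 4 < z.re} ∩ Metric.ball 0 B with hU
  have hUo : IsOpen U := (isOpen_lt continuous_const continuous_re).inter Metric.isOpen_ball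
  have hUc : Convex ℝ U := (convex_halfSpace_re_gt (1 / 4)).inter (convex_ball 0 B)
  have hd : DifferentiableOn ℂ (fun z => 1 + ∑' n, zk n z) U := by
    refine (differentiableOn_const _).add ?_
    refine differentiableOn_tsum_of_summable_norm
      (u := fun n : ℕ => (B + 1) * B * ((n : ℝ) + 1) ^ (-(1 / 4 : ℝ) - 1))
      ((zk_summable_bound (by norm_num)).mul_left _) ?_ hUo ?_
    · intro n z hz
      have h1 : (n : ℂ) + 1 ≠ 0 := by exact_mod_cast (Nat.succ_ne_zero n)
      have h2 : (n : ℂ) + 2 ≠ 0 := by exact_mod_cast (Nat.succ_ne_zero (n + 1))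
      refine DifferentiableAt.differentiableWithinAt ?_
      unfold zk
      refine ((DifferentiableAt.mul (by fun_prop) ?_).add ?_).sub ?_
      · exact DifferentiableAt.const_cpow (by fun_prop) (Or.inl h1)
      · exact DifferentiableAt.const_cpow (by fun_prop) (Or.inl h2)
      · exact DifferentiableAt.const_cpow (by fun_prop) (Or.inl h1)
    · intro n z hz
      have hz1 : 1 / 4 < z.re := hz.1
      have hz2 : ‖z‖ < B := by simpa using hz.2
      refine (zk_bound n z (by linarith)).trans ?_
      have : ‖z - 1‖ ≤ B + 1 := (norm_sub_le _ _).trans (by simpa using by linarith)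
      gcongr
      linarith [show (0:ℝ) ≤ n from n.cast_nonneg]
  have h2U : (2 : ℂ) ∈ U := by
    refine ⟨by norm_num, ?_⟩
    have := norm_nonneg s
    simp only [Metric.mem_ball, dist_zero_right, Complex.norm_ofNat, B]; linarith
  have hsU : s ∈ U := ⟨show 1 / 4 < s.re by linarith, by simp [B]⟩
  have hev : riemannZeta₁ =ᶠ[nhds 2] fun z => 1 + ∑' n, zk n z := by
    have : {z : ℂ | 1 < z.re} ∈ nhds (2 : ℂ) :=
      (isOpen_lt continuous_const continuous_re).mem_nhds (by norm_num)
    filter_upwards [this] with z hz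
    have hz1 : 1 < z.re := hz
    have hzne : z ≠ 1 := by rintro rfl; simp at hz1
    have hz0 : z - 1 ≠ 0 := sub_ne_zero.2 hzne
    have e1 : riemannZeta₁ z = (z - 1) * riemannZeta z := by
      rw [riemannZeta_eq_inv_sub_mul hzne]; field_simp
    have hsum1 : Summable (fun n : ℕ => (z - 1) * ((n : ℂ) + 1) ^ (-z)) := by
      refine Summable.mul_left _ ?_
      have := (summable_nat_add_iff 1).2 (Complex.summable_one_div_nat_cpow.2 hz1)
      refine this.congr fun n => ?_
      rw [Complex.cpow_neg]; simp
    have hsum2 : Summable (fun n : ℕ => zk n z) := by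
      refine Summable.of_norm_bounded ((zk_summable_bound (show 0 < z.re by linarith)).mul_left
        (‖z - 1‖ * ‖z‖)) fun n => zk_bound n z (by linarith)
    have hsum3 : HasSum (fun n : ℕ => zk n z - (z - 1) * ((n : ℂ) + 1) ^ (-z)) (-1) := by
      refine ((hsum2.sub hsum1).hasSum_iff_tendsto_nat).2 ?_
      have e : ∀ N : ℕ, ∑ n ∈ Finset.range N, (zk n z - (z - 1) * ((n : ℂ) + 1) ^ (-z)) =
          ((N : ℂ) + 1) ^ (1 - z) - 1 := by
        intro N
        induction N with
        | zero => simp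
        | succ N ih =>
          rw [Finset.sum_range_succ, ih, zk]; push_cast
          rw [show (N : ℂ) + 1 + 1 = N + 2 by ring]; ring
      simp_rw [e]
      have : Tendsto (fun N : ℕ => ((N : ℂ) + 1) ^ (1 - z)) atTop (nhds 0) := by
        rw [tendsto_zero_iff_norm_tendsto_zero]
        have h3 : ∀ N : ℕ, ‖((N : ℂ) + 1) ^ (1 - z)‖ = ((N : ℝ) + 1) ^ (-(z.re - 1)) := by
          intro N
          have := Complex.norm_cpow_eq_rpow_re_of_pos (show (0 : ℝ) < (N : ℝ) + 1 by positivity)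
            (1 - z)
          push_cast at this
          rw [this]; simp
        simp_rw [h3]
        exact (tendsto_rpow_neg_atTop (by linarith)).comp
          (tendsto_natCast_atTop_atTop.atTop_add tendsto_const_nhds)
      simpa using this.sub_const 1
    have h4 := hsum3.tsum_eq
    rw [hsum2.tsum_sub hsum1, tsum_mul_left] at h4
    rw [e1, zeta_eq_tsum_one_div_nat_add_one_cpow hz1]
    have h5 : ∑' n : ℕ, 1 / ((n : ℂ) + 1) ^ z = ∑' n : ℕ, ((n : ℂ) + 1) ^ (-z) := by
      refine tsum_congr fun n => ?_
      rw [Complex.cpow_neg]; simp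
    rw [h5]; linear_combination -h4
  have := AnalyticOnNhd.eqOn_of_preconnected_of_eventuallyEq
    (fun z _ => differentiable_riemannZeta₁.analyticAt z) (hd.analyticOnNhd hUo)
    hUc.isPreconnected h2U hev
  exact this hsU

lemma zeta1_right_bound : ∃ C : ℝ, 1 ≤ C ∧ ∀ s : ℂ, 1 / 2 ≤ s.re →
    ‖riemannZeta₁ s‖ ≤ C * (1 + ‖s‖) ^ 2 := by
  have hS := zk_summable_bound (show (0 : ℝ) < 1 / 2 by norm_num)
  refine ⟨1 + ∑' n : ℕ, ((n : ℝ) + 1) ^ (-(1 / 2) - 1 : ℝ), ?_, ?_⟩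
  · have : 0 ≤ ∑' n : ℕ, ((n : ℝ) + 1) ^ (-(1 / 2) - 1 : ℝ) :=
      tsum_nonneg (fun n : ℕ => by positivity)
    linarith
  intro s hs
  rw [zeta1_eq s hs]
  have h1 : ‖∑' n, zk n s‖ ≤ ∑' n : ℕ, ‖s - 1‖ * ‖s‖ * ((n : ℝ) + 1) ^ (-(1 / 2) - 1 : ℝ) := by
    refine tsum_of_norm_bounded (hS.mul_left _).hasSum fun n => ?_
    refine (zk_bound n s (by linarith)).trans ?_
    gcongr
    linarith [show (0:ℝ) ≤ n from n.cast_nonneg]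
  rw [tsum_mul_left] at h1
  set S := ∑' n : ℕ, ((n : ℝ) + 1) ^ (-(1 / 2) - 1 : ℝ) with hSdef
  have hS0 : 0 ≤ S := tsum_nonneg (fun n => by positivity)
  have h2 : ‖s - 1‖ ≤ 1 + ‖s‖ := by
    have := norm_sub_le s 1; simp at this; linarith
  have h0 := norm_nonneg s
  calc _ ≤ ‖(1 : ℂ)‖ + ‖∑' n, zk n s‖ := norm_add_le _ _
    _ ≤ 1 + (1 + ‖s‖) * (1 + ‖s‖) * S := by
      rw [norm_one]
      have : ‖s - 1‖ * ‖s‖ * S ≤ (1 + ‖s‖) * (1 + ‖s‖) * S := by gcongr; linarith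
      linarith
    _ ≤ (1 + S) * (1 + ‖s‖) ^ 2 := by nlinarith

lemma gamma_growth (w : ℂ) (hw : 1 / 2 ≤ w.re) (hr : 1 ≤ ‖w‖) :
    ‖Complex.Gamma w‖ ≤ 3 * Real.exp (6 * ‖w‖ ^ (3 / 2 : ℝ)) := by
  set n := ⌈‖w‖⌉₊ with hn
  have hn1 : ‖w‖ ≤ n := Nat.le_ceil _
  have hn2 : (n : ℝ) ≤ 2 * ‖w‖ := by
    have := Nat.ceil_lt_add_one (norm_nonneg w); linarith
  have hre : w.re ≤ n := (Complex.re_le_norm w).trans hn1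
  rw [Complex.Gamma_eq_integral (by linarith), Complex.GammaIntegral]
  have hI1 := Real.GammaIntegral_convergent (show (0 : ℝ) < 1 / 2 by norm_num)
  have hI2 := Real.GammaIntegral_convergent (show (0 : ℝ) < (n : ℝ) + 1 by positivity)
  have h1 : ‖∫ x in Ioi (0 : ℝ), ((-x).exp : ℂ) * (x : ℂ) ^ (w - 1)‖ ≤
      ∫ x in Ioi (0 : ℝ), (Real.exp (-x) * x ^ ((1 / 2 : ℝ) - 1) +
        Real.exp (-x) * x ^ ((n : ℝ) + 1 - 1)) := by
    refine norm_integral_le_of_norm_le (hI1.add hI2) ?_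
    refine (ae_restrict_iff' measurableSet_Ioi).2 (Eventually.of_forall fun x hx => ?_)
    have hx0 : 0 < x := hx
    rw [norm_mul, Complex.norm_cpow_eq_rpow_re_of_pos hx0, Complex.norm_real,
      Real.norm_of_nonneg (Real.exp_pos _).le, ← mul_add]
    gcongr
    simp only [sub_re, one_re]
    rcases le_total x 1 with h | h
    · have : x ^ (w.re - 1) ≤ x ^ ((1 / 2 : ℝ) - 1) :=
        Real.rpow_le_rpow_of_exponent_ge hx0 h (by linarith)
      have h3 : 0 ≤ x ^ ((n : ℝ) + 1 - 1) := by positivity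
      linarith
    · have : x ^ (w.re - 1) ≤ x ^ ((n : ℝ) + 1 - 1) :=
        Real.rpow_le_rpow_of_exponent_le h (by linarith)
      have h3 : 0 ≤ x ^ ((1 / 2 : ℝ) - 1) := by positivity
      linarith
  rw [integral_add hI1 hI2, ← Real.Gamma_eq_integral (by norm_num),
    ← Real.Gamma_eq_integral (by positivity), Real.Gamma_nat_eq_factorial,
    Real.Gamma_one_half_eq] at h1
  have h2 : √π ≤ 2 := by
    rw [Real.sqrt_le_left (by norm_num)]; nlinarith [Real.pi_lt_four]
  have h3 : (n.factorial : ℝ) ≤ Real.exp (6 * ‖w‖ ^ (3 / 2 : ℝ)) := by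
    have hnpos : (0 : ℝ) < n := by linarith
    have a1 : (n.factorial : ℝ) ≤ (n : ℝ) ^ n := by exact_mod_cast Nat.factorial_le_pow n
    have a2 : (n : ℝ) ^ n = Real.exp (n * Real.log n) := by
      rw [← Real.rpow_natCast, Real.rpow_def_of_pos hnpos, mul_comm]
    have a3 : Real.log n ≤ (n : ℝ) ^ (1 / 2 : ℝ) / (1 / 2) :=
      Real.log_le_rpow_div hnpos.le (by norm_num)
    rw [a2] at a1
    refine a1.trans (Real.exp_le_exp.2 ?_)
    have a4 : (n : ℝ) * Real.log n ≤ 2 * (n : ℝ) ^ (3 / 2 : ℝ) := by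
      have : (n : ℝ) ^ (3 / 2 : ℝ) = n * (n : ℝ) ^ (1 / 2 : ℝ) := by
        rw [show (3 / 2 : ℝ) = 1 + 1 / 2 by norm_num, Real.rpow_add hnpos, Real.rpow_one]
      rw [this]; nlinarith
    have a5 : (n : ℝ) ^ (3 / 2 : ℝ) ≤ (2 * ‖w‖) ^ (3 / 2 : ℝ) := by gcongr
    rw [Real.mul_rpow (by norm_num) (norm_nonneg _)] at a5
    have a6 : (2 : ℝ) ^ (3 / 2 : ℝ) ≤ 3 := by
      rw [show (3 / 2 : ℝ) = 1 + 1 / 2 by norm_num, Real.rpow_add (by norm_num), Real.rpow_one,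
        ← Real.sqrt_eq_rpow]
      nlinarith [Real.sqrt_nonneg 2, Real.sq_sqrt (show (0 : ℝ) ≤ 2 by norm_num)]
    have a7 : 0 ≤ ‖w‖ ^ (3 / 2 : ℝ) := by positivity
    nlinarith
  have h4 : 1 ≤ Real.exp (6 * ‖w‖ ^ (3 / 2 : ℝ)) := Real.one_le_exp (by positivity)
  linarith

lemma zeta1_growth : ∃ C : ℝ, 0 ≤ C ∧ ∀ s : ℂ, 4 ≤ ‖s‖ →
    ‖riemannZeta₁ s‖ ≤ Real.exp (C * ‖s‖ ^ (3 / 2 : ℝ)) := by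
  obtain ⟨C, hC1, hC⟩ := zeta1_right_bound
  refine ⟨C + 200, by linarith, fun s hs => ?_⟩
  have hr : ∀ r : ℝ, 1 ≤ r → r ≤ r ^ (3 / 2 : ℝ) := by
    intro r hr
    calc r = r ^ (1 : ℝ) := (Real.rpow_one r).symm
      _ ≤ _ := Real.rpow_le_rpow_of_exponent_le hr (by norm_num)
  have hx := hr ‖s‖ (by linarith)
  set X := ‖s‖ ^ (3 / 2 : ℝ) with hX
  have hX4 : 4 ≤ X := by linarith
  have hCe : C ≤ Real.exp C := by linarith [Real.add_one_le_exp C]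
  have hCeX : C ≤ Real.exp (C * X) := hCe.trans (Real.exp_le_exp.2 (by nlinarith))
  rcases le_total (1 / 2) s.re with h | h
  · refine (hC s h).trans ?_
    have h2 : 1 + ‖s‖ ≤ Real.exp X := by linarith [Real.add_one_le_exp X]
    calc C * (1 + ‖s‖) ^ 2 ≤ Real.exp (C * X) * Real.exp X ^ 2 := by gcongr
      _ = Real.exp (C * X + 2 * X) := by
        rw [← Real.exp_nat_mul, ← Real.exp_add]; norm_num
      _ ≤ _ := Real.exp_le_exp.2 (by nlinarith)
  · set w := 1 - s with hw
    have hsw : s = 1 - w := by rw [hw]; ring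
    have hwre : 1 / 2 ≤ w.re := by simp [hw]; linarith
    have hw1 : ‖w‖ ≤ 1 + ‖s‖ := by
      have := norm_sub_le 1 s; simpa [hw] using this
    have hw2 : ‖w‖ ≤ 2 * ‖s‖ := by linarith
    have hw3 : 3 ≤ ‖w‖ := by
      have := norm_sub_norm_le s 1
      rw [norm_sub_rev] at this; simp at this; rw [hw]; linarith
    have hwn : ∀ n : ℕ, w ≠ -n := by
      intro n hn
      have : w.re = -(n : ℝ) := by rw [hn]; simp
      have : (0 : ℝ) ≤ n := n.cast_nonneg
      linarith
    have hw1' : w ≠ 1 := by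
      intro h; rw [h] at hw3; norm_num at hw3
    have hs1 : s ≠ 1 := by
      intro h; rw [h] at hs; norm_num at hs
    have hfe := riemannZeta_one_sub hwn hw1'
    rw [← hsw] at hfe
    have e1 : riemannZeta₁ s = (s - 1) * riemannZeta s := by
      rw [riemannZeta_eq_inv_sub_mul hs1]
      have := sub_ne_zero.2 hs1
      field_simp
    have e2 : riemannZeta w = (w - 1)⁻¹ * riemannZeta₁ w := riemannZeta_eq_inv_sub_mul hw1'
    have n1 : ‖s - 1‖ ≤ ‖w‖ := by rw [hw, norm_sub_rev]
    have n2 : ‖(2 * (π : ℂ)) ^ (-w)‖ ≤ 1 := by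
      have := Complex.norm_cpow_eq_rpow_re_of_pos (show (0 : ℝ) < 2 * π by positivity) (-w)
      push_cast at this
      rw [this]
      refine Real.rpow_le_one_of_one_le_of_nonpos (by linarith [Real.pi_gt_three]) ?_
      simp; linarith
    have n3 := gamma_growth w hwre (by linarith)
    have n4 : ‖Complex.cos (π * w / 2)‖ ≤ Real.exp (2 * ‖w‖) := by
      rw [Complex.cos]
      have hb : ∀ z : ℂ, ‖z‖ ≤ 2 * ‖w‖ → ‖Complex.exp z‖ ≤ Real.exp (2 * ‖w‖) := by
        intro z hz
        rw [Complex.norm_exp]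
        exact Real.exp_le_exp.2 ((Complex.re_le_norm z).trans hz)
      have hz : ‖(π : ℂ) * w / 2‖ ≤ 2 * ‖w‖ := by
        rw [norm_div, norm_mul, Complex.norm_real, Real.norm_of_nonneg Real.pi_pos.le,
          Complex.norm_ofNat]
        nlinarith [Real.pi_lt_four, norm_nonneg w]
      have b1 := hb (π * w / 2 * I) (by simpa using hz)
      have b2 := hb (-(π * w / 2) * I) (by simpa using hz)
      rw [norm_div, Complex.norm_ofNat]
      have := norm_add_le (Complex.exp (π * w / 2 * I)) (Complex.exp (-(π * w / 2) * I))
      linarith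
    have n5 : ‖riemannZeta w‖ ≤ C * (1 + ‖w‖) ^ 2 := by
      rw [e2, norm_mul, norm_inv]
      refine (mul_le_of_le_one_left (norm_nonneg _) ?_).trans (hC w hwre)
      refine inv_le_one_of_one_le₀ ?_
      rw [show w - 1 = -s by rw [hw]; ring, norm_neg]; linarith
    have hY : ‖w‖ ^ (3 / 2 : ℝ) ≤ 3 * X := by
      have a5 : ‖w‖ ^ (3 / 2 : ℝ) ≤ (2 * ‖s‖) ^ (3 / 2 : ℝ) := by gcongr
      rw [Real.mul_rpow (by norm_num) (norm_nonneg _)] at a5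
      have a6 : (2 : ℝ) ^ (3 / 2 : ℝ) ≤ 3 := by
        rw [show (3 / 2 : ℝ) = 1 + 1 / 2 by norm_num, Real.rpow_add (by norm_num), Real.rpow_one,
          ← Real.sqrt_eq_rpow]
        nlinarith [Real.sqrt_nonneg 2, Real.sq_sqrt (show (0 : ℝ) ≤ 2 by norm_num)]
      nlinarith
    have m1 : ‖w‖ ≤ Real.exp (2 * X) := by linarith [Real.add_one_le_exp (2 * X)]
    have m2 : 1 + ‖w‖ ≤ Real.exp (2 * X) := by linarith [Real.add_one_le_exp (2 * X)]
    have m3 : ‖Complex.Gamma w‖ ≤ Real.exp (2 * X) * Real.exp (18 * X) := by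
      refine n3.trans ?_
      exact mul_le_mul (by linarith [Real.add_one_le_exp (2 * X)])
        (Real.exp_le_exp.2 (by linarith)) (Real.exp_pos _).le (Real.exp_pos _).le
    have m4 : ‖Complex.cos (π * w / 2)‖ ≤ Real.exp (4 * X) :=
      n4.trans (Real.exp_le_exp.2 (by linarith))
    have m5 : (2 : ℝ) ≤ Real.exp (2 * X) := by linarith [Real.add_one_le_exp (2 * X)]
    rw [e1, hfe]
    simp only [norm_mul]
    calc _ ≤ Real.exp (2 * X) * (Real.exp (2 * X) * 1 * (Real.exp (2 * X) * Real.exp (18 * X)) *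
          Real.exp (4 * X) * (Real.exp (C * X) * Real.exp (2 * X) ^ 2)) := by
          gcongr
          · exact n1.trans m1
          · simpa using m5
          · refine n5.trans ?_
            gcongr
      _ = Real.exp (C * X + 32 * X) := by
        rw [← Real.exp_nat_mul, mul_one]; simp only [← Real.exp_add]; congr 1; push_cast; ring
      _ ≤ _ := Real.exp_le_exp.2 (by nlinarith)

/-! Part 3 of the proof. -/
/-- all zeros of zeta -/
def ZS : Set ℂ := {ρ | riemannZeta ρ = 0}

lemma ZS_finite_ball (R : ℝ) : (Metric.closedBall (0 : ℂ) R ∩ ZS).Finite :=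
  (isCompact_closedBall 0 R).inter_riemannZetaZeros_finite

lemma ZS_countable : ZS.Countable := by
  have : ZS = ⋃ n : ℕ, (Metric.closedBall (0 : ℂ) n ∩ ZS) := by
    ext z
    simp only [mem_iUnion, mem_inter_iff, Metric.mem_closedBall, dist_zero_right]
    constructor
    · intro h
      obtain ⟨n, hn⟩ := exists_nat_ge ‖z‖
      exact ⟨n, hn, h⟩
    · rintro ⟨n, -, h⟩; exact h
  rw [this]
  exact countable_iUnion fun n => (ZS_finite_ball n).countable

instance : Countable ZS := ZS_countable.to_subtype

lemma ZS_ne_one {ρ : ℂ} (h : ρ ∈ ZS) : ρ ≠ 1 := by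
  rintro rfl; exact riemannZeta_one_ne_zero h

lemma zeta1_eq_mul {s : ℂ} (hs : s ≠ 1) : riemannZeta₁ s = (s - 1) * riemannZeta s := by
  rw [riemannZeta_eq_inv_sub_mul hs]
  have := sub_ne_zero.2 hs
  field_simp

lemma zeta1_zero_iff (s : ℂ) : riemannZeta₁ s = 0 ↔ s ∈ ZS := by
  by_cases hs : s = 1
  · subst hs
    simp [ZS, riemannZeta_one_ne_zero]
  · rw [zeta1_eq_mul hs]
    simp [ZS, sub_ne_zero.2 hs]

lemma zeta1_zero_ne : riemannZeta₁ 0 ≠ 0 := by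
  rw [zeta1_eq_mul (by norm_num), riemannZeta_zero]; norm_num

lemma zeta1_order_ne_top (ρ : ℂ) : analyticOrderAt riemannZeta₁ ρ ≠ ⊤ := by
  intro htop
  have h1 := analyticOrderAt_eq_top.1 htop
  have h2 : AnalyticOnNhd ℂ riemannZeta₁ univ := fun z _ => differentiable_riemannZeta₁.analyticAt z
  have := h2.eqOn_zero_of_preconnected_of_eventuallyEq_zero isPreconnected_univ (mem_univ ρ) h1
  exact zeta1_zero_ne (this (mem_univ 0))

lemma zeta_analyticAt {ρ : ℂ} (h : ρ ≠ 1) : AnalyticAt ℂ riemannZeta ρ := by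
  refine analyticAt_iff_eventually_differentiableAt.2 ?_
  filter_upwards [isOpen_ne.mem_nhds h] with z hz
  exact differentiableAt_riemannZeta hz

lemma zetaMult_eq {ρ : ℂ} (h : ρ ≠ 1) : zetaMult ρ = analyticOrderNatAt riemannZeta₁ ρ := by
  have ha := zeta_analyticAt h
  have h1 : analyticOrderAt riemannZeta₁ ρ = analyticOrderAt riemannZeta ρ := by
    have : riemannZeta₁ =ᶠ[nhds ρ] ((fun s => s - 1) * riemannZeta) := by
      filter_upwards [isOpen_ne.mem_nhds h] with z hz
      exact zeta1_eq_mul hz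
    have ha1 : AnalyticAt ℂ (fun s : ℂ => s - 1) ρ := by fun_prop
    rw [analyticOrderAt_congr this, analyticOrderAt_mul ha1 ha,
      ha1.analyticOrderAt_eq_zero.2 (sub_ne_zero.2 h), zero_add]
  have h2 := zeta1_order_ne_top ρ
  have h3 : (analyticOrderNatAt riemannZeta₁ ρ : ℕ∞) = analyticOrderAt riemannZeta ρ := by
    rw [← h1]; exact Nat.cast_analyticOrderNatAt h2
  set n := analyticOrderNatAt riemannZeta₁ ρ
  have h4 := (natCast_le_analyticOrderAt_iff_iteratedDeriv_eq_zero (n := n) ha).1 h3.le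
  have h5 : iteratedDeriv n riemannZeta ρ ≠ 0 := by
    intro h0
    have := (natCast_le_analyticOrderAt_iff_iteratedDeriv_eq_zero (n := n + 1) ha).2 (by
      intro i hi
      rcases Nat.lt_succ_iff_lt_or_eq.1 hi with h | h
      · exact h4 i h
      · rw [h]; exact h0)
    rw [← h3] at this
    have := Nat.cast_le.1 this
    omega
  unfold zetaMult
  apply le_antisymm
  · exact Nat.sInf_le h5
  · by_contra hlt
    push Not at hlt
    have hm := Nat.sInf_mem (s := {n : ℕ | iteratedDeriv n riemannZeta ρ ≠ 0}) ⟨n, h5⟩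
    exact hm (h4 _ hlt)

lemma zero_cases (hRH : RiemannHypothesis) {ρ : ℂ} (h : ρ ∈ ZS) :
    (∃ k : ℕ, ρ = -2 * (k + 1)) ∨ ρ.re = 1 / 2 := by
  by_cases hk : ∃ k : ℕ, ρ = -2 * (k + 1)
  · exact Or.inl hk
  · exact Or.inr (hRH ρ h hk (ZS_ne_one h))

lemma zeta_deriv_triv (k : ℕ) : deriv riemannZeta (-2 * (k + 1)) ≠ 0 := by
  set s₀ : ℂ := 2 * (k + 1) + 1 with hs₀
  have hre : s₀.re = 2 * (k + 1) + 1 := by simp [hs₀]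
  have hkp : (0 : ℝ) ≤ k := k.cast_nonneg
  have hU : ∀ᶠ s in nhds s₀, 1 < s.re :=
    (Complex.continuous_re.isOpen_preimage _ isOpen_Ioi).mem_nhds (by
      show 1 < s₀.re; rw [hre]; linarith)
  have e1 : (fun s => riemannZeta (1 - s)) =ᶠ[nhds s₀]
      fun s => (2 * (2 * π) ^ (-s) * Complex.Gamma s * riemannZeta s) * cos (π * s / 2) := by
    filter_upwards [hU] with s hs
    rw [riemannZeta_one_sub]
    · ring
    · intro n hn
      rw [hn] at hs
      have : (0 : ℝ) ≤ n := n.cast_nonneg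
      simp at hs; linarith
    · rintro rfl; simp at hs
  have hs1 : s₀ ≠ 1 := by
    intro h; rw [h] at hre; simp at hre; linarith
  have hGd : ∀ n : ℕ, s₀ ≠ -n := by
    intro n hn
    rw [hn] at hre
    have : (0 : ℝ) ≤ n := n.cast_nonneg
    simp at hre; linarith
  have hG : DifferentiableAt ℂ (fun s => 2 * (2 * (π : ℂ)) ^ (-s) * Complex.Gamma s * riemannZeta s) s₀ := by
    refine ((DifferentiableAt.mul ?_ (Complex.differentiableAt_Gamma _ hGd))).mul
      (differentiableAt_riemannZeta hs1)
    refine (differentiableAt_const _).mul ?_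
    refine DifferentiableAt.const_cpow (by fun_prop) (Or.inl ?_)
    simp
  have hcos : Complex.cos (π * s₀ / 2) = 0 := by
    rw [Complex.cos_eq_zero_iff]
    refine ⟨k + 1, ?_⟩
    rw [hs₀]; push_cast; ring
  have hsin : Complex.sin (π * s₀ / 2) ≠ 0 := by
    intro h
    have := Complex.sin_sq_add_cos_sq (π * s₀ / 2)
    rw [h, hcos] at this; norm_num at this
  have hc : HasDerivAt (fun s : ℂ => Complex.cos (π * s / 2)) (-Complex.sin (π * s₀ / 2) * (π / 2)) s₀ := by
    have h1 : HasDerivAt (fun s : ℂ => (π : ℂ) * s / 2) (π / 2) s₀ := by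
      simpa using ((hasDerivAt_id s₀).const_mul (π : ℂ)).div_const 2
    exact h1.ccos
  have hd := hG.hasDerivAt.mul hc
  have hd2 := hd.congr_of_eventuallyEq e1
  intro h0
  have hz : (1 : ℂ) - s₀ = -2 * (k + 1) := by rw [hs₀]; ring
  have hz1 : (-2 * ((k : ℂ) + 1)) ≠ 1 := by
    intro h
    have := congrArg Complex.re h
    simp at this; linarith
  have hd3 : HasDerivAt riemannZeta 0 (1 - s₀) := by
    rw [hz, ← h0]; exact (differentiableAt_riemannZeta hz1).hasDerivAt
  have hd4 : HasDerivAt (fun s => riemannZeta (1 - s)) (0 * -1) s₀ :=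
    HasDerivAt.comp (h₂ := riemannZeta) (h := fun s => 1 - s) s₀ hd3 (by simpa using (hasDerivAt_id s₀).const_sub 1)
  have := hd2.unique hd4
  rw [hcos] at this
  have hzne : riemannZeta s₀ ≠ 0 := riemannZeta_ne_zero_of_one_le_re (by rw [hre]; linarith)
  have hGne : Complex.Gamma s₀ ≠ 0 := Complex.Gamma_ne_zero hGd
  have hpne : (2 * (π : ℂ)) ^ (-s₀) ≠ 0 := by
    simp [Complex.cpow_eq_zero_iff]
  have hpi : (π : ℂ) ≠ 0 := by exact_mod_cast Real.pi_ne_zero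
  simp [hzne, hGne, hpne, hsin, hpi] at this

lemma zetaMult_triv (k : ℕ) : zetaMult (-2 * (k + 1)) = 1 := by
  unfold zetaMult
  apply le_antisymm
  · refine Nat.sInf_le ?_
    simp only [mem_ofPred_eq, iteratedDeriv_one]
    exact zeta_deriv_triv k
  · have hm := Nat.sInf_mem (s := {n : ℕ | iteratedDeriv n riemannZeta (-2 * ((k : ℂ) + 1)) ≠ 0})
      ⟨1, by simp only [mem_ofPred_eq, iteratedDeriv_one]; exact zeta_deriv_triv k⟩
    by_contra h
    have h0 : sInf {n : ℕ | iteratedDeriv n riemannZeta (-2 * ((k : ℂ) + 1)) ≠ 0} = 0 := by omega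
    rw [h0] at hm
    simp only [mem_ofPred_eq, iteratedDeriv_zero] at hm
    exact hm (riemannZeta_neg_two_mul_nat_add_one k)

lemma triv_mem_ZS (k : ℕ) : (-2 * ((k : ℂ) + 1)) ∈ ZS := riemannZeta_neg_two_mul_nat_add_one k

/-- zeros in a ball as a finset -/
def ZR (R : ℝ) : Finset ℂ := (ZS_finite_ball R).toFinset

lemma mem_ZR (R : ℝ) (ρ : ℂ) : ρ ∈ ZR R ↔ ρ ∈ ZS ∧ ‖ρ‖ ≤ R := by
  simp [ZR, and_comm]

lemma pf_zeta0 (s w : ℂ) (hs : s ∉ ZS) (hw : w ∉ ZS) :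
    Tendsto (fun R : ℝ => ∑ ρ ∈ ZR R, (zetaMult ρ : ℂ) * (1 / (s - ρ) - 1 / (w - ρ)))
      atTop (nhds (logDeriv riemannZeta₁ s - logDeriv riemannZeta₁ w)) := by
  obtain ⟨C, hC, hgr⟩ := zeta1_growth
  have := pf_main riemannZeta₁ differentiable_riemannZeta₁ zeta1_zero_ne C 4 hC hgr ZR
    (fun R ρ => by rw [mem_ZR, zeta1_zero_iff]) s w (by rwa [Ne, zeta1_zero_iff])
    (by rwa [Ne, zeta1_zero_iff])
  refine this.congr fun R => Finset.sum_congr rfl fun ρ hρ => ?_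
  rw [zetaMult_eq (ZS_ne_one ((mem_ZR _ _).1 hρ).1)]

lemma triv_summable : Summable (fun k : ℕ => 1 / (1 + ‖(-2 * ((k : ℂ) + 1))‖ ^ 2)) := by
  have h : Summable (fun k : ℕ => 1 / ((k + 1 : ℕ) : ℝ) ^ 2) :=
    (summable_nat_add_iff 1).2 (Real.summable_one_div_nat_pow.2 (by norm_num))
  refine h.of_nonneg_of_le (fun k => by positivity) (fun k => ?_)
  have : ‖(-2 * ((k : ℂ) + 1))‖ = 2 * (k + 1) := by
    rw [norm_mul, norm_neg, Complex.norm_ofNat]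
    congr 1
    exact_mod_cast Complex.norm_natCast (k + 1)
  rw [this]
  push_cast
  have hk : (0 : ℝ) ≤ k := k.cast_nonneg
  gcongr
  nlinarith

open Classical in
/-- majorant for trivial zeros -/
def Gt (ρ : ℂ) : ℝ := if ∃ k : ℕ, ρ = -2 * ((k : ℂ) + 1) then 1 / (1 + ‖ρ‖ ^ 2) else 0

lemma Gt_nonneg (ρ : ℂ) : 0 ≤ Gt ρ := by
  unfold Gt; split_ifs <;> positivity

lemma Gt_summable : Summable Gt := by
  have hinj : Function.Injective (fun k : ℕ => (-2 * ((k : ℂ) + 1))) := by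
    intro a b h
    have h2 : (a : ℂ) = b := by
      have : (-2 * ((a : ℂ) + 1)) = (-2 * ((b : ℂ) + 1)) := h
      linear_combination (-1 / 2) * this
    exact_mod_cast h2
  refine (hinj.summable_iff ?_).1 ?_
  · intro x hx
    unfold Gt
    rw [if_neg]
    rintro ⟨k, hk⟩
    exact hx ⟨k, hk.symm⟩
  · refine triv_summable.congr fun k => ?_
    unfold Gt
    simp only [Function.comp]
    rw [if_pos ⟨k, rfl⟩]

lemma not_ZS_of_re (hRH : RiemannHypothesis) {s : ℂ} (h : -2 < s.re) (h2 : s.re ≠ 1 / 2) : s ∉ ZS := by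
  intro hs
  rcases zero_cases hRH hs with ⟨k, hk⟩ | h'
  · rw [hk] at h
    have : (0 : ℝ) ≤ k := k.cast_nonneg
    simp at h
    linarith
  · exact h2 h'

lemma zero_pointwise (hRH : RiemannHypothesis) {ρ : ℂ} (hρ : ρ ∈ ZS) :
    (zetaMult ρ : ℝ) / (1 + ‖ρ‖ ^ 2) ≤
      ((zetaMult ρ : ℂ) * (1 / (3 / 2 - ρ) - 1 / (-1 / 2 - ρ))).re + 3 * Gt ρ := by
  rcases zero_cases hRH hρ with ⟨k, hk⟩ | h
  · have hk0 : (0 : ℝ) ≤ k := k.cast_nonneg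
    have h1 : zetaMult ρ = 1 := by rw [hk]; exact zetaMult_triv k
    have hn : ‖ρ‖ = 2 * (k + 1) := by
      rw [hk, norm_mul, norm_neg, Complex.norm_ofNat]
      congr 1
      exact_mod_cast Complex.norm_natCast (k + 1)
    have hG : Gt ρ = 1 / (1 + ‖ρ‖ ^ 2) := by
      unfold Gt; rw [if_pos ⟨k, hk⟩]
    rw [hG, h1, hn]
    have e : ((1 : ℕ) : ℂ) * (1 / (3 / 2 - ρ) - 1 / (-1 / 2 - ρ)) =
        (((1 / (3 / 2 + 2 * (k + 1)) - 1 / (-1 / 2 + 2 * (k + 1))) : ℝ) : ℂ) := by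
      rw [hk]; push_cast; ring
    rw [e, Complex.ofReal_re]
    have e2 : (1 / (3 / 2 + 2 * (k + 1)) - 1 / (-1 / 2 + 2 * (k + 1)) : ℝ) =
        - (2 / ((3 / 2 + 2 * (k + 1)) * (-1 / 2 + 2 * (k + 1)))) := by
      have a1 : (3 / 2 + 2 * (k + 1) : ℝ) ≠ 0 := by positivity
      have a2 : (-1 / 2 + 2 * (k + 1) : ℝ) ≠ 0 := by
        have : (0 : ℝ) < -1 / 2 + 2 * (k + 1) := by linarith
        exact this.ne'
      rw [div_sub_div _ _ a1 a2, ← neg_div]; congr 1; ring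
    rw [e2]
    have e3 : 2 / ((3 / 2 + 2 * (k + 1)) * (-1 / 2 + 2 * (k + 1)) : ℝ) ≤ 2 / (1 + (2 * (k + 1)) ^ 2) := by
      gcongr
      nlinarith
    have e4 : 2 / (1 + (2 * (k + 1)) ^ 2 : ℝ) = 2 * (1 / (1 + (2 * (k + 1)) ^ 2)) := by ring
    push_cast
    linarith
  · have hG := Gt_nonneg ρ
    have e : ρ = 1 / 2 + ρ.im * I := by
      apply Complex.ext <;> simp [h]
    set γ := ρ.im
    have hn : ‖ρ‖ ^ 2 = 1 / 4 + γ ^ 2 := by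
      rw [← Complex.normSq_eq_norm_sq, Complex.normSq_apply, h]; ring
    have e1 : 1 / (3 / 2 - ρ) - 1 / (-1 / 2 - ρ) = ((2 / (1 + γ ^ 2) : ℝ) : ℂ) := by
      have i2 : I ^ 2 = -1 := Complex.I_sq
      have h1 : (3 / 2 - ρ) ≠ 0 := by
        intro h0; have := congrArg Complex.re h0; simp [h] at this; norm_num at this
      have h2 : (-1 / 2 - ρ) ≠ 0 := by
        intro h0; have := congrArg Complex.re h0; simp [h] at this; norm_num at this
      have h3 : (1 + (γ : ℂ) ^ 2) ≠ 0 := by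
        have : (1 + γ ^ 2 : ℝ) ≠ 0 := by positivity
        exact_mod_cast this
      push_cast
      rw [div_sub_div _ _ h1 h2, div_eq_div_iff (mul_ne_zero h1 h2) h3, e]
      linear_combination (2 * (γ : ℂ) ^ 2) * (-i2) 
    rw [e1, hn, ← Complex.ofReal_natCast, ← Complex.ofReal_mul, Complex.ofReal_re]
    have : (zetaMult ρ : ℝ) / (1 + (1 / 4 + γ ^ 2)) ≤ zetaMult ρ * (2 / (1 + γ ^ 2)) := by
      rw [div_eq_mul_one_div]
      have : 1 / (1 + (1 / 4 + γ ^ 2)) ≤ 2 / (1 + γ ^ 2) := by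
        rw [div_le_div_iff₀ (by positivity) (by positivity)]
        nlinarith [sq_nonneg γ]
      gcongr
    linarith

lemma zero_summable (hRH : RiemannHypothesis) :
    Summable (fun ρ : ZS => (zetaMult ρ : ℝ) / (1 + ‖(ρ : ℂ)‖ ^ 2)) := by
  have h1 := pf_zeta0 (3 / 2) (-1 / 2) (not_ZS_of_re hRH (by norm_num) (by norm_num))
    (not_ZS_of_re hRH (by norm_num) (by norm_num))
  have h2 := (Complex.continuous_re.tendsto _).comp h1
  set L := (logDeriv riemannZeta₁ (3 / 2) - logDeriv riemannZeta₁ (-1 / 2)).re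
  have h3 := h2.eventually_le_const (show L < L + 1 by linarith)
  refine summable_of_sum_le (c := L + 1 + 3 * ∑' ρ, Gt ρ) (fun ρ => by positivity) fun u => ?_
  obtain ⟨R, hR1, hR2⟩ := (h3.and (eventually_ge_atTop (∑ ρ ∈ u, ‖(ρ : ℂ)‖))).exists
  calc ∑ ρ ∈ u, (zetaMult ρ : ℝ) / (1 + ‖(ρ : ℂ)‖ ^ 2)
      = ∑ ρ ∈ u.map (Function.Embedding.subtype _), (zetaMult ρ : ℝ) / (1 + ‖(ρ : ℂ)‖ ^ 2) := by
        rw [Finset.sum_map]; rfl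
    _ ≤ ∑ ρ ∈ ZR R, (zetaMult ρ : ℝ) / (1 + ‖(ρ : ℂ)‖ ^ 2) := by
        refine Finset.sum_le_sum_of_subset_of_nonneg ?_ (fun ρ _ _ => by positivity)
        intro ρ hρ
        obtain ⟨z, hz, rfl⟩ := Finset.mem_map.1 hρ
        refine (mem_ZR _ _).2 ⟨z.2, le_trans ?_ hR2⟩
        exact Finset.single_le_sum (f := fun ρ : ZS => ‖(ρ : ℂ)‖) (fun _ _ => norm_nonneg _) hz
    _ ≤ ∑ ρ ∈ ZR R, (((zetaMult ρ : ℂ) * (1 / (3 / 2 - ρ) - 1 / (-1 / 2 - ρ))).re + 3 * Gt ρ) :=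
        Finset.sum_le_sum fun ρ hρ => zero_pointwise hRH ((mem_ZR _ _).1 hρ).1
    _ = (∑ ρ ∈ ZR R, (zetaMult ρ : ℂ) * (1 / (3 / 2 - ρ) - 1 / (-1 / 2 - ρ))).re +
          3 * ∑ ρ ∈ ZR R, Gt ρ := by
        rw [Finset.sum_add_distrib, Finset.mul_sum, Complex.re_sum]
    _ ≤ _ := add_le_add hR1 (by
        have := Gt_summable.sum_le_tsum (ZR R) (fun ρ _ => Gt_nonneg ρ)
        linarith)

lemma ZS_dist {s : ℂ} (hs : s ∉ ZS) : ∃ c : ℝ, 0 < c ∧ ∀ ρ ∈ ZS, c * Real.sqrt (1 + ‖ρ‖ ^ 2) ≤ ‖s - ρ‖ := by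
  have hcl : IsClosed ZS := isClosed_riemannZetaZeros
  obtain ⟨r, hr, hb⟩ := Metric.isOpen_iff.1 hcl.isOpen_compl s hs
  refine ⟨min (1 / 4) (r / (2 * (2 * ‖s‖ + 2))), by positivity, fun ρ hρ => ?_⟩
  have hd : r ≤ ‖s - ρ‖ := by
    by_contra h
    push Not at h
    exact hb (show ρ ∈ Metric.ball s r by rw [Metric.mem_ball, dist_comm, dist_eq_norm]; exact h) hρ
  have hq : Real.sqrt (1 + ‖ρ‖ ^ 2) ≤ 1 + ‖ρ‖ := by
    rw [Real.sqrt_le_left (by positivity)]; nlinarith [norm_nonneg ρ]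
  rcases le_total (2 * ‖s‖ + 1) ‖ρ‖ with h | h
  · have h1 := norm_sub_norm_le ρ s
    rw [norm_sub_rev] at h1
    calc min (1 / 4) (r / (2 * (2 * ‖s‖ + 2))) * Real.sqrt (1 + ‖ρ‖ ^ 2) ≤ 1 / 4 * (1 + ‖ρ‖) := by
          gcongr; exact min_le_left _ _
      _ ≤ ‖s - ρ‖ := by linarith [norm_nonneg s]
  · calc min (1 / 4) (r / (2 * (2 * ‖s‖ + 2))) * Real.sqrt (1 + ‖ρ‖ ^ 2)
        ≤ (r / (2 * (2 * ‖s‖ + 2))) * (2 * ‖s‖ + 2) := by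
          gcongr
          · exact min_le_right _ _
          · linarith
      _ = r / 2 := by field_simp
      _ ≤ _ := by linarith

lemma zero_term_bound {s w : ℂ} (hs : s ∉ ZS) (hw : w ∉ ZS) : ∃ C : ℝ, 0 ≤ C ∧ ∀ ρ ∈ ZS,
    ‖1 / (s - ρ) - 1 / (w - ρ)‖ ≤ C / (1 + ‖ρ‖ ^ 2) := by
  obtain ⟨c, hc, h1⟩ := ZS_dist hs
  obtain ⟨d, hd, h2⟩ := ZS_dist hw
  refine ⟨‖w - s‖ / (c * d), by positivity, fun ρ hρ => ?_⟩
  have a1 := h1 ρ hρ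
  have a2 := h2 ρ hρ
  have hq : 0 < Real.sqrt (1 + ‖ρ‖ ^ 2) := by positivity
  have p1 : s - ρ ≠ 0 := by
    rw [← norm_pos_iff]; exact lt_of_lt_of_le (by positivity) a1
  have p2 : w - ρ ≠ 0 := by
    rw [← norm_pos_iff]; exact lt_of_lt_of_le (by positivity) a2
  have e : 1 / (s - ρ) - 1 / (w - ρ) = (w - s) / ((s - ρ) * (w - ρ)) := by
    field_simp; ring
  rw [e, norm_div, norm_mul, div_div]
  have e3 : c * d * (1 + ‖ρ‖ ^ 2) = (c * Real.sqrt (1 + ‖ρ‖ ^ 2)) * (d * Real.sqrt (1 + ‖ρ‖ ^ 2)) := by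
    have := Real.mul_self_sqrt (show (0 : ℝ) ≤ 1 + ‖ρ‖ ^ 2 by positivity)
    linear_combination (-(c * d)) * this
  rw [e3]
  gcongr

lemma zero_summable2 (hRH : RiemannHypothesis) {s w : ℂ} (hs : s ∉ ZS) (hw : w ∉ ZS) :
    Summable (fun ρ : ZS => ‖(zetaMult ρ : ℂ) * (1 / (s - ρ) - 1 / (w - ρ))‖) := by
  obtain ⟨C, hC, h⟩ := zero_term_bound hs hw
  refine ((zero_summable hRH).mul_left C).of_nonneg_of_le (fun _ => norm_nonneg _) fun ρ => ?_
  rw [norm_mul, Complex.norm_natCast]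
  calc (zetaMult ρ : ℝ) * ‖1 / (s - ρ) - 1 / (w - ρ)‖ ≤ zetaMult ρ * (C / (1 + ‖(ρ : ℂ)‖ ^ 2)) := by
        gcongr; exact h ρ ρ.2
    _ = _ := by ring

open Classical in
theorem pf_zeta (hRH : RiemannHypothesis) {s w : ℂ} (hs : s ∉ ZS) (hw : w ∉ ZS) :
    HasSum (fun ρ : ZS => (zetaMult ρ : ℂ) * (1 / (s - ρ) - 1 / (w - ρ)))
      (logDeriv riemannZeta₁ s - logDeriv riemannZeta₁ w) := by
  have h1 := (zero_summable2 hRH hs hw).of_norm.hasSum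
  have h2 : Tendsto (fun R : ℝ => (ZR R).subtype (· ∈ ZS)) atTop atTop := by
    refine tendsto_atTop_finset_of_monotone ?_ ?_
    · intro R R' h ρ hρ
      rw [Finset.mem_subtype, mem_ZR] at hρ ⊢
      exact ⟨hρ.1, hρ.2.trans h⟩
    · intro ρ
      exact ⟨‖(ρ : ℂ)‖, by rw [Finset.mem_subtype, mem_ZR]; exact ⟨ρ.2, le_rfl⟩⟩
  have h1' := h1
  unfold HasSum at h1'
  rw [SummationFilter.unconditional_filter] at h1'
  have h3 : Tendsto (fun R : ℝ => ∑ ρ ∈ (ZR R).subtype (· ∈ ZS),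
      (zetaMult ρ : ℂ) * (1 / (s - ρ) - 1 / (w - ρ))) atTop
      (nhds (∑' ρ : ZS, (zetaMult ρ : ℂ) * (1 / (s - ρ) - 1 / (w - ρ)))) := h1'.comp h2
  have h4 : Tendsto (fun R : ℝ => ∑ ρ ∈ (ZR R).subtype (· ∈ ZS),
      (zetaMult ρ : ℂ) * (1 / (s - ρ) - 1 / (w - ρ))) atTop
      (nhds (logDeriv riemannZeta₁ s - logDeriv riemannZeta₁ w)) := by
    refine (pf_zeta0 s w hs hw).congr fun R => ?_
    rw [Finset.sum_subtype_of_mem (fun ρ : ℂ => (zetaMult ρ : ℂ) * (1 / (s - ρ) - 1 / (w - ρ)))]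
    intro ρ hρ; exact ((mem_ZR _ _).1 hρ).1
  rwa [tendsto_nhds_unique h3 h4] at h1

/-! Part 4 of the proof. -/
/-- `f` has Laplace transform `g` on `re z > k`, with growth and continuity. -/
def LTr (k : ℝ) (f : ℝ → ℂ) (g : ℂ → ℂ) : Prop :=
  ContinuousOn f (Ici 0) ∧ (∃ B : ℝ, ∀ u : ℝ, 0 ≤ u → ‖f u‖ ≤ B * Real.exp (k * u)) ∧
  ∀ z : ℂ, k < z.re → ∫ u in Ioi (0 : ℝ), Complex.exp (-z * u) * f u = g z

lemma LTr_integrable_aux {k : ℝ} {f : ℝ → ℂ} (hc : ContinuousOn f (Ici 0)) {B : ℝ}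
    (hB : ∀ u : ℝ, 0 ≤ u → ‖f u‖ ≤ B * Real.exp (k * u)) {z : ℂ} (hz : k < z.re) :
    IntegrableOn (fun u : ℝ => Complex.exp (-z * u) * f u) (Ioi 0) := by
  have h1 : IntegrableOn (fun u : ℝ => B * Real.exp ((k - z.re) * u)) (Ioi 0) := by
    have := (integrableOn_exp_mul_Ioi (show k - z.re < 0 by linarith) 0).const_mul B
    exact this
  refine Integrable.mono' h1 ?_ ?_
  · refine ContinuousOn.aestronglyMeasurable ?_ measurableSet_Ioi
    exact ContinuousOn.mul (by fun_prop) (hc.mono Ioi_subset_Ici_self)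
  · refine (ae_restrict_iff' measurableSet_Ioi).2 (Eventually.of_forall fun u hu => ?_)
    rw [norm_mul, Complex.norm_exp]
    have e : (-z * (u : ℂ)).re = -z.re * u := by simp
    rw [e]
    calc Real.exp (-z.re * u) * ‖f u‖ ≤ Real.exp (-z.re * u) * (B * Real.exp (k * u)) := by
          gcongr; exact hB u (le_of_lt hu)
      _ = B * (Real.exp (k * u) * Real.exp (-z.re * u)) := by ring
      _ = _ := by rw [← Real.exp_add]; ring_nf

lemma LTr.integrable {k : ℝ} {f : ℝ → ℂ} {g : ℂ → ℂ} (h : LTr k f g) {z : ℂ} (hz : k < z.re) :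
    IntegrableOn (fun u : ℝ => Complex.exp (-z * u) * f u) (Ioi 0) := by
  obtain ⟨hc, ⟨B, hB⟩, -⟩ := h
  exact LTr_integrable_aux hc hB hz

lemma LTr.add {k : ℝ} {f f' : ℝ → ℂ} {g g' : ℂ → ℂ} (h : LTr k f g) (h' : LTr k f' g') :
    LTr k (fun u => f u + f' u) (fun z => g z + g' z) := by
  refine ⟨h.1.add h'.1, ?_, fun z hz => ?_⟩
  · obtain ⟨B, hB⟩ := h.2.1
    obtain ⟨B', hB'⟩ := h'.2.1
    refine ⟨B + B', fun u hu => (norm_add_le _ _).trans ?_⟩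
    rw [add_mul]; exact add_le_add (hB u hu) (hB' u hu)
  · simp only [mul_add]
    rw [integral_add (h.integrable hz) (h'.integrable hz), h.2.2 z hz, h'.2.2 z hz]

lemma LTr.const_mul {k : ℝ} {f : ℝ → ℂ} {g : ℂ → ℂ} (c : ℂ) (h : LTr k f g) :
    LTr k (fun u => c * f u) (fun z => c * g z) := by
  refine ⟨h.1.const_smul c, ?_, fun z hz => ?_⟩
  · obtain ⟨B, hB⟩ := h.2.1
    refine ⟨‖c‖ * B, fun u hu => ?_⟩
    rw [norm_mul, mul_assoc]
    exact mul_le_mul_of_nonneg_left (hB u hu) (norm_nonneg _)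
  · have : ∀ u : ℝ, Complex.exp (-z * u) * (c * f u) = c * (Complex.exp (-z * u) * f u) :=
      fun u => by ring
    simp only [this]
    rw [integral_const_mul, h.2.2 z hz]

lemma LTr.congr {k : ℝ} {f : ℝ → ℂ} {g g' : ℂ → ℂ} (h : LTr k f g) (h' : ∀ z : ℂ, k < z.re → g z = g' z) :
    LTr k f g' := ⟨h.1, h.2.1, fun z hz => by rw [h.2.2 z hz, h' z hz]⟩

lemma LTr_exp {k : ℝ} {l : ℂ} (hl : l.re ≤ k) :
    LTr k (fun u => Complex.exp (l * u)) (fun z => 1 / (z - l)) := by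
  refine ⟨by fun_prop, ⟨1, fun u hu => ?_⟩, fun z hz => ?_⟩
  · rw [Complex.norm_exp, one_mul]
    refine Real.exp_le_exp.2 ?_
    simp only [Complex.mul_re, Complex.ofReal_re, Complex.ofReal_im, mul_zero, sub_zero]
    gcongr
  · have : ∀ u : ℝ, Complex.exp (-z * u) * Complex.exp (l * u) = Complex.exp ((l - z) * u) := by
      intro u; rw [← Complex.exp_add]; ring_nf
    simp only [this]
    rw [integral_exp_mul_complex_Ioi (by simp; linarith)]
    simp only [Complex.ofReal_zero, mul_zero, Complex.exp_zero]
    rw [neg_div, ← div_neg, neg_sub]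

/-- two-sided exponential kernel -/
def EE (a b : ℂ) (v : ℝ) : ℂ := if 0 ≤ v then Complex.exp (b * v) else Complex.exp (a * v)

lemma EE_continuous (a b : ℂ) : Continuous (EE a b) := by
  unfold EE
  refine Continuous.if_le (by fun_prop) (by fun_prop) continuous_const continuous_id ?_
  intro x hx
  rw [← show (0 : ℝ) = x from hx]; simp

lemma EE_bound {a b : ℂ} (hab : b.re ≤ a.re) (v : ℝ) : ‖EE a b v‖ ≤ Real.exp (a.re * v) := by
  unfold EE
  split_ifs with h
  · rw [Complex.norm_exp]
    refine Real.exp_le_exp.2 ?_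
    simp only [Complex.mul_re, Complex.ofReal_re, Complex.ofReal_im, mul_zero, sub_zero]
    gcongr
  · rw [Complex.norm_exp]
    simp

lemma LTr_EE {k : ℝ} {a b : ℂ} (hab : b.re ≤ a.re) (hk : a.re ≤ k) {v : ℝ} (hv : 0 ≤ v) :
    LTr k (fun u => EE a b (u - v)) (fun z => Complex.exp (-z * v) / (z - b) +
      (Complex.exp (-a * v) - Complex.exp (-z * v)) / (z - a)) := by
  have hc : Continuous (fun u => EE a b (u - v)) := (EE_continuous a b).comp (by fun_prop)
  have hB : ∀ u : ℝ, 0 ≤ u → ‖EE a b (u - v)‖ ≤ Real.exp (-(a.re * v)) * Real.exp (k * u) := by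
    intro u hu
    refine (EE_bound hab _).trans ?_
    rw [← Real.exp_add]
    refine Real.exp_le_exp.2 ?_
    nlinarith
  refine ⟨hc.continuousOn, ⟨_, hB⟩, fun z hz => ?_⟩
  have hi := LTr_integrable_aux (k := k) hc.continuousOn hB hz
  rw [← intervalIntegral.integral_interval_add_Ioi hi (hi.mono_set (Ioi_subset_Ioi hv))]
  have hza : z - a ≠ 0 := by
    intro h; have := congrArg Complex.re h; simp at this; linarith
  have hza' : a - z ≠ 0 := by
    intro h; have := congrArg Complex.re h; simp at this; linarith
  have hzb : z - b ≠ 0 := by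
    intro h; have := congrArg Complex.re h; simp at this; linarith
  have hzb' : b - z ≠ 0 := by
    intro h; have := congrArg Complex.re h; simp at this; linarith
  have h1 : ∫ u in (0 : ℝ)..v, Complex.exp (-z * u) * EE a b (u - v) =
      Complex.exp (-a * v) * ∫ u in (0 : ℝ)..v, Complex.exp ((a - z) * u) := by
    rw [← intervalIntegral.integral_const_mul]
    refine intervalIntegral.integral_congr fun u hu => ?_
    rw [uIcc_of_le hv] at hu
    simp only [EE]
    split_ifs with h
    · have : u = v := le_antisymm hu.2 (by linarith)
      subst this
      simp only [sub_self, Complex.ofReal_zero, mul_zero, Complex.exp_zero, mul_one]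
      rw [← Complex.exp_add]; ring_nf
    · rw [← Complex.exp_add, ← Complex.exp_add]; push_cast; ring_nf
  have h2 : ∫ u in Ioi v, Complex.exp (-z * u) * EE a b (u - v) =
      Complex.exp (-b * v) * ∫ u in Ioi v, Complex.exp ((b - z) * u) := by
    rw [← integral_const_mul]
    refine setIntegral_congr_fun measurableSet_Ioi fun u hu => ?_
    have hu' : v < u := hu
    simp only [EE]
    rw [if_pos (by linarith), ← Complex.exp_add, ← Complex.exp_add]; push_cast; ring_nf
  rw [h1, h2, integral_exp_mul_complex hza', integral_exp_mul_complex_Ioi (by simp; linarith)]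
  have e1 : Complex.exp (-b * v) * (-Complex.exp ((b - z) * v) / (b - z)) = Complex.exp (-z * v) / (z - b) := by
    rw [← mul_div_assoc, mul_neg, ← Complex.exp_add, neg_div, ← div_neg, neg_sub]; ring_nf
  have e2 : Complex.exp (-a * v) * ((Complex.exp ((a - z) * v) - Complex.exp ((a - z) * (0 : ℝ))) / (a - z)) =
      (Complex.exp (-a * v) - Complex.exp (-z * v)) / (z - a) := by
    rw [← mul_div_assoc, mul_sub, ← Complex.exp_add, ← neg_sub z a, div_neg, ← neg_div, neg_sub]
    simp; ring_nf
  rw [e1, e2]; ring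

lemma LTr_tsum {ι : Type*} [Countable ι] {k : ℝ} {f : ι → ℝ → ℂ} {g : ι → ℂ → ℂ} {B : ι → ℝ}
    (h : ∀ i, LTr k (f i) (g i)) (hB : Summable B)
    (hb : ∀ i u, 0 ≤ u → ‖f i u‖ ≤ B i * Real.exp (k * u)) :
    LTr k (fun u => ∑' i, f i u) (fun z => ∑' i, g i z) := by
  have hc : ContinuousOn (fun u => ∑' i, f i u) (Ici 0) := by
    intro u₀ hu₀
    have : ContinuousOn (fun u => ∑' i, f i u) (Icc 0 (u₀ + 1)) := by
      refine continuousOn_tsum (u := fun i => B i * Real.exp (|k| * (u₀ + 1)))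
        (fun i => (h i).1.mono Icc_subset_Ici_self) (hB.mul_right _) fun i u hu => ?_
      refine (hb i u hu.1).trans ?_
      have hBi : 0 ≤ B i := by
        have := (norm_nonneg _).trans (hb i 0 le_rfl)
        simpa using this
      gcongr
      · exact hu.1
      · exact le_abs_self _
      · exact hu.2
    have h2 := this u₀ ⟨hu₀, by linarith⟩
    refine h2.mono_of_mem_nhdsWithin ?_
    rw [mem_nhdsWithin]
    exact ⟨Iio (u₀ + 1), isOpen_Iio, by simp, fun x hx => ⟨hx.2, le_of_lt hx.1⟩⟩
  have hbd : ∀ u : ℝ, 0 ≤ u → ‖∑' i, f i u‖ ≤ (∑' i, B i) * Real.exp (k * u) := by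
    intro u hu
    have hs : HasSum (fun i => B i * Real.exp (k * u)) ((∑' i, B i) * Real.exp (k * u)) :=
      hB.hasSum.mul_right _
    exact tsum_of_norm_bounded hs fun i => hb i u hu
  refine ⟨hc, ⟨_, hbd⟩, fun z hz => ?_⟩
  have hF := hasSum_integral_of_summable_integral_norm (μ := volume.restrict (Ioi (0 : ℝ)))
    (F := fun i (u : ℝ) => Complex.exp (-z * u) * f i u) (fun i => (h i).integrable hz) (by
      have hs : Summable (fun i => B i * ∫ u in Ioi (0 : ℝ), Real.exp ((k - z.re) * u)) :=
        hB.mul_right _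
      refine hs.of_nonneg_of_le (fun i => integral_nonneg fun _ => norm_nonneg _) fun i => ?_
      rw [← integral_const_mul]
      refine setIntegral_mono_on ((h i).integrable hz).norm
        ((integrableOn_exp_mul_Ioi (show k - z.re < 0 by linarith) 0).const_mul _)
        measurableSet_Ioi fun u hu => ?_
      rw [norm_mul, Complex.norm_exp]
      have e : (-z * (u : ℂ)).re = -z.re * u := by simp
      rw [e]
      calc Real.exp (-z.re * u) * ‖f i u‖ ≤ Real.exp (-z.re * u) * (B i * Real.exp (k * u)) := by
            gcongr; exact hb i u (le_of_lt hu)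
        _ = B i * (Real.exp (k * u) * Real.exp (-z.re * u)) := by ring
        _ = _ := by rw [← Real.exp_add]; ring_nf)
  simp only [tsum_mul_left] at hF
  rw [← hF.tsum_eq]
  exact tsum_congr fun i => (h i).2.2 z hz

lemma LTr_zero {k : ℝ} {f : ℝ → ℂ} (h : LTr k f (fun _ => 0)) : ∀ u, 0 ≤ u → f u = 0 := by
  set c := k + 1
  set D : ℝ → ℂ := (Ioi (0 : ℝ)).indicator (fun u => Complex.exp (-(c : ℂ) * u) * f u) with hD
  have hDi : Integrable D := by
    rw [hD, integrable_indicator_iff measurableSet_Ioi]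
    exact h.integrable (z := (c : ℂ)) (by simp [c])
  have hF : FourierTransform.fourier D = fun _ => 0 := by
    funext w
    rw [Real.fourier_real_eq_integral_exp_smul]
    have h1 := h.2.2 ((c : ℂ) + 2 * π * w * I) (by simp [c])
    refine Eq.trans ?_ h1
    rw [← integral_indicator measurableSet_Ioi]
    congr 1
    funext v
    by_cases hv : v ∈ Ioi (0 : ℝ)
    · rw [hD, indicator_of_mem hv, indicator_of_mem hv, smul_eq_mul, ← mul_assoc, ← Complex.exp_add]
      congr 2
      push_cast; ring
    · rw [hD, indicator_of_notMem hv, indicator_of_notMem hv, smul_zero]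
  have hpos : ∀ u : ℝ, 0 < u → f u = 0 := by
    intro u hu
    have hcont : ContinuousAt D u := by
      have : ContinuousAt (fun u : ℝ => Complex.exp (-(c : ℂ) * u) * f u) u := by
        refine ContinuousAt.mul (by fun_prop) (h.1.continuousAt (Ici_mem_nhds hu))
      refine this.congr ?_
      filter_upwards [Ioi_mem_nhds hu] with v hv
      rw [hD, indicator_of_mem hv]
    have h2 := hDi.fourierInv_fourier_eq (by rw [hF]; exact integrable_zero _ _ _) hcont
    rw [hF] at h2
    have h3 : D u = 0 := by
      rw [← h2, Real.fourierInv_eq]; simp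
    rw [hD, indicator_of_mem (show u ∈ Ioi (0 : ℝ) from hu)] at h3
    exact (mul_eq_zero.1 h3).resolve_left (Complex.exp_ne_zero _)
  have := Set.EqOn.of_subset_closure (s := Ioi (0 : ℝ)) (t := Ici 0) (f := f) (g := fun _ => 0)
    (fun u hu => hpos u hu) h.1 continuousOn_const Ioi_subset_Ici_self (by rw [closure_Ioi])
  exact fun u hu => this hu

/-! Part 5 of the proof. -/
/-- logarithmic derivative of zeta at 1/2 + z -/
def MM (z : ℂ) : ℂ := logDeriv riemannZeta (1 / 2 + z)

/-- coefficients Λ(n)/√n -/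
def lam (n : ℕ) : ℝ := ArithmeticFunction.vonMangoldt n * Real.exp (-(1 / 2) * Real.log n)

lemma lam_nonneg (n : ℕ) : 0 ≤ lam n :=
  mul_nonneg ArithmeticFunction.vonMangoldt_nonneg (Real.exp_pos _).le

lemma logDeriv_zeta1 {s : ℂ} (h1 : s ≠ 1) (h : s ∉ ZS) :
    logDeriv riemannZeta₁ s = logDeriv riemannZeta s + 1 / (s - 1) := by
  have e : riemannZeta₁ =ᶠ[nhds s] (fun s => (s - 1) * riemannZeta s) := by
    filter_upwards [isOpen_ne.mem_nhds h1] with z hz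
    exact zeta1_eq_mul hz
  have h2 : logDeriv riemannZeta₁ s = logDeriv (fun s => (s - 1) * riemannZeta s) s := by
    unfold logDeriv
    simp only [Pi.div_apply]
    rw [e.deriv_eq, e.eq_of_nhds]
  rw [h2, logDeriv_mul (f := fun s : ℂ => s - 1) (g := riemannZeta) s (sub_ne_zero.2 h1) h (by fun_prop)
    (differentiableAt_riemannZeta h1)]
  have : logDeriv (fun s : ℂ => s - 1) s = 1 / (s - 1) := by
    unfold logDeriv; simp
  rw [this, add_comm]

lemma MM_hasSum {z : ℂ} (hz : 1 / 2 < z.re) :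
    HasSum (fun n : ℕ => (lam n : ℂ) * Complex.exp (-z * (Real.log n : ℝ))) (-MM z) := by
  have hs : 1 < (1 / 2 + z).re := by simp; linarith
  have h1 := ArithmeticFunction.LSeriesSummable_vonMangoldt hs
  have h2 := ArithmeticFunction.LSeries_vonMangoldt_eq_deriv_riemannZeta_div hs
  have h3 : -MM z = LSeries (fun n => (ArithmeticFunction.vonMangoldt n : ℂ)) (1 / 2 + z) := by
    rw [h2, MM, logDeriv]; simp [neg_div]
  rw [h3]
  have h4 := h1.LSeriesHasSum
  unfold LSeriesHasSum at h4
  refine h4.congr_fun (fun n => ?_)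
  rcases eq_or_ne n 0 with rfl | hn
  · simp [lam]
  · rw [LSeries.term_of_ne_zero hn, lam, Complex.cpow_def_of_ne_zero (by exact_mod_cast hn),
      Complex.ofReal_mul, Complex.ofReal_exp, eq_div_iff (Complex.exp_ne_zero _), mul_assoc, mul_assoc,
      ← Complex.exp_add, ← Complex.exp_add, ← Complex.natCast_log]
    have : ((-(1 / 2) * Real.log n : ℝ) : ℂ) + (-z * (Real.log n : ℝ) + (Real.log n : ℝ) * (1 / 2 + z)) = 0 := by
      push_cast; ring
    rw [this, Complex.exp_zero, mul_one]

lemma lam_summable {c : ℝ} (hc : 1 / 2 < c) :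
    Summable (fun n : ℕ => lam n * Real.exp (-c * Real.log n)) := by
  have := (MM_hasSum (z := (c : ℂ)) (by simpa using hc)).summable.norm
  refine this.congr fun n => ?_
  rw [norm_mul, Complex.norm_real, Real.norm_of_nonneg (lam_nonneg n), Complex.norm_exp]
  congr 2
  simp only [Complex.mul_re, Complex.neg_re, Complex.neg_im, Complex.ofReal_re, Complex.ofReal_im, mul_zero, sub_zero]

lemma ZS_re (hRH : RiemannHypothesis) {ρ : ℂ} (h : ρ ∈ ZS) : ρ.re ≤ 1 / 2 := by
  rcases zero_cases hRH h with ⟨k, hk⟩ | h'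
  · have : (0 : ℝ) ≤ k := k.cast_nonneg
    rw [hk]; simp; linarith
  · exact h'.le

/-- Explicit formula -/
theorem explicit_formula (hRH : RiemannHypothesis) {a b : ℂ} (ha : 1 / 2 < a.re) (hab : b.re ≤ a.re)
    (hb : 1 / 2 + b ∉ ZS) (hb1 : b ≠ 1 / 2) {u : ℝ} (hu : 0 ≤ u) :
    (∑' ρ : ZS, (zetaMult ρ : ℂ) * (1 / (1 / 2 + a - ρ) - 1 / (1 / 2 + b - ρ)) *
        Complex.exp (((ρ : ℂ) - 1 / 2) * u)) =
      (1 / (a - 1 / 2) - 1 / (b - 1 / 2)) * Complex.exp ((1 / 2 : ℂ) * u)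
       - (∑' n : ℕ, (lam n : ℂ) * EE a b (u - Real.log n)) - MM b * Complex.exp (b * u) := by
  set k := a.re with hk
  have hnz : ∀ z : ℂ, 1 / 2 < z.re → 1 / 2 + z ∉ ZS := by
    intro z hz h
    have := ZS_re hRH h
    simp at this; linarith
  have hn1 : ∀ z : ℂ, 1 / 2 < z.re → 1 / 2 + z ≠ 1 := by
    intro z hz h
    have := congrArg Complex.re h
    simp at this; linarith
  have hM : ∀ z : ℂ, 1 / 2 < z.re → logDeriv riemannZeta₁ (1 / 2 + z) = MM z + 1 / (z - 1 / 2) := by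
    intro z hz
    rw [logDeriv_zeta1 (hn1 z hz) (hnz z hz), MM]; congr 2; ring
  have hMb : logDeriv riemannZeta₁ (1 / 2 + b) = MM b + 1 / (b - 1 / 2) := by
    rw [logDeriv_zeta1 _ hb, MM]
    · congr 2; ring
    · intro h; apply hb1; linear_combination h
  -- zero sum
  have L1 : LTr k (fun u => ∑' ρ : ZS, (zetaMult ρ : ℂ) * (1 / (1 / 2 + a - ρ) - 1 / (1 / 2 + b - ρ)) *
        Complex.exp (((ρ : ℂ) - 1 / 2) * u)) (fun z => ∑' ρ : ZS,
        (zetaMult ρ : ℂ) * (1 / (1 / 2 + a - ρ) - 1 / (1 / 2 + b - ρ)) * (1 / (z - ((ρ : ℂ) - 1 / 2)))) := by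
    refine LTr_tsum (fun ρ => LTr.const_mul _ (LTr_exp ?_)) (zero_summable2 hRH (hnz a ha) hb) ?_
    · have := ZS_re hRH ρ.2
      simp; linarith
    · intro ρ u hu
      rw [norm_mul]
      gcongr
      rw [Complex.norm_exp]
      refine Real.exp_le_exp.2 ?_
      have := ZS_re hRH ρ.2
      simp only [Complex.mul_re, Complex.ofReal_re, Complex.ofReal_im, mul_zero, sub_zero]
      gcongr
      simp; linarith
  have L2 : LTr k (fun u => ∑' n : ℕ, (lam n : ℂ) * EE a b (u - Real.log n)) (fun z => ∑' n : ℕ,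
      (lam n : ℂ) * (Complex.exp (-z * (Real.log n : ℝ)) / (z - b) +
      (Complex.exp (-a * (Real.log n : ℝ)) - Complex.exp (-z * (Real.log n : ℝ))) / (z - a))) := by
    refine LTr_tsum (fun n => LTr.const_mul _ (LTr_EE hab le_rfl (Real.log_natCast_nonneg n)))
      (lam_summable ha) ?_
    intro n u hu
    rw [norm_mul, Complex.norm_real, Real.norm_of_nonneg (lam_nonneg n), mul_assoc, ← Real.exp_add]
    have := lam_nonneg n
    gcongr
    refine (EE_bound hab _).trans (Real.exp_le_exp.2 ?_)
    linarith
  have L3 := (LTr_exp (k := k) (l := 1 / 2) (by norm_num; linarith)).const_mul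
    (-(1 / (a - 1 / 2) - 1 / (b - 1 / 2)))
  have L4 := (LTr_exp (k := k) (l := b) hab).const_mul (MM b)
  have L := ((L1.add L2).add L3).add L4
  have hz := LTr_zero (L.congr (g' := fun _ => 0) ?_) u hu
  · linear_combination hz
  intro z hz
  have hz2 : 1 / 2 < z.re := by linarith
  have hne : ∀ w : ℂ, w.re < z.re → z - w ≠ 0 := by
    intro w hw h
    have := congrArg Complex.re h
    simp at this; linarith
  have hza := hne a hz
  have hzb := hne b (by linarith)
  have hzh := hne (1 / 2) (by norm_num; linarith)
  have hah : a - 1 / 2 ≠ 0 := by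
    intro h
    have := congrArg Complex.re h
    norm_num at this; linarith
  have hbh : b - 1 / 2 ≠ 0 := sub_ne_zero.2 hb1
  have s1 : HasSum (fun ρ : ZS =>
        (zetaMult ρ : ℂ) * (1 / (1 / 2 + a - ρ) - 1 / (1 / 2 + b - ρ)) * (1 / (z - ((ρ : ℂ) - 1 / 2))))
      ((logDeriv riemannZeta₁ (1 / 2 + a) - logDeriv riemannZeta₁ (1 / 2 + z)) * (1 / (z - a)) -
        (logDeriv riemannZeta₁ (1 / 2 + b) - logDeriv riemannZeta₁ (1 / 2 + z)) * (1 / (z - b))) := by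
    have q1 := (pf_zeta hRH (hnz a ha) (hnz z hz2)).mul_right (1 / (z - a))
    have q2 := (pf_zeta hRH hb (hnz z hz2)).mul_right (1 / (z - b))
    refine (q1.sub q2).congr_fun fun ρ => ?_
    have n1 : 1 / 2 + a - (ρ : ℂ) ≠ 0 := fun h => hnz a ha (by rw [sub_eq_zero.1 h]; exact ρ.2)
    have n2 : 1 / 2 + b - (ρ : ℂ) ≠ 0 := fun h => hb (by rw [sub_eq_zero.1 h]; exact ρ.2)
    have n3 : 1 / 2 + z - (ρ : ℂ) ≠ 0 := fun h => hnz z hz2 (by rw [sub_eq_zero.1 h]; exact ρ.2)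
    have n4 : z - ((ρ : ℂ) - 1 / 2) = 1 / 2 + z - ρ := by ring
    rw [n4]
    have e1 : (1 / (1 / 2 + a - (ρ : ℂ)) - 1 / (1 / 2 + z - (ρ : ℂ))) * (1 / (z - a)) =
        1 / (1 / 2 + a - (ρ : ℂ)) * (1 / (1 / 2 + z - (ρ : ℂ))) := by
      rw [div_sub_div _ _ n1 n3, div_mul_div_comm, div_mul_div_comm, div_eq_div_iff
        (mul_ne_zero (mul_ne_zero n1 n3) hza) (mul_ne_zero n1 n3)]
      ring
    have e2 : (1 / (1 / 2 + b - (ρ : ℂ)) - 1 / (1 / 2 + z - (ρ : ℂ))) * (1 / (z - b)) =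
        1 / (1 / 2 + b - (ρ : ℂ)) * (1 / (1 / 2 + z - (ρ : ℂ))) := by
      rw [div_sub_div _ _ n2 n3, div_mul_div_comm, div_mul_div_comm, div_eq_div_iff
        (mul_ne_zero (mul_ne_zero n2 n3) hzb) (mul_ne_zero n2 n3)]
      ring
    linear_combination (zetaMult (ρ : ℂ) : ℂ) * (e2 - e1)
  have s2 : HasSum (fun n : ℕ => (lam n : ℂ) * (Complex.exp (-z * (Real.log n : ℝ)) / (z - b) +
      (Complex.exp (-a * (Real.log n : ℝ)) - Complex.exp (-z * (Real.log n : ℝ))) / (z - a)))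
      ((-MM z) * (1 / (z - b)) + (-MM a - -MM z) * (1 / (z - a))) := by
    have q1 := (MM_hasSum hz2).mul_right (1 / (z - b))
    have q2 := ((MM_hasSum ha).sub (MM_hasSum hz2)).mul_right (1 / (z - a))
    refine (q1.add q2).congr_fun fun n => ?_
    ring
  rw [s1.tsum_eq, s2.tsum_eq, hM a ha, hM z hz2, hMb]
  have f1 : (1 / (a - 1 / 2) - 1 / (z - 1 / 2)) * (1 / (z - a)) = 1 / (a - 1 / 2) * (1 / (z - 1 / 2)) := by
    rw [div_sub_div _ _ hah hzh, div_mul_div_comm, div_mul_div_comm, div_eq_div_iff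
      (mul_ne_zero (mul_ne_zero hah hzh) hza) (mul_ne_zero hah hzh)]
    ring
  have f2 : (1 / (b - 1 / 2) - 1 / (z - 1 / 2)) * (1 / (z - b)) = 1 / (b - 1 / 2) * (1 / (z - 1 / 2)) := by
    rw [div_sub_div _ _ hbh hzh, div_mul_div_comm, div_mul_div_comm, div_eq_div_iff
      (mul_ne_zero (mul_ne_zero hbh hzh) hzb) (mul_ne_zero hbh hzh)]
    ring
  linear_combination f1 - f2

/-! Part 6 of the proof. -/
lemma gs_prod_lower {σ : ℝ} (h1 : 1 ≤ σ) (h2 : σ ≤ 2) (n : ℕ) :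
    (n.factorial : ℝ) * ((n : ℝ) + 1) ^ (σ - 1) ≤ ∏ j ∈ Finset.range n, (σ + j) := by
  induction n with
  | zero => simp
  | succ n ih =>
    rw [Finset.prod_range_succ, Nat.factorial_succ]
    have hb := rpow_one_add_le_one_add_mul_self (s := 1 / ((n : ℝ) + 1)) (p := σ - 1)
      (by have : (0 : ℝ) ≤ 1 / ((n : ℝ) + 1) := by positivity
          linarith) (by linarith) (by linarith)
    have e : ((n : ℝ) + 1 + 1) ^ (σ - 1) = (n + 1 : ℝ) ^ (σ - 1) * (1 + 1 / ((n : ℝ) + 1)) ^ (σ - 1) := by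
      rw [← Real.mul_rpow (by positivity) (by positivity)]
      congr 1
      field_simp
    have e2 : σ + n = (n + 1) * (1 + (σ - 1) * (1 / ((n : ℝ) + 1))) := by
      field_simp; ring
    push_cast
    rw [e, e2]
    calc ((n : ℝ) + 1) * n.factorial * ((n + 1 : ℝ) ^ (σ - 1) * (1 + 1 / ((n : ℝ) + 1)) ^ (σ - 1))
        = (n.factorial * (n + 1 : ℝ) ^ (σ - 1)) * ((n + 1) * (1 + 1 / ((n : ℝ) + 1)) ^ (σ - 1)) := by ring
      _ ≤ _ := by
        refine mul_le_mul ih ?_ (by positivity) ?_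
        · gcongr
        · exact Finset.prod_nonneg fun j _ => by positivity

lemma gs_bound {w : ℂ} (h1 : 1 ≤ w.re) (h2 : w.re ≤ 2) {n : ℕ} (hn : 1 ≤ n) : ‖Complex.GammaSeq w n‖ ≤ 1 := by
  unfold Complex.GammaSeq
  have hn0 : (0 : ℝ) < n := by exact_mod_cast hn
  rw [norm_div, norm_mul, norm_prod, Complex.norm_natCast, Complex.norm_natCast_cpow_of_pos hn]
  have hp : (((n + 1).factorial : ℕ) : ℝ) * (((n + 1 : ℕ) : ℝ) + 1) ^ (w.re - 1) ≤
      ∏ j ∈ Finset.range (n + 1), ‖w + j‖ := by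
    refine (gs_prod_lower h1 h2 (n + 1)).trans ?_
    refine Finset.prod_le_prod (fun j _ => by positivity) fun j _ => ?_
    have := Complex.re_le_norm (w + j)
    simpa using this
  have hpos : 0 < (((n + 1).factorial : ℕ) : ℝ) * (((n + 1 : ℕ) : ℝ) + 1) ^ (w.re - 1) := by positivity
  rw [div_le_one (hpos.trans_le hp)]
  refine le_trans ?_ hp
  rw [Nat.factorial_succ]
  push_cast
  have e : (n : ℝ) ^ w.re = n * (n : ℝ) ^ (w.re - 1) := by
    rw [Real.rpow_sub_one hn0.ne']; field_simp
  rw [e]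
  have : (n : ℝ) ^ (w.re - 1) ≤ ((n : ℝ) + 1 + 1) ^ (w.re - 1) := by
    gcongr
    · linarith
  calc (n : ℝ) * (n : ℝ) ^ (w.re - 1) * n.factorial ≤ (n + 1) * ((n : ℝ) + 1 + 1) ^ (w.re - 1) * n.factorial := by
        gcongr; linarith
    _ = _ := by ring

lemma gs_diff {w : ℂ} (h : 0 < w.re) {n : ℕ} (hn : 1 ≤ n) : DifferentiableAt ℂ (fun s => Complex.GammaSeq s n) w := by
  unfold Complex.GammaSeq
  refine DifferentiableAt.div ?_ ?_ ?_
  · refine DifferentiableAt.mul_const (DifferentiableAt.const_cpow (by fun_prop) (Or.inl ?_)) _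
    exact_mod_cast (by omega : n ≠ 0)
  · fun_prop
  · refine Finset.prod_ne_zero_iff.2 fun j _ h0 => ?_
    have := congrArg Complex.re h0
    simp at this
    have : (0 : ℝ) ≤ j := j.cast_nonneg
    linarith

lemma gs_logDeriv {w : ℂ} (h : 0 < w.re) {n : ℕ} (hn : 1 ≤ n) :
    logDeriv (fun s => Complex.GammaSeq s n) w = (Real.log n : ℂ) - ∑ j ∈ Finset.range (n + 1), 1 / (w + j) := by
  have hn0 : (n : ℂ) ≠ 0 := by exact_mod_cast (by omega : n ≠ 0)
  have hf0 : (n.factorial : ℂ) ≠ 0 := by exact_mod_cast n.factorial_ne_zero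
  have hj : ∀ j : ℕ, w + j ≠ 0 := by
    intro j h0
    have := congrArg Complex.re h0
    simp at this
    have : (0 : ℝ) ≤ j := j.cast_nonneg
    linarith
  have hd : DifferentiableAt ℂ (fun s : ℂ => (n : ℂ) ^ s) w :=
    DifferentiableAt.const_cpow (by fun_prop) (Or.inl hn0)
  unfold Complex.GammaSeq
  rw [logDeriv_div (f := fun s : ℂ => (n : ℂ) ^ s * (n.factorial : ℂ))
    (g := fun s : ℂ => ∏ j ∈ Finset.range (n + 1), (s + (j : ℂ)))]
  · congr 1
    · have hd2 : HasDerivAt (fun s : ℂ => (n : ℂ) ^ s * (n.factorial : ℂ)) ((n : ℂ) ^ w * Complex.log n * n.factorial) w := by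
        have := ((hasDerivAt_id w).const_cpow (c := (n : ℂ)) (Or.inl hn0)).mul_const (n.factorial : ℂ)
        simpa using this
      rw [logDeriv_apply, hd2.deriv, ← Complex.natCast_log]
      have : (n : ℂ) ^ w ≠ 0 := by simp [Complex.cpow_eq_zero_iff, hn0]
      field_simp
    · rw [logDeriv_prod (fun j _ => hj j) (fun j _ => by fun_prop)]
      refine Finset.sum_congr rfl fun j _ => ?_
      simp [logDeriv_apply]
  · refine mul_ne_zero ?_ hf0
    simp [Complex.cpow_eq_zero_iff, hn0]
  · exact Finset.prod_ne_zero_iff.2 fun j _ => hj j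
  · exact hd.mul_const _
  · fun_prop

lemma gs_deriv_tendsto {s : ℂ} (hs : s.re = 3 / 2) :
    Tendsto (fun n : ℕ => deriv (fun s => Complex.GammaSeq s n) s) atTop (nhds (deriv Complex.Gamma s)) := by
  have hre : ∀ w ∈ Metric.closedBall s (1 / 2), 1 ≤ w.re ∧ w.re ≤ 2 := by
    intro w hw
    rw [Metric.mem_closedBall, dist_eq_norm] at hw
    have := abs_le.1 ((Complex.abs_re_le_norm (w - s)).trans hw)
    simp [hs] at this
    constructor <;> linarith [this.1, this.2]
  have hG : DiffContOnCl ℂ Complex.Gamma (Metric.ball s (1 / 2)) := by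
    refine DifferentiableOn.diffContOnCl fun w hw => ?_
    rw [closure_ball _ (by norm_num)] at hw
    refine (Complex.differentiableAt_Gamma _ fun m hm => ?_).differentiableWithinAt
    have := (hre w hw).1
    rw [hm] at this
    have : (0 : ℝ) ≤ m := m.cast_nonneg
    simp at *; linarith
  have hGn : ∀ n : ℕ, 1 ≤ n → DiffContOnCl ℂ (fun s => Complex.GammaSeq s n) (Metric.ball s (1 / 2)) := by
    intro n hn
    refine DifferentiableOn.diffContOnCl fun w hw => ?_
    rw [closure_ball _ (by norm_num)] at hw
    exact (gs_diff (by linarith [(hre w hw).1]) hn).differentiableWithinAt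
  have hI : (2 * (π : ℂ) * I) ≠ 0 := by simp [Real.pi_ne_zero]
  have h1 := hG.deriv_eq_smul_circleIntegral (by norm_num)
  have e0 : deriv Complex.Gamma s = (2 * (π : ℂ) * I)⁻¹ • ∮ z in C(s, 1 / 2), (1 / (z - s) ^ 2) • Complex.Gamma z := by
    rw [h1, smul_smul, inv_mul_cancel₀ hI, one_smul]
  rw [e0]
  have e1 : ∀ᶠ n : ℕ in atTop, (2 * (π : ℂ) * I)⁻¹ • (∮ z in C(s, 1 / 2), (1 / (z - s) ^ 2) • Complex.GammaSeq z n) =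
      deriv (fun s => Complex.GammaSeq s n) s := by
    filter_upwards [eventually_ge_atTop 1] with n hn
    rw [(hGn n hn).deriv_eq_smul_circleIntegral (by norm_num), smul_smul, inv_mul_cancel₀ hI, one_smul]
  refine Tendsto.congr' e1 ?_
  refine Tendsto.const_smul ?_ _
  unfold circleIntegral
  have hmem : ∀ θ : ℝ, circleMap s (1 / 2) θ ∈ Metric.closedBall s (1 / 2) := fun θ =>
    circleMap_mem_closedBall s (by norm_num) θ
  refine intervalIntegral.tendsto_integral_filter_of_dominated_convergence (fun _ => 2) ?_ ?_ ?_ ?_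
  · filter_upwards [eventually_ge_atTop 1] with n hn
    refine Continuous.aestronglyMeasurable ?_
    have c1 : Continuous (fun θ => Complex.GammaSeq (circleMap s (1 / 2) θ) n) := by
      refine continuous_iff_continuousAt.2 fun θ => ?_
      exact ContinuousAt.comp (f := circleMap s (1 / 2)) (g := fun z => Complex.GammaSeq z n)
        (gs_diff (by linarith [(hre _ (hmem θ)).1]) hn).continuousAt (continuous_circleMap _ _).continuousAt
    have c2 : Continuous (fun θ => 1 / (circleMap s (1 / 2) θ - s) ^ 2) := by
      refine Continuous.div continuous_const (by fun_prop) fun θ => ?_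
      refine pow_ne_zero _ (sub_ne_zero.2 (circleMap_ne_center (by norm_num)))
    simp only [deriv_circleMap]
    exact ((continuous_circleMap 0 (1 / 2)).mul continuous_const).smul (c2.smul c1)
  · filter_upwards [eventually_ge_atTop 1] with n hn
    refine Eventually.of_forall fun θ _ => ?_
    rw [norm_smul, norm_smul, deriv_circleMap]
    have := gs_bound (hre _ (hmem θ)).1 (hre _ (hmem θ)).2 hn
    have e2 : ‖circleMap 0 (1 / 2) θ * I‖ = 1 / 2 := by simp [abs_of_pos]
    have e3 : ‖1 / (circleMap s (1 / 2) θ - s) ^ 2‖ = 4 := by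
      rw [norm_div, norm_pow]; simp [circleMap]; norm_num
    rw [e2, e3]; linarith
  · exact intervalIntegrable_const
  · refine Eventually.of_forall fun θ _ => ?_
    exact ((Complex.GammaSeq_tendsto_Gamma _).const_smul _).const_smul _

lemma digamma_tendsto {s : ℂ} (hs : s.re = 3 / 2) :
    Tendsto (fun n : ℕ => (Real.log n : ℂ) - ∑ j ∈ Finset.range (n + 1), 1 / (s + j)) atTop
      (nhds (logDeriv Complex.Gamma s)) := by
  have hG : Complex.Gamma s ≠ 0 := Complex.Gamma_ne_zero_of_re_pos (by rw [hs]; norm_num)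
  have := (gs_deriv_tendsto hs).div (Complex.GammaSeq_tendsto_Gamma s) hG
  rw [logDeriv_apply]
  refine this.congr' ?_
  filter_upwards [eventually_ge_atTop 1] with n hn
  rw [← gs_logDeriv (by rw [hs]; norm_num) hn, logDeriv_apply]
  rfl

lemma log_step {z : ℂ} (hz : 3 / 2 ≤ z.re) :
    ‖1 / z - (Complex.log (z + 1) - Complex.log z)‖ ≤ 2 * (1 / z.re ^ 2) := by
  have hz0 : z ≠ 0 := by rintro rfl; norm_num at hz
  have hzn : z.re ≤ ‖z‖ := Complex.re_le_norm z
  have hv : ‖1 / z‖ ≤ 1 / z.re := by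
    rw [norm_div, norm_one]; gcongr
  have hv2 : ‖1 / z‖ ≤ 2 / 3 := hv.trans (by
    rw [div_le_div_iff₀ (by linarith) (by norm_num)]; linarith)
  have hre : 0 < (1 + 1 / z).re := by
    have := (abs_le.1 ((Complex.abs_re_le_norm (1 / z)).trans hv2)).1
    rw [Complex.add_re, Complex.one_re]; linarith
  have h1 : Complex.log (z + 1) = Complex.log z + Complex.log (1 + 1 / z) := by
    have : z + 1 = z * (1 + 1 / z) := by field_simp
    rw [this, Complex.log_mul_eq_add_log_iff hz0 (by rintro h; rw [h] at hre; simp at hre)]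
    have a1 := abs_lt.1 (Complex.abs_arg_lt_pi_div_two_iff.2 (Or.inl (show 0 < z.re by linarith)))
    have a2 := abs_lt.1 (Complex.abs_arg_lt_pi_div_two_iff.2 (Or.inl hre))
    constructor <;> linarith [a1.1, a1.2, a2.1, a2.2]
  rw [h1, add_sub_cancel_left, norm_sub_rev]
  refine (Complex.norm_log_one_add_sub_self_le (by linarith)).trans ?_
  have h3 : (1 - ‖1 / z‖)⁻¹ ≤ 3 := by
    rw [inv_le_comm₀ (by linarith) (by norm_num)]; linarith
  have h4 : ‖1 / z‖ ^ 2 ≤ 1 / z.re ^ 2 := by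
    calc ‖1 / z‖ ^ 2 ≤ (1 / z.re) ^ 2 := by gcongr
      _ = _ := by rw [div_pow, one_pow]
  have h5 : 0 ≤ 1 / z.re ^ 2 := by positivity
  have h6 : ‖1 / z‖ ^ 2 * (1 - ‖1 / z‖)⁻¹ ≤ (1 / z.re ^ 2) * 3 :=
    mul_le_mul h4 h3 (inv_nonneg.2 (by linarith)) h5
  linarith

lemma digamma_bound : ∃ C : ℝ, ∀ s : ℂ, s.re = 3 / 2 → ‖logDeriv Complex.Gamma s - Complex.log s‖ ≤ C := by
  have hsum : Summable (fun j : ℕ => 2 * (1 / (3 / 2 + (j : ℝ)) ^ 2)) := by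
    have h : Summable (fun k : ℕ => 1 / ((k + 1 : ℕ) : ℝ) ^ 2) :=
      (summable_nat_add_iff 1).2 (Real.summable_one_div_nat_pow.2 (by norm_num))
    refine (h.mul_left 2).of_nonneg_of_le (fun j => by positivity) fun j => ?_
    gcongr
    push_cast; linarith
  refine ⟨∑' j : ℕ, 2 * (1 / (3 / 2 + (j : ℝ)) ^ 2), fun s hs => ?_⟩
  have hlog : Tendsto (fun n : ℕ => (Real.log n : ℂ) - Complex.log (s + (n + 1 : ℕ))) atTop (nhds 0) := by
    have h1 : Tendsto (fun n : ℕ => 1 + (s + 1) / (n : ℂ)) atTop (nhds (1 + 0)) :=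
      tendsto_const_nhds.add (tendsto_const_div_atTop_nhds_zero_nat _)
    have h2 : Tendsto (fun n : ℕ => -Complex.log (1 + (s + 1) / (n : ℂ))) atTop (nhds (-Complex.log (1 + 0))) :=
      (h1.clog (by simp)).neg
    simp only [add_zero, Complex.log_one, neg_zero] at h2
    refine h2.congr' ?_
    filter_upwards [eventually_ge_atTop 1] with n hn
    have hn0 : (0 : ℝ) < n := by exact_mod_cast hn
    have hn1 : (n : ℂ) ≠ 0 := by exact_mod_cast hn0.ne'
    have e : s + (n + 1 : ℕ) = ((n : ℝ) : ℂ) * (1 + (s + 1) / (n : ℂ)) := by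
      push_cast; field_simp; ring
    rw [e, Complex.log_ofReal_mul hn0]
    · ring
    · intro h0
      have : s + (n + 1 : ℕ) = 0 := by rw [e, h0, mul_zero]
      have := congrArg Complex.re this
      simp [hs] at this
      linarith
  have hlim := ((digamma_tendsto hs).sub hlog).sub (tendsto_const_nhds (x := Complex.log s))
  rw [sub_zero] at hlim
  refine le_of_tendsto hlim.norm (Eventually.of_forall fun n => ?_)
  have e : (Real.log n : ℂ) - ∑ j ∈ Finset.range (n + 1), 1 / (s + j) -
      ((Real.log n : ℂ) - Complex.log (s + (n + 1 : ℕ))) - Complex.log s =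
      -∑ j ∈ Finset.range (n + 1), (1 / (s + j) - (Complex.log (s + j + 1) - Complex.log (s + j))) := by
    have h := Finset.sum_range_sub (fun j : ℕ => Complex.log (s + j)) (n + 1)
    rw [Finset.sum_sub_distrib]
    have : ∑ j ∈ Finset.range (n + 1), (Complex.log (s + j + 1) - Complex.log (s + j)) =
        Complex.log (s + (n + 1 : ℕ)) - Complex.log s := by
      rw [← add_zero s, ← Nat.cast_zero (R := ℂ)]
      simp only [Nat.cast_zero, add_zero]
      have h' := h
      simp only [Nat.cast_zero, add_zero] at h'
      rw [← h']
      refine Finset.sum_congr rfl fun j _ => ?_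
      push_cast; ring_nf
    rw [this]; ring
  rw [e, norm_neg]
  refine (norm_sum_le _ _).trans (le_trans (Finset.sum_le_sum fun j _ => ?_)
    (hsum.sum_le_tsum (Finset.range (n + 1)) fun j _ => by positivity))
  have hj : (0 : ℝ) ≤ j := j.cast_nonneg
  have := log_step (z := s + j) (by simp [hs])
  simpa [hs] using this

/-! Part 7 of the proof. -/
lemma MM_func {s : ℂ} (hs : s.re = 3 / 2) :
    logDeriv riemannZeta (1 - s) = (Real.log (2 * π) : ℂ) - logDeriv Complex.Gamma s
      + (π / 2) * Complex.tan (π * s / 2) - logDeriv riemannZeta s ∧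
    ‖Complex.tan (π * s / 2)‖ ≤ 1 := by
  have hcos : ‖Complex.cos (π * s / 2)‖ ^ 2 = 1 / 2 + Real.sinh (π * s.im / 2) ^ 2 := by
    have e : (π * s / 2 : ℂ) = ((3 / 4 * π : ℝ) : ℂ) + ((π * s.im / 2 : ℝ) : ℂ) * I := by
      apply Complex.ext <;> simp [hs] <;> ring
    rw [e, Complex.cos_add_mul_I]
    rw [← Complex.normSq_eq_norm_sq, ← Complex.ofReal_cos, ← Complex.ofReal_sin, ← Complex.ofReal_cosh, ← Complex.ofReal_sinh]
    have h1 : Real.cos (3 / 4 * π) ^ 2 = 1 / 2 := by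
      rw [Real.cos_sq, show 2 * (3 / 4 * π) = π / 2 + π by ring, Real.cos_add_pi]; simp
    have h2 : Real.sin (3 / 4 * π) ^ 2 = 1 / 2 := by
      have := Real.sin_sq_add_cos_sq (3 / 4 * π); linarith
    have h3 := Real.cosh_sq (π * s.im / 2)
    simp only [Complex.normSq_apply]
    simp only [Complex.sub_re, Complex.sub_im, ← Complex.ofReal_mul, Complex.re_ofReal_mul, Complex.im_ofReal_mul, Complex.ofReal_re, Complex.ofReal_im, Complex.I_re, Complex.I_im]
    ring_nf
    ring_nf at h1 h2 h3
    rw [h1, h2, h3]; ring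
  have hsin : ‖Complex.sin (π * s / 2)‖ ^ 2 = 1 / 2 + Real.sinh (π * s.im / 2) ^ 2 := by
    have e : (π * s / 2 : ℂ) = ((3 / 4 * π : ℝ) : ℂ) + ((π * s.im / 2 : ℝ) : ℂ) * I := by
      apply Complex.ext <;> simp [hs] <;> ring
    rw [e, Complex.sin_add_mul_I]
    rw [← Complex.normSq_eq_norm_sq, ← Complex.ofReal_cos, ← Complex.ofReal_sin, ← Complex.ofReal_cosh, ← Complex.ofReal_sinh]
    have h1 : Real.cos (3 / 4 * π) ^ 2 = 1 / 2 := by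
      rw [Real.cos_sq, show 2 * (3 / 4 * π) = π / 2 + π by ring, Real.cos_add_pi]; simp
    have h2 : Real.sin (3 / 4 * π) ^ 2 = 1 / 2 := by
      have := Real.sin_sq_add_cos_sq (3 / 4 * π); linarith
    have h3 := Real.cosh_sq (π * s.im / 2)
    simp only [Complex.normSq_apply]
    simp only [Complex.add_re, Complex.add_im, ← Complex.ofReal_mul, Complex.re_ofReal_mul, Complex.im_ofReal_mul, Complex.ofReal_re, Complex.ofReal_im, Complex.I_re, Complex.I_im]
    ring_nf
    ring_nf at h1 h2 h3
    rw [h1, h2, h3]; ring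
  have hc0 : Complex.cos (π * s / 2) ≠ 0 := by
    intro h; rw [h] at hcos; simp at hcos
    have : 0 ≤ Real.sinh (π * s.im / 2) ^ 2 := sq_nonneg _
    linarith
  have hne : ∀ {w : ℂ}, 1 < w.re → (∀ n : ℕ, w ≠ -n) ∧ w ≠ 1 := by
    intro w hw
    refine ⟨fun n h => ?_, fun h => ?_⟩
    · rw [h] at hw; simp at hw
      have : (0 : ℝ) ≤ n := n.cast_nonneg
      linarith
    · rw [h] at hw; simp at hw
  have hs1 : 1 < s.re := by rw [hs]; norm_num
  have hG0 : Complex.Gamma s ≠ 0 := Complex.Gamma_ne_zero_of_re_pos (by linarith)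
  have hz0 : riemannZeta s ≠ 0 := riemannZeta_ne_zero_of_one_lt_re hs1
  have hdG : DifferentiableAt ℂ Complex.Gamma s := Complex.differentiableAt_Gamma _ (hne hs1).1
  have hdz : DifferentiableAt ℂ riemannZeta s := differentiableAt_riemannZeta (hne hs1).2
  have h2pi : (2 * π : ℂ) ≠ 0 := by simp [Real.pi_ne_zero]
  have hp : HasDerivAt (fun s : ℂ => 2 * (2 * π : ℂ) ^ (-s)) (2 * ((2 * π : ℂ) ^ (-s) * Complex.log (2 * π) * (-1))) s :=
    (((hasDerivAt_id s).neg).const_cpow (Or.inl h2pi)).const_mul 2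
  have hp0 : (2 * (2 * π : ℂ) ^ (-s)) ≠ 0 := by
    refine mul_ne_zero two_ne_zero ?_
    rw [Complex.cpow_def_of_ne_zero h2pi]; exact Complex.exp_ne_zero _
  have hcd : HasDerivAt (fun s : ℂ => Complex.cos (π * s / 2)) (-Complex.sin (π * s / 2) * (π / 2)) s := by
    have : HasDerivAt (fun s : ℂ => (π * s / 2 : ℂ)) (π / 2) s := by
      simpa using ((hasDerivAt_id s).const_mul (π : ℂ)).div_const 2
    exact this.ccos
  constructor
  · have hev : (fun w => riemannZeta (1 - w)) =ᶠ[nhds s] fun w => 2 * (2 * π : ℂ) ^ (-w) * Complex.Gamma w * Complex.cos (π * w / 2) * riemannZeta w := by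
      have : ∀ᶠ w in nhds s, 1 < w.re := Complex.continuous_re.continuousAt.eventually_const_lt hs1
      filter_upwards [this] with w hw
      exact riemannZeta_one_sub (hne hw).1 (hne hw).2
    have hl : logDeriv (fun w => riemannZeta (1 - w)) s = -logDeriv riemannZeta (1 - s) := by
      have h1 : (1 : ℂ) - s ≠ 1 := by
        intro h; have := congrArg Complex.re h; simp [hs] at this
      have := logDeriv_comp (f := riemannZeta) (g := fun w => 1 - w) (x := s) (differentiableAt_riemannZeta h1) (by fun_prop)
      rw [show (riemannZeta ∘ fun w => 1 - w) = fun w => riemannZeta (1 - w) from rfl] at this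
      rw [this]; simp
    have hr : logDeriv (fun w => 2 * (2 * π : ℂ) ^ (-w) * Complex.Gamma w * Complex.cos (π * w / 2) * riemannZeta w) s =
        -(Real.log (2 * π) : ℂ) + logDeriv Complex.Gamma s - (π / 2) * Complex.tan (π * s / 2) + logDeriv riemannZeta s := by
      rw [logDeriv_mul (f := fun w => 2 * (2 * π : ℂ) ^ (-w) * Complex.Gamma w * Complex.cos (π * w / 2)) (g := riemannZeta) s
        (mul_ne_zero (mul_ne_zero hp0 hG0) hc0) hz0 ((hp.differentiableAt.mul hdG).mul hcd.differentiableAt) hdz,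
        logDeriv_mul (f := fun w => 2 * (2 * π : ℂ) ^ (-w) * Complex.Gamma w) (g := fun w => Complex.cos (π * w / 2)) s
        (mul_ne_zero hp0 hG0) hc0 (hp.differentiableAt.mul hdG) hcd.differentiableAt,
        logDeriv_mul (f := fun w => 2 * (2 * π : ℂ) ^ (-w)) (g := Complex.Gamma) s hp0 hG0 hp.differentiableAt hdG]
      have e1 : logDeriv (fun s : ℂ => 2 * (2 * π : ℂ) ^ (-s)) s = -(Real.log (2 * π) : ℂ) := by
        rw [logDeriv_apply, hp.deriv]
        have : ((Real.log (2 * π) : ℝ) : ℂ) = Complex.log (2 * π) := by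
          rw [Complex.ofReal_log (by positivity)]; push_cast; rfl
        rw [this]
        have := hp0
        field_simp
      have e2 : logDeriv (fun w : ℂ => Complex.cos (π * w / 2)) s = -((π / 2) * Complex.tan (π * s / 2)) := by
        rw [logDeriv_apply, hcd.deriv, Complex.tan]; ring
      rw [e1, e2]; ring
    have : logDeriv (fun w => riemannZeta (1 - w)) s = logDeriv (fun w => 2 * (2 * π : ℂ) ^ (-w) * Complex.Gamma w * Complex.cos (π * w / 2) * riemannZeta w) s := by
      rw [logDeriv_apply, logDeriv_apply, hev.deriv_eq]
      congr 1
      exact hev.self_of_nhds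
    rw [hl, hr] at this
    linear_combination -this
  · rw [Complex.tan, norm_div]
    have : ‖Complex.sin (π * s / 2)‖ = ‖Complex.cos (π * s / 2)‖ := by
      rw [← sq_eq_sq₀ (norm_nonneg _) (norm_nonneg _), hsin, hcos]
    rw [this, div_self (norm_ne_zero_iff.2 hc0)]

lemma MM_bound : ∃ C : ℝ, 0 ≤ C ∧ ∀ t : ℝ, ‖MM (-1 + t * I) + (Real.log (|t| + 2) : ℂ)‖ ≤ C := by
  obtain ⟨C, hC⟩ := digamma_bound
  set B := ∑' n : ℕ, lam n * Real.exp (-1 * Real.log n) with hB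
  have key : ∀ t : ℝ, ‖MM (-1 + t * I) + (Real.log (|t| + 2) : ℂ)‖ ≤ |Real.log (2 * π)| + C + Real.log 3 + π + π + B := by
    intro t
    set s : ℂ := 3 / 2 - t * I with hsdef
    have hsre : s.re = 3 / 2 := by simp [hsdef]
    have hsim : s.im = -t := by simp [hsdef]
    obtain ⟨h1, h2⟩ := MM_func hsre
    have e1 : MM (-1 + t * I) = logDeriv riemannZeta (1 - s) := by
      rw [MM]; congr 1; rw [hsdef]; ring
    have hMM : ‖logDeriv riemannZeta s‖ ≤ B := by
      have h := MM_hasSum (z := 1 - t * I) (by simp; norm_num)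
      have e2 : logDeriv riemannZeta s = MM (1 - t * I) := by
        rw [MM]; congr 1; rw [hsdef]; ring
      rw [e2, ← norm_neg, ← h.tsum_eq]
      refine tsum_of_norm_bounded (lam_summable (c := 1) (by norm_num)).hasSum fun n => ?_
      rw [norm_mul, Complex.norm_real, Real.norm_of_nonneg (lam_nonneg n), Complex.norm_exp, Complex.re_mul_ofReal]
      simp
    have hlog : ‖Complex.log s - (Real.log (|t| + 2) : ℂ)‖ ≤ Real.log 3 + π := by
      have hs0 : s ≠ 0 := by intro h; rw [h] at hsre; norm_num at hsre
      have e3 : Complex.log s - (Real.log (|t| + 2) : ℂ) = ((Real.log ‖s‖ - Real.log (|t| + 2) : ℝ) : ℂ) + (s.arg : ℂ) * I := by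
        rw [Complex.log]; push_cast; ring
      rw [e3]
      refine (norm_add_le _ _).trans (add_le_add ?_ ?_)
      · rw [Complex.norm_real, Real.norm_eq_abs]
        have u1 : ‖s‖ ≤ |t| + 2 := by
          refine (Complex.norm_le_abs_re_add_abs_im s).trans ?_
          rw [hsre, hsim, abs_neg, abs_of_pos (by norm_num : (0 : ℝ) < 3 / 2)]; linarith
        have u2 : |t| + 2 ≤ 3 * ‖s‖ := by
          have a1 := Complex.abs_re_le_norm s
          have a2 := Complex.abs_im_le_norm s
          rw [hsre, abs_of_pos (by norm_num : (0 : ℝ) < 3 / 2)] at a1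
          rw [hsim, abs_neg] at a2
          linarith
        have hp : 0 < ‖s‖ := norm_pos_iff.2 hs0
        have v1 := Real.log_le_log hp u1
        have v2 := Real.log_le_log (by positivity) u2
        rw [Real.log_mul (by norm_num) hp.ne'] at v2
        have v3 := Real.log_nonneg (by norm_num : (1 : ℝ) ≤ 3)
        rw [abs_le]; constructor <;> linarith
      · rw [norm_mul, Complex.norm_I, mul_one, Complex.norm_real]
        exact Complex.abs_arg_le_pi s
    have htan : ‖(π / 2 : ℂ) * Complex.tan (π * s / 2)‖ ≤ π := by
      rw [norm_mul]
      have : ‖(π / 2 : ℂ)‖ = π / 2 := by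
        rw [norm_div, Complex.norm_real, Real.norm_of_nonneg Real.pi_pos.le]; simp
      rw [this]
      have := Real.pi_pos
      nlinarith [norm_nonneg (Complex.tan (π * s / 2))]
    have hCs := hC s hsre
    have e4 : MM (-1 + t * I) + (Real.log (|t| + 2) : ℂ) = (Real.log (2 * π) : ℂ) - (logDeriv Complex.Gamma s - Complex.log s)
        - (Complex.log s - (Real.log (|t| + 2) : ℂ)) + (π / 2) * Complex.tan (π * s / 2) - logDeriv riemannZeta s := by
      rw [e1, h1]; ring
    rw [e4]
    have n1 := norm_sub_le ((Real.log (2 * π) : ℂ) - (logDeriv Complex.Gamma s - Complex.log s)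
        - (Complex.log s - (Real.log (|t| + 2) : ℂ)) + (π / 2) * Complex.tan (π * s / 2)) (logDeriv riemannZeta s)
    have n2 := norm_add_le ((Real.log (2 * π) : ℂ) - (logDeriv Complex.Gamma s - Complex.log s)
        - (Complex.log s - (Real.log (|t| + 2) : ℂ))) ((π / 2) * Complex.tan (π * s / 2))
    have n3 := norm_sub_le ((Real.log (2 * π) : ℂ) - (logDeriv Complex.Gamma s - Complex.log s)) (Complex.log s - (Real.log (|t| + 2) : ℂ))
    have n4 := norm_sub_le (Real.log (2 * π) : ℂ) (logDeriv Complex.Gamma s - Complex.log s)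
    have n5 : ‖(Real.log (2 * π) : ℂ)‖ = |Real.log (2 * π)| := Complex.norm_real _
    linarith
  exact ⟨_, (norm_nonneg _).trans (key 0), key⟩

/-! Part 8 of the proof. -/
open Classical in
/-- weight of a zero: its multiplicity if on the critical line -/
def mu (ρ : ℂ) : ℝ := if ρ.re = 1 / 2 then (zetaMult ρ : ℝ) else 0

lemma mu_nonneg (ρ : ℂ) : 0 ≤ mu ρ := by unfold mu; split_ifs <;> positivity

lemma mu_le (ρ : ℂ) : mu ρ ≤ zetaMult ρ := by unfold mu; split_ifs <;> simp

def SS (u t : ℝ) : ℂ := ∑' ρ : ZS, ((mu ρ * (2 / (1 + (t - (ρ : ℂ).im) ^ 2)) : ℝ) : ℂ) * Complex.exp (I * (ρ : ℂ).im * u)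

def an (u : ℝ) (n : ℕ) : ℝ := lam n * Real.exp (-|u - Real.log n|)

def AA (u t : ℝ) : ℂ := ∑' n : ℕ, (an u n : ℂ) * Complex.exp (I * t * (u - Real.log n : ℝ))

lemma an_nonneg (u : ℝ) (n : ℕ) : 0 ≤ an u n := mul_nonneg (lam_nonneg n) (Real.exp_pos _).le

lemma mu_summable (hRH : RiemannHypothesis) (t : ℝ) :
    Summable (fun ρ : ZS => mu ρ * (1 / (1 + (t - (ρ : ℂ).im) ^ 2))) := by
  refine ((zero_summable hRH).mul_left (2 + 2 * t ^ 2)).of_nonneg_of_le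
    (fun ρ => mul_nonneg (mu_nonneg _) (by positivity)) fun ρ => ?_
  unfold mu
  split_ifs with h
  · have e : ‖(ρ : ℂ)‖ ^ 2 = 1 / 4 + (ρ : ℂ).im ^ 2 := by
      rw [← Complex.normSq_eq_norm_sq, Complex.normSq_apply, h]; ring
    rw [e, mul_one_div, mul_div_assoc', div_le_div_iff₀ (by positivity) (by positivity)]
    have h1 : 1 + (1 / 4 + (ρ : ℂ).im ^ 2) ≤ (2 + 2 * t ^ 2) * (1 + (t - (ρ : ℂ).im) ^ 2) := by
      nlinarith [sq_nonneg (t * (t - (ρ : ℂ).im)), sq_nonneg (t + (t - (ρ : ℂ).im)), sq_nonneg (ρ : ℂ).im]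
    calc (zetaMult ρ : ℝ) * (1 + (1 / 4 + (ρ : ℂ).im ^ 2))
        ≤ zetaMult ρ * ((2 + 2 * t ^ 2) * (1 + (t - (ρ : ℂ).im) ^ 2)) := by gcongr
      _ = _ := by ring
  · rw [zero_mul]; positivity

lemma EE_eval (t v : ℝ) : EE (1 + t * I) (-1 + t * I) v = (Real.exp (-|v|) : ℂ) * Complex.exp (I * t * v) := by
  unfold EE
  rw [Complex.ofReal_exp]
  split_ifs with h
  · rw [abs_of_nonneg h, ← Complex.exp_add]; congr 1; push_cast; ring
  · rw [abs_of_neg (not_le.1 h), ← Complex.exp_add]; congr 1; push_cast; ring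

lemma mu_term_eq {ρ : ℂ} (h : ρ.re = 1 / 2) (u t : ℝ) :
    (zetaMult ρ : ℂ) * (1 / (1 / 2 + (1 + t * I) - ρ) - 1 / (1 / 2 + (-1 + t * I) - ρ)) * Complex.exp ((ρ - 1 / 2) * u)
    = ((mu ρ * (2 / (1 + (t - ρ.im) ^ 2)) : ℝ) : ℂ) * Complex.exp (I * ρ.im * u) := by
  have hρ : ρ = 1 / 2 + ρ.im * I := by
    apply Complex.ext <;> simp [h]
  have e1 : (ρ - 1 / 2) * u = I * ρ.im * u := by
    conv_lhs => rw [hρ]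
    ring
  rw [e1]
  congr 1
  rw [mu, if_pos h]
  push_cast
  congr 1
  have a1 : (1 / 2 + (1 + t * I) - ρ) = 1 + (t - ρ.im) * I := by
    conv_lhs => rw [hρ]
    ring
  have a2 : (1 / 2 + (-1 + t * I) - ρ) = -1 + (t - ρ.im) * I := by
    conv_lhs => rw [hρ]
    ring
  rw [a1, a2]
  have n1 : (1 + (t - ρ.im) * I : ℂ) ≠ 0 := by
    intro h0; have := congrArg Complex.re h0; simp at this
  have n2 : (-1 + (t - ρ.im) * I : ℂ) ≠ 0 := by
    intro h0; have := congrArg Complex.re h0; simp at this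
  have n3 : (1 + ((t : ℂ) - ρ.im) ^ 2) ≠ 0 := by
    have : (1 + ((t : ℂ) - ρ.im) ^ 2) = ((1 + (t - ρ.im) ^ 2 : ℝ) : ℂ) := by push_cast; rfl
    rw [this]; exact_mod_cast (by positivity : (0 : ℝ) < 1 + (t - ρ.im) ^ 2).ne'
  rw [div_sub_div _ _ n1 n2, div_eq_div_iff (mul_ne_zero n1 n2) n3]
  ring_nf
  simp only [I_sq]
  ring

lemma triv_term_bound (k : ℕ) (t : ℝ) {u : ℝ} (hu : 0 ≤ u) :
    ‖(zetaMult (-2 * (k + 1)) : ℂ) * (1 / (1 / 2 + (1 + t * I) - (-2 * (k + 1))) - 1 / (1 / 2 + (-1 + t * I) - (-2 * (k + 1))))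
      * Complex.exp (((-2 * (k + 1) : ℂ) - 1 / 2) * u)‖ ≤ 4 * Gt (-2 * ((k : ℂ) + 1)) := by
  have hk : (0 : ℝ) ≤ k := k.cast_nonneg
  rw [zetaMult_triv, Gt, if_pos ⟨k, rfl⟩]
  have hn : ‖(-2 * ((k : ℂ) + 1))‖ = 2 * (k + 1) := by
    have : (-2 * ((k : ℂ) + 1)) = ((-2 * (k + 1) : ℝ) : ℂ) := by push_cast; ring
    rw [this, Complex.norm_real, Real.norm_eq_abs, abs_of_nonpos (by linarith)]; ring
  rw [hn]
  set p := (1 / 2 + (1 + t * I) - (-2 * (k + 1)) : ℂ) with hp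
  set q := (1 / 2 + (-1 + t * I) - (-2 * (k + 1)) : ℂ) with hq
  have hp1 : 3 / 2 + 2 * (k + 1) ≤ ‖p‖ := by
    refine le_trans (le_of_eq ?_) (Complex.re_le_norm p)
    simp [hp]; ring
  have hq1 : -1 / 2 + 2 * (k + 1) ≤ ‖q‖ := by
    refine le_trans (le_of_eq ?_) (Complex.re_le_norm q)
    simp [hq]; ring
  have hp0 : p ≠ 0 := by rintro h; rw [h, norm_zero] at hp1; linarith
  have hq0 : q ≠ 0 := by rintro h; rw [h, norm_zero] at hq1; linarith
  have hexp : ‖Complex.exp (((-2 * (k + 1) : ℂ) - 1 / 2) * u)‖ ≤ 1 := by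
    rw [Complex.norm_exp, Complex.re_mul_ofReal, Real.exp_le_one_iff]
    refine mul_nonpos_of_nonpos_of_nonneg ?_ hu
    simp; linarith
  have e : 1 / p - 1 / q = -2 / (p * q) := by
    rw [div_sub_div _ _ hp0 hq0]; congr 1; rw [hp, hq]; ring
  rw [e, norm_mul, norm_mul, norm_div, norm_mul]
  have h5 : (2 : ℝ) / (‖p‖ * ‖q‖) ≤ 4 * (1 / (1 + (2 * (k + 1)) ^ 2)) := by
    rw [mul_one_div, div_le_div_iff₀ (by positivity) (by positivity)]
    have : (3 / 2 + 2 * (k + 1)) * (-1 / 2 + 2 * (k + 1)) ≤ ‖p‖ * ‖q‖ := by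
      refine mul_le_mul hp1 hq1 (by linarith) (norm_nonneg _)
    nlinarith
  simp only [Nat.cast_one, norm_one, one_mul, norm_neg, Complex.norm_ofNat]
  calc 2 / (‖p‖ * ‖q‖) * ‖Complex.exp (((-2 * (k + 1) : ℂ) - 1 / 2) * u)‖ ≤ 2 / (‖p‖ * ‖q‖) * 1 := by gcongr
    _ ≤ _ := by rw [mul_one]; exact h5

lemma triv_re (k : ℕ) : ¬ ((-2 * ((k : ℂ) + 1)).re = 1 / 2) := by
  have hk : (0 : ℝ) ≤ k := k.cast_nonneg
  simp; intro h; linarith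

lemma term_diff (hRH : RiemannHypothesis) (ρ : ZS) (t : ℝ) {u : ℝ} (hu : 0 ≤ u) :
    ‖(zetaMult ρ : ℂ) * (1 / (1 / 2 + (1 + t * I) - ρ) - 1 / (1 / 2 + (-1 + t * I) - ρ)) * Complex.exp (((ρ : ℂ) - 1 / 2) * u)
    - ((mu ρ * (2 / (1 + (t - (ρ : ℂ).im) ^ 2)) : ℝ) : ℂ) * Complex.exp (I * (ρ : ℂ).im * u)‖ ≤ 4 * Gt ρ := by
  rcases zero_cases hRH ρ.2 with ⟨k, hk⟩ | h
  · have : mu ρ = 0 := by rw [mu, if_neg]; rw [hk]; exact triv_re k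
    rw [this, zero_mul, Complex.ofReal_zero, zero_mul, sub_zero, hk]
    exact triv_term_bound k t hu
  · rw [mu_term_eq h, sub_self, norm_zero]
    exact mul_nonneg (by norm_num) (Gt_nonneg _)

theorem S_formula (hRH : RiemannHypothesis) : ∃ C : ℝ, 0 ≤ C ∧ ∀ t u : ℝ, 0 ≤ u →
    ‖SS u t + AA u t - (Real.log (|t| + 2) : ℂ) * Complex.exp ((-1 + t * I) * u)‖ ≤ C + C * Real.exp (u / 2) / (1 + t ^ 2) := by
  obtain ⟨C₁, hC₁, h1⟩ := MM_bound
  set G := ∑' ρ : ZS, 4 * Gt ρ with hG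
  have hGs : Summable (fun ρ : ZS => 4 * Gt ρ) := by
    exact (Gt_summable.mul_left 4).comp_injective Subtype.val_injective
  have hG0 : 0 ≤ G := tsum_nonneg fun ρ => mul_nonneg (by norm_num) (Gt_nonneg _)
  refine ⟨G + C₁ + 8, by positivity, fun t u hu => ?_⟩
  have hbre : ((-1 + t * I : ℂ)).re = -1 := by simp
  have ef := explicit_formula hRH (a := 1 + t * I) (b := -1 + t * I) (by simp; norm_num) (by simp)
    (not_ZS_of_re hRH (by simp; norm_num) (by simp)) (by intro h; have := congrArg Complex.re h; norm_num at this) hu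
  have hAA : AA u t = ∑' n : ℕ, (lam n : ℂ) * EE (1 + t * I) (-1 + t * I) (u - Real.log n) := by
    unfold AA
    refine tsum_congr fun n => ?_
    rw [EE_eval, an]; push_cast; ring
  rw [← hAA] at ef
  have hs1 : Summable (fun ρ : ZS => (((mu ρ * (2 / (1 + (t - (ρ : ℂ).im) ^ 2)) : ℝ) : ℂ) * Complex.exp (I * (ρ : ℂ).im * u))) := by
    refine Summable.of_norm (((mu_summable hRH t).mul_left 2).of_nonneg_of_le (fun _ => norm_nonneg _) fun ρ => ?_)
    rw [norm_mul, Complex.norm_real, Real.norm_of_nonneg (mul_nonneg (mu_nonneg _) (by positivity)), Complex.norm_exp]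
    simp
    apply le_of_eq; ring
  have hsd : Summable (fun ρ : ZS => (zetaMult ρ : ℂ) * (1 / (1 / 2 + (1 + t * I) - ρ) - 1 / (1 / 2 + (-1 + t * I) - ρ)) * Complex.exp (((ρ : ℂ) - 1 / 2) * u)
    - ((mu ρ * (2 / (1 + (t - (ρ : ℂ).im) ^ 2)) : ℝ) : ℂ) * Complex.exp (I * (ρ : ℂ).im * u)) :=
    Summable.of_norm (hGs.of_nonneg_of_le (fun _ => norm_nonneg _) fun ρ => term_diff hRH ρ t hu)
  have hd : ‖(∑' ρ : ZS, (zetaMult ρ : ℂ) * (1 / (1 / 2 + (1 + t * I) - ρ) - 1 / (1 / 2 + (-1 + t * I) - ρ)) * Complex.exp (((ρ : ℂ) - 1 / 2) * u))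
      - SS u t‖ ≤ G := by
    have hs2 := hsd.add hs1
    simp only [sub_add_cancel] at hs2
    rw [SS, ← hs2.tsum_sub hs1]
    exact tsum_of_norm_bounded hGs.hasSum fun ρ => term_diff hRH ρ t hu
  rw [ef] at hd
  have hpole : ‖(1 / (1 + t * I - 1 / 2) - 1 / (-1 + t * I - 1 / 2)) * Complex.exp ((1 / 2 : ℂ) * u)‖ ≤ 8 * Real.exp (u / 2) / (1 + t ^ 2) := by
    set p := (1 + t * I - 1 / 2 : ℂ) with hp
    set q := (-1 + t * I - 1 / 2 : ℂ) with hq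
    have hp1 : ‖p‖ ^ 2 = 1 / 4 + t ^ 2 := by
      rw [← Complex.normSq_eq_norm_sq, Complex.normSq_apply]; simp [hp]; ring
    have hq1 : ‖q‖ ^ 2 = 9 / 4 + t ^ 2 := by
      rw [← Complex.normSq_eq_norm_sq, Complex.normSq_apply]; simp [hq]; ring
    have hp0 : p ≠ 0 := by rintro h; rw [h] at hp1; simp at hp1; nlinarith [sq_nonneg t]
    have hq0 : q ≠ 0 := by rintro h; rw [h] at hq1; simp at hq1; nlinarith [sq_nonneg t]
    have e : 1 / p - 1 / q = -2 / (p * q) := by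
      rw [div_sub_div _ _ hp0 hq0]; congr 1; rw [hp, hq]; ring
    rw [e, norm_mul, norm_div, norm_mul, Complex.norm_exp]
    have e2 : ((1 / 2 : ℂ) * u).re = u / 2 := by
      rw [Complex.re_mul_ofReal]; simp; ring
    rw [e2]
    have hpq : 1 / 4 + t ^ 2 ≤ ‖p‖ * ‖q‖ := by
      have : ‖p‖ ≤ ‖q‖ := by
        rw [← sq_le_sq₀ (norm_nonneg _) (norm_nonneg _), hp1, hq1]; linarith
      nlinarith [norm_nonneg p]
    simp only [norm_neg, Complex.norm_ofNat]
    have h6 : (2 : ℝ) / (‖p‖ * ‖q‖) ≤ 8 / (1 + t ^ 2) := by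
      rw [div_le_div_iff₀ (by positivity) (by positivity)]; nlinarith [sq_nonneg t]
    calc 2 / (‖p‖ * ‖q‖) * Real.exp (u / 2) ≤ 8 / (1 + t ^ 2) * Real.exp (u / 2) := by gcongr
      _ = _ := by ring
  have hMMt : ‖(MM (-1 + t * I) + (Real.log (|t| + 2) : ℂ)) * Complex.exp ((-1 + t * I) * u)‖ ≤ C₁ := by
    rw [norm_mul]
    have : ‖Complex.exp ((-1 + t * I) * u)‖ ≤ 1 := by
      rw [Complex.norm_exp, Complex.re_mul_ofReal, Real.exp_le_one_iff, hbre]; linarith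
    calc _ ≤ C₁ * 1 := mul_le_mul (h1 t) this (norm_nonneg _) hC₁
      _ = C₁ := mul_one _
  set P := (1 / (1 + t * I - 1 / 2) - 1 / (-1 + t * I - 1 / 2)) * Complex.exp ((1 / 2 : ℂ) * u)
  set Q := (MM (-1 + t * I) + (Real.log (|t| + 2) : ℂ)) * Complex.exp ((-1 + t * I) * u) with hQ
  have e7 : SS u t + AA u t - (Real.log (|t| + 2) : ℂ) * Complex.exp ((-1 + t * I) * u) =
      P - Q - (P - AA u t - MM (-1 + t * I) * Complex.exp ((-1 + t * I) * u) - SS u t) := by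
    rw [hQ]; ring
  rw [e7]
  have n1 := norm_sub_le (P - Q) (P - AA u t - MM (-1 + t * I) * Complex.exp ((-1 + t * I) * u) - SS u t)
  have n2 := norm_sub_le P Q
  have h8 : 8 * Real.exp (u / 2) / (1 + t ^ 2) ≤ (G + C₁ + 8) * Real.exp (u / 2) / (1 + t ^ 2) := by
    gcongr; linarith
  linarith

/-- Local density of zeros. -/
theorem zero_density (hRH : RiemannHypothesis) : ∃ C : ℝ, 0 ≤ C ∧ ∀ t : ℝ,
    ∑' ρ : ZS, mu ρ * (1 / (1 + (t - (ρ : ℂ).im) ^ 2)) ≤ C * Real.log (|t| + 2) := by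
  obtain ⟨C, hC, h⟩ := S_formula hRH
  set B := ∑' n : ℕ, lam n * Real.exp (-1 * Real.log n) with hB
  have hB0 : 0 ≤ B := tsum_nonneg fun n => mul_nonneg (lam_nonneg n) (Real.exp_pos _).le
  have hl2 : 0 < Real.log 2 := Real.log_pos (by norm_num)
  refine ⟨1 + (2 * C + B) / Real.log 2, by positivity, fun t => ?_⟩
  have h0 := h t 0 le_rfl
  have hAA : ‖AA 0 t‖ ≤ B := by
    refine tsum_of_norm_bounded (lam_summable (c := 1) (by norm_num)).hasSum fun n => ?_
    rw [norm_mul, Complex.norm_real, Real.norm_of_nonneg (an_nonneg _ _), Complex.norm_exp, an]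
    have : 0 ≤ Real.log n := Real.log_natCast_nonneg n
    have e0 : (I * t * ((0 - Real.log n : ℝ) : ℂ)).re = 0 := by rw [Complex.re_mul_ofReal]; simp
    rw [e0]
    simp [abs_of_nonneg this]
  have hSS : SS 0 t = ((2 * ∑' ρ : ZS, mu ρ * (1 / (1 + (t - (ρ : ℂ).im) ^ 2)) : ℝ) : ℂ) := by
    rw [SS, ← tsum_mul_left, Complex.ofReal_tsum]
    refine tsum_congr fun ρ => ?_
    simp; ring
  set X := ∑' ρ : ZS, mu ρ * (1 / (1 + (t - (ρ : ℂ).im) ^ 2))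
  have hX : 0 ≤ X := tsum_nonneg fun ρ => mul_nonneg (mu_nonneg _) (by positivity)
  have hL : Real.log 2 ≤ Real.log (|t| + 2) := Real.log_le_log (by norm_num) (by linarith [abs_nonneg t])
  have h9 : C * Real.exp (0 / 2) / (1 + t ^ 2) ≤ C := by
    rw [zero_div, Real.exp_zero, mul_one]
    exact div_le_self hC (by nlinarith [sq_nonneg t])
  simp only [Complex.ofReal_zero, mul_zero, Complex.exp_zero, mul_one] at h0
  have n1 : ‖SS 0 t‖ ≤ 2 * C + B + Real.log (|t| + 2) := by
    have e : SS 0 t = (SS 0 t + AA 0 t - (Real.log (|t| + 2) : ℂ)) - AA 0 t + (Real.log (|t| + 2) : ℂ) := by ring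
    have m1 := norm_add_le ((SS 0 t + AA 0 t - (Real.log (|t| + 2) : ℂ)) - AA 0 t) (Real.log (|t| + 2) : ℂ)
    have m2 := norm_sub_le (SS 0 t + AA 0 t - (Real.log (|t| + 2) : ℂ)) (AA 0 t)
    rw [← e] at m1
    rw [Complex.norm_real, Real.norm_of_nonneg (by linarith)] at m1
    linarith
  rw [hSS, Complex.norm_real, Real.norm_of_nonneg (by positivity)] at n1
  have h10 : 2 * C + B ≤ (2 * C + B) / Real.log 2 * Real.log (|t| + 2) := by
    rw [div_mul_eq_mul_div, le_div_iff₀ hl2]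
    gcongr
  linarith

/-- Chebyshev type bound with a smooth kernel. -/
theorem cheb (hRH : RiemannHypothesis) (c : ℝ) (hc1 : 1 ≤ c) (hc2 : c < 3) : ∃ C : ℝ, 0 ≤ C ∧ ∀ u : ℝ, 0 ≤ u →
    |(∑' n : ℕ, ArithmeticFunction.vonMangoldt n / n * Real.exp (-c * |u - Real.log n|)) - 2 / c| ≤ C * Real.exp (-u / 2) := by
  have hc : 0 < c := by linarith
  have ha : (1 / 2 + ((1 / 2 + c : ℝ) : ℂ)) ∉ ZS := not_ZS_of_re hRH (by simp; linarith) (by simp; intro h; linarith)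
  have hb : (1 / 2 + ((1 / 2 - c : ℝ) : ℂ)) ∉ ZS :=
    not_ZS_of_re hRH (by simp; linarith) (by simp; intro h; linarith)
  have hs := zero_summable2 hRH ha hb
  set K := ∑' ρ : ZS, ‖(zetaMult ρ : ℂ) * (1 / (1 / 2 + ((1 / 2 + c : ℝ) : ℂ) - ρ) - 1 / (1 / 2 + ((1 / 2 - c : ℝ) : ℂ) - ρ))‖
  have hK : 0 ≤ K := tsum_nonneg fun _ => norm_nonneg _
  refine ⟨K + ‖MM ((1 / 2 - c : ℝ) : ℂ)‖, by positivity, fun u hu => ?_⟩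
  have ef := explicit_formula hRH (a := ((1 / 2 + c : ℝ) : ℂ)) (b := ((1 / 2 - c : ℝ) : ℂ)) (by rw [Complex.ofReal_re]; linarith)
    (by rw [Complex.ofReal_re, Complex.ofReal_re]; linarith) hb (by
      intro h; have := congrArg Complex.re h; rw [Complex.ofReal_re] at this; norm_num at this; linarith) hu
  have hl : ‖∑' ρ : ZS, (zetaMult ρ : ℂ) * (1 / (1 / 2 + ((1 / 2 + c : ℝ) : ℂ) - ρ) - 1 / (1 / 2 + ((1 / 2 - c : ℝ) : ℂ) - ρ)) * Complex.exp (((ρ : ℂ) - 1 / 2) * u)‖ ≤ K := by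
    refine tsum_of_norm_bounded hs.hasSum fun ρ => ?_
    rw [norm_mul]
    refine mul_le_of_le_one_right (norm_nonneg _) ?_
    rw [Complex.norm_exp, Complex.re_mul_ofReal, Real.exp_le_one_iff]
    refine mul_nonpos_of_nonpos_of_nonneg ?_ hu
    have := ZS_re hRH ρ.2
    simp; linarith
  rw [ef] at hl
  have e1 : ∑' n : ℕ, (lam n : ℂ) * EE ((1 / 2 + c : ℝ) : ℂ) ((1 / 2 - c : ℝ) : ℂ) (u - Real.log n) =
      ((Real.exp (u / 2) * ∑' n : ℕ, ArithmeticFunction.vonMangoldt n / n * Real.exp (-c * |u - Real.log n|) : ℝ) : ℂ) := by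
    rw [← tsum_mul_left, Complex.ofReal_tsum]
    refine tsum_congr fun n => ?_
    rcases Nat.eq_zero_or_pos n with rfl | hn
    · simp [lam]
    have hn0 : (0 : ℝ) < n := by exact_mod_cast hn
    have e2 : EE ((1 / 2 + c : ℝ) : ℂ) ((1 / 2 - c : ℝ) : ℂ) (u - Real.log n) =
        ((Real.exp ((u - Real.log n) / 2 - c * |u - Real.log n|) : ℝ) : ℂ) := by
      unfold EE
      rw [Complex.ofReal_exp]
      split_ifs with h
      · rw [abs_of_nonneg h]; congr 1; push_cast; ring
      · rw [abs_of_neg (not_le.1 h)]; congr 1; push_cast; ring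
    rw [e2, ← Complex.ofReal_mul]
    congr 1
    rw [lam]
    have e3 : (1 : ℝ) / n = Real.exp (-Real.log n) := by rw [Real.exp_neg, Real.exp_log hn0, one_div]
    rw [div_eq_mul_one_div _ (n : ℝ), e3]
    have e4 : Real.exp (-(1 / 2) * Real.log n) * Real.exp ((u - Real.log n) / 2 - c * |u - Real.log n|)
       = Real.exp (u / 2) * Real.exp (-Real.log n) * Real.exp (-c * |u - Real.log n|) := by
      rw [← Real.exp_add, ← Real.exp_add, ← Real.exp_add]; congr 1; ring
    rw [mul_assoc, e4]; ring
  rw [e1] at hl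
  set W := ∑' n : ℕ, ArithmeticFunction.vonMangoldt n / n * Real.exp (-c * |u - Real.log n|)
  have e5 : (1 / (((1 / 2 + c : ℝ) : ℂ) - 1 / 2) - 1 / (((1 / 2 - c : ℝ) : ℂ) - 1 / 2)) * Complex.exp ((1 / 2 : ℂ) * u) =
      ((2 / c * Real.exp (u / 2) : ℝ) : ℂ) := by
    have hc0 : (c : ℂ) ≠ 0 := by exact_mod_cast hc.ne'
    push_cast
    rw [show (1 / 2 : ℂ) * u = u / 2 by ring]
    congr 1
    rw [show (1 / 2 + c - 1 / 2 : ℂ) = c by ring, show (1 / 2 - c - 1 / 2 : ℂ) = -c by ring]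
    field_simp; norm_num
  rw [e5] at hl
  set M := MM ((1 / 2 - c : ℝ) : ℂ) * Complex.exp (((1 / 2 - c : ℝ) : ℂ) * u) with hM
  have hMn : ‖M‖ ≤ ‖MM ((1 / 2 - c : ℝ) : ℂ)‖ * 1 := by
    rw [hM, norm_mul]
    refine mul_le_mul_of_nonneg_left ?_ (norm_nonneg _)
    rw [Complex.norm_exp, Complex.re_mul_ofReal, Real.exp_le_one_iff, Complex.ofReal_re]
    exact mul_nonpos_of_nonpos_of_nonneg (by linarith) hu
  have e6 : ((Real.exp (u / 2) * (W - 2 / c) : ℝ) : ℂ) = -(((2 / c * Real.exp (u / 2) : ℝ) : ℂ) - ((Real.exp (u / 2) * W : ℝ) : ℂ) - M) - M := by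
    push_cast; ring
  have h7 : Real.exp (u / 2) * |W - 2 / c| ≤ K + ‖MM ((1 / 2 - c : ℝ) : ℂ)‖ := by
    have : Real.exp (u / 2) * |W - 2 / c| = ‖((Real.exp (u / 2) * (W - 2 / c) : ℝ) : ℂ)‖ := by
      rw [Complex.norm_real, Real.norm_eq_abs, abs_mul, abs_of_pos (Real.exp_pos _)]
    rw [this, e6]
    have := norm_sub_le (-(((2 / c * Real.exp (u / 2) : ℝ) : ℂ) - ((Real.exp (u / 2) * W : ℝ) : ℂ) - M)) M
    rw [norm_neg] at this
    linarith
  have h8 : |W - 2 / c| = Real.exp (u / 2) * |W - 2 / c| * Real.exp (-u / 2) := by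
    rw [mul_right_comm, ← Real.exp_add]; ring_nf; simp
  rw [h8]
  gcongr

/-! Part 9 of the proof. -/
lemma log_sq_le {y : ℝ} (hy : 1 ≤ y) : Real.log y ^ 2 ≤ 64 * y ^ (1 / 4 : ℝ) := by
  have h := Real.log_le_rpow_div (x := y) (ε := 1 / 8) (by linarith) (by norm_num)
  have h0 := Real.log_nonneg hy
  have e : y ^ (1 / 4 : ℝ) = (y ^ (1 / 8 : ℝ)) ^ 2 := by
    rw [← Real.rpow_natCast, ← Real.rpow_mul (by linarith)]; norm_num
  rw [e]
  calc Real.log y ^ 2 ≤ (y ^ (1 / 8 : ℝ) / (1 / 8)) ^ 2 := by gcongr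
    _ = _ := by ring

def hcor (n : ℕ) : ℝ := ArithmeticFunction.vonMangoldt n * (Real.log n - ArithmeticFunction.vonMangoldt n) / n

lemma hcor_nonneg (n : ℕ) : 0 ≤ hcor n :=
  div_nonneg (mul_nonneg ArithmeticFunction.vonMangoldt_nonneg (sub_nonneg.2 ArithmeticFunction.vonMangoldt_le_log)) n.cast_nonneg

lemma hcor_le {n : ℕ} (hn : 1 ≤ n) : hcor n ≤ 64 * (n : ℝ) ^ (-(3 / 4) : ℝ) := by
  have hn1 : (1 : ℝ) ≤ n := by exact_mod_cast hn
  have h1 := ArithmeticFunction.vonMangoldt_le_log (n := n)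
  have h2 := ArithmeticFunction.vonMangoldt_nonneg (n := n)
  have h3 := log_sq_le hn1
  have h4 : (n : ℝ) ^ (-(3 / 4) : ℝ) = (n : ℝ) ^ (1 / 4 : ℝ) / n := by
    rw [← Real.rpow_sub_one (by linarith)]; norm_num
  rw [h4, hcor, mul_div_assoc']
  refine div_le_div_of_nonneg_right (le_trans ?_ h3) (by linarith)
  nlinarith

lemma hcor_summable : Summable hcor := by
  have hsupp : Function.support hcor ⊆ {n : ℕ | IsPrimePow n} := by
    intro n hn
    by_contra h
    apply hn
    have : ArithmeticFunction.vonMangoldt n = 0 := ArithmeticFunction.vonMangoldt_eq_zero_iff.2 h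
    rw [hcor, this]; simp
  refine (Function.Injective.summable_iff (f := hcor) (Subtype.val_injective (p := IsPrimePow (R := ℕ))) ?_).1 ?_
  · intro n hn
    by_contra h
    exact hn ⟨⟨n, hsupp h⟩, rfl⟩
  rw [← Nat.Primes.prodNatEquiv.summable_iff]
  set r : ℝ := (2 : ℝ) ^ (-(3 / 4) : ℝ) with hr
  have hr0 : 0 < r := by positivity
  have hr1 : r < 1 := Real.rpow_lt_one_of_one_lt_of_neg (by norm_num) (by norm_num)
  have hp : Summable (fun p : Nat.Primes => ((p : ℕ) : ℝ) ^ (-(3 / 2) : ℝ)) :=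
    (Real.summable_nat_rpow.2 (by norm_num)).comp_injective Nat.Primes.coe_nat_injective
  have hg : Summable (fun k : ℕ => 64 * r⁻¹ * r ^ k) := (summable_geometric_of_lt_one hr0.le hr1).mul_left _
  have hm := hp.mul_of_nonneg hg (fun p => by positivity) (fun k => by positivity)
  refine hm.of_nonneg_of_le (fun x => hcor_nonneg _) ?_
  rintro ⟨p, k⟩
  have hp2 : (2 : ℝ) ≤ ((p : ℕ) : ℝ) := by exact_mod_cast p.2.two_le
  have hp0 : (0 : ℝ) < ((p : ℕ) : ℝ) := by linarith
  simp only [Function.comp, Nat.Primes.prodNatEquiv_apply]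
  rcases Nat.eq_zero_or_pos k with rfl | hk
  · have : hcor ((p : ℕ) ^ (0 + 1)) = 0 := by
      rw [hcor, zero_add, pow_one, ArithmeticFunction.vonMangoldt_apply_prime p.2]; simp
    rw [this]; positivity
  · refine (hcor_le (Nat.one_le_pow _ _ p.2.pos)).trans ?_
    obtain ⟨j, rfl⟩ : ∃ j, k = j + 1 := ⟨k - 1, by omega⟩
    have e1 : ((((p : ℕ) ^ (j + 1 + 1) : ℕ) : ℝ)) ^ (-(3 / 4) : ℝ) = ((p : ℕ) : ℝ) ^ (-(3 / 2) : ℝ) * (((p : ℕ) : ℝ) ^ (-(3 / 4) : ℝ)) ^ j := by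
      push_cast
      rw [← Real.rpow_natCast, ← Real.rpow_natCast, ← Real.rpow_mul hp0.le, ← Real.rpow_mul hp0.le, ← Real.rpow_add hp0]
      congr 1; push_cast; ring
    rw [e1]
    have e2 : ((p : ℕ) : ℝ) ^ (-(3 / 4) : ℝ) ≤ r := by
      rw [hr]; exact Real.rpow_le_rpow_of_nonpos (by norm_num) hp2 (by norm_num)
    have e3 : r⁻¹ * r ^ (j + 1) = r ^ j := by rw [pow_succ]; field_simp
    calc 64 * (((p : ℕ) : ℝ) ^ (-(3 / 2) : ℝ) * (((p : ℕ) : ℝ) ^ (-(3 / 4) : ℝ)) ^ j)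
        ≤ 64 * (((p : ℕ) : ℝ) ^ (-(3 / 2) : ℝ) * r ^ j) := by gcongr
      _ = _ := by rw [← e3]; ring

def Wk (c u : ℝ) (n : ℕ) : ℝ := ArithmeticFunction.vonMangoldt n / n * Real.exp (-c * |u - Real.log n|)

lemma Wk_nonneg (c u : ℝ) (n : ℕ) : 0 ≤ Wk c u n :=
  mul_nonneg (div_nonneg ArithmeticFunction.vonMangoldt_nonneg n.cast_nonneg) (Real.exp_pos _).le

lemma lam_eq (n : ℕ) : ArithmeticFunction.vonMangoldt n / n = lam n * Real.exp (-(1 / 2) * Real.log n) := by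
  rcases Nat.eq_zero_or_pos n with rfl | hn
  · simp [lam]
  have hn0 : (0 : ℝ) < n := by exact_mod_cast hn
  rw [lam, mul_assoc, ← Real.exp_add, show -(1 / 2) * Real.log n + -(1 / 2) * Real.log n = -Real.log n by ring, Real.exp_neg, Real.exp_log hn0, div_eq_mul_inv]

lemma Wk_summable {c : ℝ} (hc : 1 ≤ c) (u : ℝ) : Summable (Wk c u) := by
  refine ((lam_summable (c := 3 / 2) (by norm_num)).mul_left (Real.exp u)).of_nonneg_of_le (Wk_nonneg c u) fun n => ?_
  rw [Wk, lam_eq, mul_assoc, ← Real.exp_add, mul_left_comm, ← Real.exp_add]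
  refine mul_le_mul_of_nonneg_left (Real.exp_le_exp.2 ?_) (lam_nonneg n)
  have h1 := neg_abs_le (u - Real.log n)
  nlinarith [abs_nonneg (u - Real.log n)]

theorem an_sq (hRH : RiemannHypothesis) : ∃ C : ℝ, 0 ≤ C ∧ ∀ u : ℝ, 0 ≤ u →
    Summable (fun n => an u n ^ 2) ∧ |(∑' n, an u n ^ 2) - u| ≤ C := by
  obtain ⟨C1, hC1, h1⟩ := cheb hRH 1 le_rfl (by norm_num)
  obtain ⟨C2, hC2, h2⟩ := cheb hRH 2 (by norm_num) (by norm_num)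
  have hD : 0 ≤ ∑' n, hcor n := tsum_nonneg hcor_nonneg
  refine ⟨∑' n, hcor n + 2 * C2 + (2 + C1), by positivity, fun u hu => ?_⟩
  have hW2 := Wk_summable (c := 2) (by norm_num) u
  have hW1 := Wk_summable (c := 1) le_rfl u
  have k1 : |(∑' n, Wk 1 u n) - 2 / 1| ≤ C1 * Real.exp (-u / 2) := h1 u hu
  have k2 : |(∑' n, Wk 2 u n) - 2 / 2| ≤ C2 * Real.exp (-u / 2) := h2 u hu
  -- decomposition
  have hb1 : ∀ n, |Wk 2 u n * (Real.log n - u)| ≤ Wk 1 u n := by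
    intro n
    rw [abs_mul, abs_of_nonneg (Wk_nonneg _ _ _), Wk, Wk, mul_assoc]
    refine mul_le_mul_of_nonneg_left ?_ (div_nonneg ArithmeticFunction.vonMangoldt_nonneg n.cast_nonneg)
    rw [abs_sub_comm (Real.log n)]
    set y := |u - Real.log n|
    have : y ≤ Real.exp y := by linarith [Real.add_one_le_exp y]
    calc Real.exp (-2 * y) * y ≤ Real.exp (-2 * y) * Real.exp y := by gcongr
      _ = Real.exp (-1 * y) := by rw [← Real.exp_add]; congr 1; ring
  have hs1 : Summable (fun n => Wk 2 u n * (Real.log n - u)) := by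
    refine Summable.of_norm (hW1.of_nonneg_of_le (fun n => norm_nonneg _) fun n => ?_)
    exact hb1 n
  have hb2 : ∀ n, hcor n * Real.exp (-2 * |u - Real.log n|) ≤ hcor n := by
    intro n
    refine mul_le_of_le_one_right (hcor_nonneg n) ?_
    rw [Real.exp_le_one_iff]; linarith [abs_nonneg (u - Real.log n)]
  have hs2 : Summable (fun n => hcor n * Real.exp (-2 * |u - Real.log n|)) :=
    hcor_summable.of_nonneg_of_le (fun n => mul_nonneg (hcor_nonneg n) (Real.exp_pos _).le) hb2
  have e : ∀ n, an u n ^ 2 = Wk 2 u n * u + Wk 2 u n * (Real.log n - u) - hcor n * Real.exp (-2 * |u - Real.log n|) := by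
    intro n
    have e1 : an u n ^ 2 = ArithmeticFunction.vonMangoldt n * (lam n * Real.exp (-(1 / 2) * Real.log n)) * Real.exp (-2 * |u - Real.log n|) := by
      rw [an, mul_pow, ← Real.exp_nat_mul]
      have : lam n ^ 2 = ArithmeticFunction.vonMangoldt n * (lam n * Real.exp (-(1 / 2) * Real.log n)) := by
        rw [sq]; conv_lhs => rw [lam]
        rw [lam]; ring
      rw [this]; congr 2; push_cast; ring
    rw [e1, ← lam_eq, Wk, hcor]; ring
  have hsum : HasSum (fun n => an u n ^ 2) ((∑' n, Wk 2 u n) * u + (∑' n, Wk 2 u n * (Real.log n - u)) - ∑' n, hcor n * Real.exp (-2 * |u - Real.log n|)) := by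
    simp_rw [e]
    exact ((hW2.hasSum.mul_right u).add hs1.hasSum).sub hs2.hasSum
  refine ⟨hsum.summable, ?_⟩
  rw [hsum.tsum_eq]
  have b1 : |∑' n, Wk 2 u n * (Real.log n - u)| ≤ ∑' n, Wk 1 u n := by
    rw [← Real.norm_eq_abs]
    exact tsum_of_norm_bounded hW1.hasSum hb1
  have b2 : ∑' n, hcor n * Real.exp (-2 * |u - Real.log n|) ≤ ∑' n, hcor n := hs2.tsum_le_tsum hb2 hcor_summable
  have b3 : 0 ≤ ∑' n, hcor n * Real.exp (-2 * |u - Real.log n|) := tsum_nonneg fun n => mul_nonneg (hcor_nonneg n) (Real.exp_pos _).le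
  have b4 : ∑' n, Wk 1 u n ≤ 2 + C1 := by
    have : C1 * Real.exp (-u / 2) ≤ C1 * 1 := by
      gcongr; rw [Real.exp_le_one_iff]; linarith
    have := (abs_le.1 k1).2
    linarith
  have b5 : |(∑' n, Wk 2 u n) * u - u| ≤ 2 * C2 := by
    have : (∑' n, Wk 2 u n) * u - u = ((∑' n, Wk 2 u n) - 2 / 2) * u := by ring
    rw [this, abs_mul, abs_of_nonneg hu]
    have h5 : Real.exp (-u / 2) * u ≤ 2 := by
      have : u / 2 ≤ Real.exp (u / 2) := by linarith [Real.add_one_le_exp (u / 2)]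
      have h6 : Real.exp (-u / 2) * Real.exp (u / 2) = 1 := by rw [← Real.exp_add]; ring_nf; simp
      nlinarith [Real.exp_pos (-u / 2)]
    calc _ ≤ C2 * Real.exp (-u / 2) * u := by gcongr
      _ = C2 * (Real.exp (-u / 2) * u) := by ring
      _ ≤ C2 * 2 := by gcongr
      _ = _ := by ring
  rw [abs_le] at *
  constructor <;> linarith [b1.1, b1.2, b5.1, b5.2]

/-! Part 10 of the proof. -/
/-- termwise oscillatory integral -/
def osc (T φ : ℝ) : ℂ := ∫ t in (0 : ℝ)..T, Complex.exp (I * t * φ)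

lemma osc_zero (T : ℝ) : osc T 0 = T := by simp [osc]

lemma osc_bound (T : ℝ) {φ : ℝ} (h : φ ≠ 0) : ‖osc T φ‖ ≤ 2 / |φ| := by
  have hc : (I * φ : ℂ) ≠ 0 := by simp [h]
  have : osc T φ = (Complex.exp (I * φ * T) - Complex.exp (I * φ * (0 : ℝ))) / (I * φ) := by
    unfold osc
    rw [← integral_exp_mul_complex hc]
    refine intervalIntegral.integral_congr fun t _ => ?_
    congr 1; ring
  rw [this, norm_div]
  have h2 : ‖(I * φ : ℂ)‖ = |φ| := by simp
  rw [h2]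
  gcongr
  refine (norm_sub_le _ _).trans ?_
  rw [Complex.norm_exp, Complex.norm_exp]
  simp; norm_num

lemma mean_value (a θ : ℕ → ℝ) (ha : ∀ n, 0 ≤ a n) (hs : Summable a) {T : ℝ} (hT : 0 ≤ T)
    (B : ℕ × ℕ → ℝ) (hB : Summable B)
    (hb : ∀ p : ℕ × ℕ, p.1 ≠ p.2 → a p.1 * a p.2 * ‖osc T (θ p.1 - θ p.2)‖ ≤ B p) (hB0 : ∀ p, 0 ≤ B p) :
    |(∫ t in (0 : ℝ)..T, ‖∑' n, (a n : ℂ) * Complex.exp (I * t * θ n)‖ ^ 2) - T * ∑' n, a n ^ 2| ≤ ∑' p, B p := by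
  set f : ℕ × ℕ → ℝ → ℂ := fun p t => (a p.1 : ℂ) * (a p.2 : ℂ) * Complex.exp (I * t * (θ p.1 - θ p.2 : ℝ)) with hf
  have hprod : Summable (fun p : ℕ × ℕ => a p.1 * a p.2) := hs.mul_of_nonneg hs ha ha
  have hnorm : ∀ p t, ‖f p t‖ = a p.1 * a p.2 := by
    intro p t
    rw [hf]; simp only [norm_mul, Complex.norm_real, Real.norm_of_nonneg (ha _), Complex.norm_exp]
    rw [Complex.re_mul_ofReal]; simp
  have hF : ∀ t : ℝ, HasSum (fun p => f p t) (((‖∑' n, (a n : ℂ) * Complex.exp (I * t * θ n)‖ ^ 2 : ℝ)) : ℂ) := by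
    intro t
    have hs1 : Summable (fun n => ‖(a n : ℂ) * Complex.exp (I * t * θ n)‖) := by
      refine hs.congr fun n => ?_
      rw [norm_mul, Complex.norm_real, Real.norm_of_nonneg (ha _), Complex.norm_exp, Complex.re_mul_ofReal]; simp
    have hs2 : Summable (fun n => ‖(starRingEnd ℂ) ((a n : ℂ) * Complex.exp (I * t * θ n))‖) := by
      refine hs1.congr fun n => ?_
      rw [RCLike.norm_conj]
    have h3 := (summable_mul_of_summable_norm hs1 hs2).hasSum
    rw [← tsum_mul_tsum_of_summable_norm hs1 hs2, ← Complex.conj_tsum] at h3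
    rw [Complex.mul_conj, Complex.normSq_eq_norm_sq] at h3
    refine h3.congr_fun fun p => ?_
    rw [hf]
    simp only [map_mul, Complex.conj_ofReal, ← Complex.exp_conj, Complex.conj_I]
    have : Complex.exp (I * t * (θ p.1 - θ p.2 : ℝ)) = Complex.exp (I * t * θ p.1) * Complex.exp (-I * t * θ p.2) := by
      rw [← Complex.exp_add]; congr 1; push_cast; ring
    rw [this]; ring
  have hI : HasSum (fun p : ℕ × ℕ => (a p.1 : ℂ) * (a p.2 : ℂ) * osc T (θ p.1 - θ p.2))
      (((∫ t in (0 : ℝ)..T, ‖∑' n, (a n : ℂ) * Complex.exp (I * t * θ n)‖ ^ 2 : ℝ)) : ℂ) := by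
    have hcont : ∀ p, Continuous (f p) := by intro p; rw [hf]; fun_prop
    have h1 : HasSum (fun p => ∫ t in (0 : ℝ)..T, f p t) (∫ t in (0 : ℝ)..T, (((‖∑' n, (a n : ℂ) * Complex.exp (I * t * θ n)‖ ^ 2 : ℝ)) : ℂ)) := by
      refine intervalIntegral.hasSum_integral_of_dominated_convergence (fun p _ => a p.1 * a p.2)
        (fun p => (hcont p).aestronglyMeasurable) (fun p => Eventually.of_forall fun t _ => (hnorm p t).le)
        (Eventually.of_forall fun t _ => hprod) intervalIntegrable_const
        (Eventually.of_forall fun t _ => hF t)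
    rw [intervalIntegral.integral_ofReal] at h1
    refine h1.congr_fun fun p => ?_
    rw [hf, osc]; simp only
    rw [intervalIntegral.integral_const_mul]
  have hsq : Summable (fun n => a n ^ 2) := by
    have := hprod.comp_injective (i := fun n : ℕ => (n, n)) (fun x y h => (Prod.mk.inj h).1)
    refine this.congr fun n => ?_
    simp [sq]
  have hD : HasSum (fun p : ℕ × ℕ => if p.1 = p.2 then (a p.1 : ℂ) * (a p.2 : ℂ) * osc T (θ p.1 - θ p.2) else 0)
      (((T * ∑' n, a n ^ 2 : ℝ)) : ℂ) := by
    have h1 : HasSum (fun n => (((T * a n ^ 2 : ℝ)) : ℂ)) ((T * ∑' n, a n ^ 2 : ℝ) : ℂ) :=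
      Complex.hasSum_ofReal.2 (hsq.hasSum.mul_left T)
    refine (Function.Injective.hasSum_iff (g := fun n : ℕ => (n, n)) (fun x y h => (Prod.mk.inj h).1) ?_).1 ?_
    · rintro ⟨m, n⟩ h
      rw [if_neg]
      rintro h'
      simp only at h'
      subst h'
      exact h ⟨m, rfl⟩
    · refine h1.congr_fun fun n => ?_
      simp [osc_zero]; ring
  have hdiff := hI.sub hD
  rw [← Complex.ofReal_sub] at hdiff
  rw [← Real.norm_eq_abs, ← Complex.norm_real, ← hdiff.tsum_eq]
  refine tsum_of_norm_bounded hB.hasSum fun p => ?_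
  split_ifs with h
  · rw [sub_self, norm_zero]; exact hB0 p
  · rw [sub_zero, norm_mul, norm_mul, Complex.norm_real, Complex.norm_real, Real.norm_of_nonneg (ha _), Real.norm_of_nonneg (ha _)]
    exact hb p h

def Gk (η : ℝ) (p : ℕ × ℕ) : ℝ := if p.1 < p.2 then (p.1 : ℝ) ^ (-1 - η) * ((p.2 - p.1 : ℕ) : ℝ) ^ (-1 - η) else 0

lemma Gk_nonneg (η : ℝ) (p : ℕ × ℕ) : 0 ≤ Gk η p := by unfold Gk; split_ifs <;> positivity

lemma Gk_summable {η : ℝ} (h : 0 < η) : Summable (Gk η) := by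
  have h1 : Summable (fun n : ℕ => (n : ℝ) ^ (-1 - η)) := Real.summable_nat_rpow.2 (by linarith)
  have h2 := h1.mul_of_nonneg ((summable_nat_add_iff 1).2 h1) (fun n => by positivity) (fun n => by positivity)
  refine (Function.Injective.summable_iff (f := Gk η) (g := fun p : ℕ × ℕ => (p.1, p.1 + p.2 + 1)) ?_ ?_).1 ?_
  · rintro ⟨a, b⟩ ⟨c, d⟩ h
    simp only [Prod.mk.injEq] at h ⊢
    omega
  · rintro ⟨m, n⟩ hmn
    unfold Gk
    rw [if_neg]
    intro h'
    simp only at h'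
    exact hmn ⟨(m, n - m - 1), by simp; omega⟩
  · refine h2.congr fun p => ?_
    simp only [Function.comp, Gk]
    rw [if_pos (by omega)]
    congr 3; omega

lemma an_le {η u : ℝ} (hη : 0 < η) (hη2 : η ≤ 1 / 4) (hu : 0 ≤ u) (n : ℕ) :
    an u n ≤ 1 / η * Real.exp ((1 / 2 + 2 * η) * u) * (n : ℝ) ^ (-1 - η) := by
  rcases Nat.eq_zero_or_pos n with rfl | hn
  · have : an u 0 = 0 := by simp [an, lam]
    rw [this]; positivity
  have hn0 : (0 : ℝ) < n := by exact_mod_cast hn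
  have hlog : ArithmeticFunction.vonMangoldt n ≤ Real.exp (η * Real.log n) / η := by
    refine ArithmeticFunction.vonMangoldt_le_log.trans ?_
    have := Real.log_le_rpow_div hn0.le hη
    rwa [Real.rpow_def_of_pos hn0, mul_comm (Real.log n)] at this
  have hexp : Real.exp (-|u - Real.log n|) ≤ Real.exp ((1 / 2 + 2 * η) * (u - Real.log n)) := by
    rw [Real.exp_le_exp]
    have := neg_abs_le (u - Real.log n)
    nlinarith [abs_nonneg (u - Real.log n)]
  rw [an, lam, Real.rpow_def_of_pos hn0]
  calc _ ≤ Real.exp (η * Real.log n) / η * Real.exp (-(1 / 2) * Real.log n) * Real.exp ((1 / 2 + 2 * η) * (u - Real.log n)) := by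
        gcongr
    _ = 1 / η * (Real.exp (η * Real.log n) * Real.exp (-(1 / 2) * Real.log n) * Real.exp ((1 / 2 + 2 * η) * (u - Real.log n))) := by ring
    _ = 1 / η * (Real.exp ((1 / 2 + 2 * η) * u) * Real.exp (Real.log n * (-1 - η))) := by
        congr 1
        rw [← Real.exp_add, ← Real.exp_add, ← Real.exp_add]; congr 1; ring
    _ = _ := by ring

lemma an_summable {u : ℝ} (hu : 0 ≤ u) : Summable (an u) := by
  have h1 : Summable (fun n : ℕ => (n : ℝ) ^ (-1 - (1 / 4) : ℝ)) := Real.summable_nat_rpow.2 (by norm_num)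
  exact (h1.mul_left _).of_nonneg_of_le (an_nonneg u) (an_le (by norm_num) le_rfl hu)

lemma pair_bound {η T : ℝ} (hη : 0 < η) {m n : ℕ} (hm : 1 ≤ m) (hmn : m < n) :
    (m : ℝ) ^ (-1 - η) * (n : ℝ) ^ (-1 - η) * ‖osc T (Real.log n - Real.log m)‖ ≤ 2 * Gk η (m, n) := by
  have hm0 : (0 : ℝ) < m := by exact_mod_cast hm
  have hmn0 : (m : ℝ) < n := by exact_mod_cast hmn
  have hn0 : (0 : ℝ) < n := hm0.trans hmn0
  have hlog : ((n : ℝ) - m) / n ≤ Real.log n - Real.log m := by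
    have := Real.log_le_sub_one_of_pos (x := m / n) (by positivity)
    rw [Real.log_div hm0.ne' hn0.ne'] at this
    have e : ((n : ℝ) - m) / n = 1 - m / n := by field_simp
    rw [e]; linarith
  have hpos : 0 < ((n : ℝ) - m) / n := div_pos (by linarith) hn0
  have hb := osc_bound T (φ := Real.log n - Real.log m) (by linarith)
  rw [abs_of_pos (by linarith)] at hb
  have hb2 : ‖osc T (Real.log n - Real.log m)‖ ≤ 2 * (n / (n - m)) := by
    refine hb.trans ?_
    calc 2 / (Real.log n - Real.log m) ≤ 2 / (((n : ℝ) - m) / n) := by gcongr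
      _ = _ := by field_simp
  rw [Gk, if_pos hmn]
  have e1 : (n : ℝ) ^ (-1 - η) = (n : ℝ) ^ (-η) / n := by
    rw [← Real.rpow_sub_one hn0.ne']; congr 1; ring
  have hd : (0 : ℝ) < n - m := by linarith
  have e2 : ((n - m : ℕ) : ℝ) = (n : ℝ) - m := by rw [Nat.cast_sub hmn.le]
  simp only
  rw [e2]
  have e3 : ((n : ℝ) - m) ^ (-1 - η) = ((n : ℝ) - m) ^ (-η) / (n - m) := by
    rw [← Real.rpow_sub_one hd.ne']; congr 1; ring
  have e4 : (n : ℝ) ^ (-η) ≤ ((n : ℝ) - m) ^ (-η) := Real.rpow_le_rpow_of_nonpos hd (by linarith) (by linarith)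
  calc (m : ℝ) ^ (-1 - η) * (n : ℝ) ^ (-1 - η) * ‖osc T (Real.log n - Real.log m)‖
      ≤ (m : ℝ) ^ (-1 - η) * (n : ℝ) ^ (-1 - η) * (2 * (n / (n - m))) := by gcongr
    _ = 2 * ((m : ℝ) ^ (-1 - η) * ((n : ℝ) ^ (-η) / (n - m))) := by rw [e1]; field_simp
    _ ≤ 2 * ((m : ℝ) ^ (-1 - η) * (((n : ℝ) - m) ^ (-η) / (n - m))) := by gcongr
    _ = _ := by rw [e3]

set_option maxHeartbeats 1000000 in
theorem AA_mean {η : ℝ} (hη : 0 < η) (hη2 : η ≤ 1 / 4) : ∃ C : ℝ, 0 ≤ C ∧ ∀ u T : ℝ, 0 ≤ u → 0 ≤ T →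
    |(∫ t in (0 : ℝ)..T, ‖AA u t‖ ^ 2) - T * ∑' n, an u n ^ 2| ≤ C * Real.exp ((1 + 4 * η) * u) := by
  have hG := Gk_summable hη
  have hG2 : Summable (fun p : ℕ × ℕ => Gk η p.swap) := (Equiv.prodComm ℕ ℕ).summable_iff.2 hG
  have hGG := hG.add hG2
  have h0 : ∀ p : ℕ × ℕ, 0 ≤ Gk η p + Gk η p.swap := fun p => add_nonneg (Gk_nonneg _ _) (Gk_nonneg _ _)
  refine ⟨2 / η ^ 2 * ∑' p : ℕ × ℕ, (Gk η p + Gk η p.swap), mul_nonneg (by positivity) (tsum_nonneg h0), fun u T hu hT => ?_⟩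
  have key := mean_value (an u) (fun n => u - Real.log n) (an_nonneg u) (an_summable hu) hT
    (fun p => (2 / η ^ 2 * Real.exp ((1 + 4 * η) * u)) * (Gk η p + Gk η p.swap)) (hGG.mul_left _) ?_ (fun p => mul_nonneg (by positivity) (h0 p))
  · rw [tsum_mul_left] at key
    refine (le_of_eq ?_).trans (key.trans (le_of_eq ?_))
    · rfl
    · ring
  · rintro ⟨m, n⟩ hmn
    simp only at hmn ⊢
    have ez : an u 0 = 0 := by simp [an, lam]
    rcases Nat.eq_zero_or_pos m with rfl | hm
    · rw [ez, zero_mul, zero_mul]; exact mul_nonneg (by positivity) (h0 _)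
    rcases Nat.eq_zero_or_pos n with rfl | hn
    · rw [ez, mul_zero, zero_mul]; exact mul_nonneg (by positivity) (h0 _)
    have hsub : (u - Real.log m) - (u - Real.log n) = Real.log n - Real.log m := by ring
    rw [hsub]
    have hpb : (m : ℝ) ^ (-1 - η) * (n : ℝ) ^ (-1 - η) * ‖osc T (Real.log n - Real.log m)‖ ≤ 2 * (Gk η (m, n) + Gk η (n, m)) := by
      rcases lt_or_gt_of_ne hmn with h | h
      · have := pair_bound (T := T) hη hm h
        linarith [Gk_nonneg η (n, m)]
      · have := pair_bound (T := T) hη hn h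
        have e : ‖osc T (Real.log n - Real.log m)‖ = ‖osc T (Real.log m - Real.log n)‖ := by
          rw [← RCLike.norm_conj (osc T (Real.log n - Real.log m))]
          congr 1
          unfold osc
          rw [intervalIntegral.integral_of_le hT, intervalIntegral.integral_of_le hT, ← integral_conj]
          refine integral_congr_ae (Eventually.of_forall fun t => ?_)
          simp only [← Complex.exp_conj, map_mul, Complex.conj_I, Complex.conj_ofReal]
          congr 1; push_cast; ring
        rw [e, mul_comm ((m : ℝ) ^ (-1 - η))]
        linarith [Gk_nonneg η (m, n)]
    have hm1 := an_le hη hη2 hu m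
    have hn1 := an_le hη hη2 hu n
    calc an u m * an u n * ‖osc T (Real.log n - Real.log m)‖
        ≤ (1 / η * Real.exp ((1 / 2 + 2 * η) * u) * (m : ℝ) ^ (-1 - η)) * (1 / η * Real.exp ((1 / 2 + 2 * η) * u) * (n : ℝ) ^ (-1 - η)) * ‖osc T (Real.log n - Real.log m)‖ := by
          gcongr
          exact an_nonneg u n
      _ = (1 / η ^ 2 * (Real.exp ((1 / 2 + 2 * η) * u) * Real.exp ((1 / 2 + 2 * η) * u))) * ((m : ℝ) ^ (-1 - η) * (n : ℝ) ^ (-1 - η) * ‖osc T (Real.log n - Real.log m)‖) := by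
          field_simp
      _ ≤ (1 / η ^ 2 * (Real.exp ((1 / 2 + 2 * η) * u) * Real.exp ((1 / 2 + 2 * η) * u))) * (2 * (Gk η (m, n) + Gk η (n, m))) := by gcongr
      _ = _ := by
          rw [← Real.exp_add, show (1 / 2 + 2 * η) * u + (1 / 2 + 2 * η) * u = (1 + 4 * η) * u by ring, Prod.swap_prod_mk]; ring

/-! Part 11 of the proof. -/
lemma tends_aux (l : Filter ℝ) (h : Tendsto (fun s : ℝ => |s|) l atTop) :
    Tendsto (fun s : ℝ => s / (1 + s ^ 2)) l (nhds 0) ∧ Tendsto (fun s : ℝ => 1 / (1 + s ^ 2)) l (nhds 0) := by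
  have h0 : Tendsto (fun s : ℝ => |s|⁻¹) l (nhds 0) := tendsto_inv_atTop_zero.comp h
  have hpos : ∀ᶠ s : ℝ in l, 0 < |s| := h.eventually_gt_atTop 0
  constructor
  · refine squeeze_zero_norm' ?_ h0
    filter_upwards [hpos] with s hs
    rw [Real.norm_eq_abs, abs_div, abs_of_pos (show 0 < 1 + s ^ 2 by positivity), ← one_div, div_le_div_iff₀ (by positivity) hs]
    nlinarith [abs_mul_abs_self s]
  · refine squeeze_zero_norm' ?_ h0
    filter_upwards [hpos] with s hs
    rw [Real.norm_eq_abs, abs_div, abs_of_pos (show 0 < 1 + s ^ 2 by positivity), ← one_div, abs_one, div_le_div_iff₀ (by positivity) hs]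
    nlinarith [abs_mul_abs_self s, sq_nonneg (|s| - 1)]

lemma kernel_integrable (a b : ℝ) : Integrable (fun t : ℝ => 1 / (1 + (t - a) ^ 2) * (1 / (1 + (t - b) ^ 2))) := by
  have h1 : Integrable (fun t : ℝ => (1 + (t - a) ^ 2)⁻¹) := integrable_inv_one_add_sq.comp_sub_right a
  refine h1.mono' ?_ (Eventually.of_forall fun t => ?_)
  · refine Continuous.aestronglyMeasurable ?_
    refine (Continuous.div continuous_const (by fun_prop) fun t => by positivity).mul
      (Continuous.div continuous_const (by fun_prop) fun t => by positivity)
  · rw [Real.norm_of_nonneg (by positivity), ← one_div]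
    refine mul_le_of_le_one_right (by positivity) ?_
    rw [div_le_one (by positivity)]; nlinarith [sq_nonneg (t - b)]

lemma kernel_integral0 (d : ℝ) : ∫ t : ℝ, 1 / (1 + t ^ 2) * (1 / (1 + (t - d) ^ 2)) = 2 * π / (4 + d ^ 2) := by
  have hintg : Integrable (fun t : ℝ => 1 / (1 + t ^ 2) * (1 / (1 + (t - d) ^ 2))) := by
    simpa using kernel_integrable 0 d
  have hT : Tendsto (fun s : ℝ => |s|) atTop atTop := tendsto_abs_atTop_atTop
  have hB : Tendsto (fun s : ℝ => |s|) atBot atTop := tendsto_abs_atBot_atTop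
  have aT := tendsto_arctan_atTop.mono_right nhdsWithin_le_nhds
  have aB := tendsto_arctan_atBot.mono_right nhdsWithin_le_nhds
  rcases eq_or_ne d 0 with rfl | hd
  · have hder : ∀ t : ℝ, HasDerivAt (fun t : ℝ => 1 / 2 * (t / (1 + t ^ 2) + Real.arctan t)) (1 / (1 + t ^ 2) * (1 / (1 + (t - 0) ^ 2))) t := by
      intro t
      have h1 : HasDerivAt (fun t : ℝ => 1 + t ^ 2) (2 * t) t := by
        simpa using ((hasDerivAt_id t).pow 2).const_add 1
      have h2 := (((hasDerivAt_id t).div h1 (by positivity)).add (Real.hasDerivAt_arctan t)).const_mul (1 / 2)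
      refine h2.congr_deriv ?_
      have : (1 + t ^ 2) ≠ 0 := by positivity
      simp only [id, sub_zero]
      field_simp
      ring
    have t1 := ((tends_aux _ hT).1.add aT).const_mul (1 / 2)
    have t2 := ((tends_aux _ hB).1.add aB).const_mul (1 / 2)
    rw [integral_of_hasDerivAt_of_tendsto hder hintg t2 t1]
    ring
  · have hder : ∀ t : ℝ, HasDerivAt (fun t : ℝ => 1 / (d * (d ^ 2 + 4)) * Real.log ((1 + t ^ 2) / (1 + (t - d) ^ 2)) + 1 / (d ^ 2 + 4) * (Real.arctan t + Real.arctan (t - d))) (1 / (1 + t ^ 2) * (1 / (1 + (t - d) ^ 2))) t := by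
      intro t
      have h1 : HasDerivAt (fun t : ℝ => 1 + t ^ 2) (2 * t) t := by
        simpa using ((hasDerivAt_id t).pow 2).const_add 1
      have hs : HasDerivAt (fun t : ℝ => t - d) 1 t := (hasDerivAt_id t).sub_const d
      have h2 : HasDerivAt (fun t : ℝ => 1 + (t - d) ^ 2) (2 * (t - d)) t := by
        simpa using (hs.pow 2).const_add 1
      have p1 : (1 + t ^ 2) ≠ 0 := by positivity
      have p2 : (1 + (t - d) ^ 2) ≠ 0 := by positivity
      have p3 : (d ^ 2 + 4) ≠ 0 := by positivity
      have h3 := ((h1.div h2 p2).log (div_ne_zero p1 p2)).const_mul (1 / (d * (d ^ 2 + 4)))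
      have h4 := ((Real.hasDerivAt_arctan t).add (hs.arctan)).const_mul (1 / (d ^ 2 + 4))
      refine (h3.add h4).congr_deriv ?_
      simp only [Pi.div_apply]
      field_simp
      ring
    have lim : ∀ l : Filter ℝ, Tendsto (fun s : ℝ => |s|) l atTop → Tendsto (fun t : ℝ => t - d) l l →
        Tendsto (fun t => Real.log ((1 + t ^ 2) / (1 + (t - d) ^ 2))) l (nhds 0) := by
      intro l hl hs
      obtain ⟨q1, q2⟩ := tends_aux l hl
      have : Tendsto (fun t => (1 + t ^ 2) / (1 + (t - d) ^ 2)) l (nhds (1 + 2 * d * 0 + d ^ 2 * 0)) := by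
        refine ((tendsto_const_nhds.add ((q1.comp hs).const_mul (2 * d))).add ((q2.comp hs).const_mul (d ^ 2))).congr fun t => ?_
        have p2 : (1 + (t - d) ^ 2) ≠ 0 := by positivity
        simp only [Function.comp]
        field_simp
        ring
      have h2 := this.log (by simp)
      simpa using h2
    have sT : Tendsto (fun t : ℝ => t - d) atTop atTop := tendsto_atTop_add_const_right _ (-d) tendsto_id
    have sB : Tendsto (fun t : ℝ => t - d) atBot atBot := tendsto_atBot_add_const_right _ (-d) tendsto_id
    have t1 := ((lim _ hT sT).const_mul (1 / (d * (d ^ 2 + 4)))).add ((aT.add (aT.comp sT)).const_mul (1 / (d ^ 2 + 4)))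
    have t2 := ((lim _ hB sB).const_mul (1 / (d * (d ^ 2 + 4)))).add ((aB.add (aB.comp sB)).const_mul (1 / (d ^ 2 + 4)))
    rw [integral_of_hasDerivAt_of_tendsto hder hintg t2 t1]
    ring

lemma kernel_integral (a b : ℝ) : ∫ t : ℝ, 1 / (1 + (t - a) ^ 2) * (1 / (1 + (t - b) ^ 2)) = 2 * π / (4 + (a - b) ^ 2) := by
  have := integral_sub_right_eq_self (μ := volume) (fun t : ℝ => 1 / (1 + t ^ 2) * (1 / (1 + (t - (b - a)) ^ 2))) a
  rw [kernel_integral0] at this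
  rw [show (a - b) ^ 2 = (b - a) ^ 2 by ring, ← this]
  refine integral_congr_ae (Eventually.of_forall fun t => ?_)
  simp only
  rw [show t - a - (b - a) = t - b by ring]

lemma zerosUpTo_finite (T : ℝ) : (zerosUpTo T).Finite := by
  refine (ZS_finite_ball (1 + |T|)).subset fun ρ hρ => ?_
  obtain ⟨⟨h0, h1, h2⟩, h3, h4⟩ := hρ
  refine ⟨?_, h0⟩
  rw [mem_closedBall_zero_iff]
  refine (Complex.norm_le_abs_re_add_abs_im ρ).trans (add_le_add ?_ ?_)
  · rw [abs_of_pos h1]; exact h2.le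
  · rw [abs_of_pos h3]; exact h4.trans (le_abs_self _)

instance (T : ℝ) : Finite (zerosUpTo T) := (zerosUpTo_finite T).to_subtype

def STz (u T t : ℝ) : ℂ := ∑' ρ : zerosUpTo T, ((zetaMult ρ * (2 / (1 + (t - (ρ : ℂ).im) ^ 2)) : ℝ) : ℂ) * Complex.exp (I * (ρ : ℂ).im * u)

lemma STz_continuous (u T : ℝ) : Continuous (STz u T) := by
  have := Fintype.ofFinite (zerosUpTo T)
  unfold STz
  simp_rw [tsum_fintype]
  refine continuous_finsetSum _ fun ρ _ => ?_
  refine Continuous.mul (Complex.continuous_ofReal.comp ?_) continuous_const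
  refine continuous_const.mul (Continuous.div continuous_const (by fun_prop) fun t => by positivity)

lemma Fxt_eq (x T : ℝ) : Integrable (fun t => ‖STz (Real.log x) T t‖ ^ 2) ∧
    Fxt x T = ((1 / (2 * π) * ∫ t, ‖STz (Real.log x) T t‖ ^ 2 : ℝ) : ℂ) := by
  have := Fintype.ofFinite (zerosUpTo T)
  set u := Real.log x
  set g : zerosUpTo T × zerosUpTo T → ℝ → ℂ := fun p t =>
    ((zetaMult p.1 * zetaMult p.2 : ℂ) * Complex.exp (I * (((p.1 : ℂ).im - (p.2 : ℂ).im : ℝ) : ℂ) * (u : ℂ)) * 4) *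
      ((1 / (1 + (t - (p.1 : ℂ).im) ^ 2) * (1 / (1 + (t - (p.2 : ℂ).im) ^ 2)) : ℝ) : ℂ) with hg
  have hpt : ∀ t, ((‖STz u T t‖ ^ 2 : ℝ) : ℂ) = ∑ p, g p t := by
    intro t
    rw [← Complex.normSq_eq_norm_sq, ← Complex.mul_conj, STz, tsum_fintype, map_sum, Finset.sum_mul_sum, ← Finset.univ_product_univ, Finset.sum_product]
    refine Finset.sum_congr rfl fun p _ => Finset.sum_congr rfl fun q _ => ?_
    rw [hg]
    simp only [map_mul, Complex.conj_ofReal, ← Complex.exp_conj, Complex.conj_I]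
    have : Complex.exp (I * (((p : ℂ).im - (q : ℂ).im : ℝ) : ℂ) * (u : ℂ)) = Complex.exp (I * (p : ℂ).im * u) * Complex.exp (-I * (q : ℂ).im * u) := by
      rw [← Complex.exp_add]; congr 1; push_cast; ring
    rw [this]; push_cast; ring
  have hgi : ∀ p, Integrable (g p) := fun p => ((kernel_integrable _ _).ofReal).const_mul _
  have hI : Integrable (fun t => ((‖STz u T t‖ ^ 2 : ℝ) : ℂ)) := by
    simp_rw [hpt]
    exact integrable_finsetSum _ fun p _ => hgi p
  have hI2 : Integrable (fun t => ‖STz u T t‖ ^ 2) := by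
    refine hI.re.congr (Eventually.of_forall fun t => ?_)
    simp only [RCLike.re_to_complex, Complex.ofReal_re]
  refine ⟨hI2, ?_⟩
  rw [Complex.ofReal_mul, ← integral_complex_ofReal]
  simp_rw [hpt]
  rw [integral_finsetSum _ fun p _ => hgi p, Fxt, tsum_fintype, Finset.mul_sum]
  refine Finset.sum_congr rfl fun p _ => ?_
  rw [hg]
  simp only
  rw [integral_const_mul, integral_complex_ofReal, kernel_integral]
  have hpi : (π : ℂ) ≠ 0 := by exact_mod_cast Real.pi_ne_zero
  push_cast
  field_simp
  rfl

lemma Fxt_inv (x T : ℝ) : Fxt x⁻¹ T = Fxt x T := by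
  unfold Fxt
  rw [← (Equiv.prodComm (zerosUpTo T) (zerosUpTo T)).tsum_eq]
  refine tsum_congr fun p => ?_
  simp only [Equiv.prodComm_apply, Prod.fst_swap, Prod.snd_swap, Real.log_inv]
  rw [mul_comm (zetaMult p.2 : ℂ), show ((p.2 : ℂ).im - (p.1 : ℂ).im) ^ 2 = ((p.1 : ℂ).im - (p.2 : ℂ).im) ^ 2 by ring]
  congr 2
  congr 1
  push_cast; ring

lemma FF_part1 (T : ℝ) (hT : 2 ≤ T) (α : ℝ) : (FF α T).im = 0 ∧ FF (-α) T = FF α T ∧ 0 ≤ (FF α T).re := by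
  have h : FF α T = (((T / (2 * π) * Real.log T)⁻¹ * (1 / (2 * π) * ∫ t, ‖STz (Real.log (T ^ α)) T t‖ ^ 2) : ℝ) : ℂ) := by
    rw [FF, (Fxt_eq _ _).2]; push_cast; rfl
  refine ⟨by rw [h, Complex.ofReal_im], ?_, ?_⟩
  · rw [FF, FF, Real.rpow_neg (by linarith), Fxt_inv]
  · rw [h, Complex.ofReal_re]
    have := Real.log_nonneg (by linarith : (1 : ℝ) ≤ T)
    have h2 : 0 ≤ ∫ t, ‖STz (Real.log (T ^ α)) T t‖ ^ 2 := integral_nonneg fun t => by positivity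
    have := Real.pi_pos
    positivity

/-! Part 12 of the proof. -/
lemma density_sum (hRH : RiemannHypothesis) :
    Summable (fun ρ : ZS => mu ρ * (1 + |(ρ : ℂ).im|) ^ (-(3 / 2) : ℝ)) := by
  obtain ⟨C, hC, hd⟩ := zero_density hRH
  set f : ℤ × ZS → ℝ := fun p => (1 + |(p.1 : ℝ)|) ^ (-(3 / 2) : ℝ) * (mu p.2 * (1 / (1 + ((p.1 : ℝ) - (p.2 : ℂ).im) ^ 2))) with hf
  have hf0 : 0 ≤ f := fun p => by
    have := mu_nonneg (p.2 : ℂ)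
    simp only [hf, Pi.zero_apply]; positivity
  have hfs : Summable f := by
    have hfib : ∀ n : ℤ, Summable (fun ρ : ZS => f (n, ρ)) := by
      intro n
      have h := (mu_summable hRH (n : ℝ)).mul_left ((1 + |(n : ℝ)|) ^ (-(3 / 2) : ℝ))
      exact h
    refine (summable_prod_of_nonneg hf0).2 ⟨hfib, ?_⟩
    have h1 : Summable (fun n : ℤ => (C * 16) * |(n : ℝ)| ^ (-(11 / 8) : ℝ)) :=
      (Real.summable_abs_int_rpow (by norm_num : (1 : ℝ) < 11 / 8)).mul_left _
    refine h1.of_norm_bounded_eventually ?_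
    have : ∀ᶠ n : ℤ in cofinite, n ≠ 0 := (Set.finite_singleton (0 : ℤ)).eventually_cofinite_notMem
    filter_upwards [this] with n hn
    have hn1 : (1 : ℝ) ≤ |(n : ℝ)| := by
      have := Int.one_le_abs hn
      exact_mod_cast this
    rw [Real.norm_of_nonneg (tsum_nonneg fun ρ => hf0 (n, ρ))]
    simp only [hf]
    rw [tsum_mul_left]
    have hy : (1 : ℝ) ≤ |(n : ℝ)| + 2 := by linarith
    have hl : Real.log (|(n : ℝ)| + 2) ≤ 8 * (|(n : ℝ)| + 2) ^ (1 / 8 : ℝ) := by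
      have h := log_sq_le hy
      refine abs_le_of_sq_le_sq' ?_ (by positivity) |>.2
      refine h.trans (le_of_eq ?_)
      rw [mul_pow, ← Real.rpow_natCast ((|(n : ℝ)| + 2) ^ (1 / 8 : ℝ)), ← Real.rpow_mul (by linarith)]
      norm_num
    have hl2 : Real.log (|(n : ℝ)| + 2) ≤ 16 * |(n : ℝ)| ^ (1 / 8 : ℝ) := by
      refine hl.trans ?_
      have h3 : (|(n : ℝ)| + 2) ^ (1 / 8 : ℝ) ≤ (3 * |(n : ℝ)|) ^ (1 / 8 : ℝ) :=
        Real.rpow_le_rpow (by linarith) (by linarith) (by norm_num)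
      rw [Real.mul_rpow (by norm_num) (by positivity)] at h3
      have h4 : (3 : ℝ) ^ (1 / 8 : ℝ) ≤ 2 := by
        refine (Real.rpow_le_rpow (by norm_num) (by norm_num : (3 : ℝ) ≤ 2 ^ (8 : ℝ)) (by norm_num)).trans (le_of_eq ?_)
        rw [← Real.rpow_mul (by norm_num)]; norm_num
      have : 0 ≤ |(n : ℝ)| ^ (1 / 8 : ℝ) := by positivity
      nlinarith
    have h5 : (1 + |(n : ℝ)|) ^ (-(3 / 2) : ℝ) ≤ |(n : ℝ)| ^ (-(3 / 2) : ℝ) :=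
      Real.rpow_le_rpow_of_nonpos (by linarith) (by linarith) (by norm_num)
    have h6 : ∑' ρ : ZS, mu ρ * (1 / (1 + ((n : ℝ) - (ρ : ℂ).im) ^ 2)) ≤ C * (16 * |(n : ℝ)| ^ (1 / 8 : ℝ)) :=
      (hd n).trans (by gcongr)
    calc _ ≤ |(n : ℝ)| ^ (-(3 / 2) : ℝ) * (C * (16 * |(n : ℝ)| ^ (1 / 8 : ℝ))) := by
          refine mul_le_mul h5 h6 (tsum_nonneg fun ρ => ?_) (by positivity)
          have := mu_nonneg (ρ : ℂ)
          positivity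
      _ = C * 16 * (|(n : ℝ)| ^ (-(3 / 2) : ℝ) * |(n : ℝ)| ^ (1 / 8 : ℝ)) := by ring
      _ = _ := by rw [← Real.rpow_add (by linarith)]; norm_num
  have hinj : Function.Injective (fun ρ : ZS => ((⌊(ρ : ℂ).im⌋, ρ) : ℤ × ZS)) := fun a b h => (Prod.mk.inj h).2
  have h2 := (hfs.comp_injective hinj).mul_left (2 * 4)
  refine Summable.of_nonneg_of_le (fun ρ => ?_) (fun ρ => ?_) h2
  · have := mu_nonneg (ρ : ℂ)
    positivity
  · simp only [Function.comp, hf]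
    set γ := (ρ : ℂ).im
    set n := ⌊γ⌋
    have h3 : (n : ℝ) ≤ γ := Int.floor_le γ
    have h4 : γ < n + 1 := Int.lt_floor_add_one γ
    have h5 : (1 : ℝ) / 2 ≤ 1 / (1 + ((n : ℝ) - γ) ^ 2) := by
      apply one_div_le_one_div_of_le (by positivity)
      nlinarith
    have h6 : 1 + |(n : ℝ)| ≤ 2 * (1 + |γ|) := by
      have : |(n : ℝ)| ≤ |γ| + 1 := by
        rw [abs_le]; constructor
        · have := neg_abs_le γ; linarith
        · have := le_abs_self γ; linarith
      have := abs_nonneg γ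
      linarith
    have h7 : (1 + |γ|) ^ (-(3 / 2) : ℝ) ≤ 4 * (1 + |(n : ℝ)|) ^ (-(3 / 2) : ℝ) := by
      have h8 := Real.rpow_le_rpow_of_nonpos (by positivity) h6 (by norm_num : (-(3 / 2) : ℝ) ≤ 0)
      rw [Real.mul_rpow (by norm_num) (by positivity)] at h8
      have h9 : (1 : ℝ) / 4 ≤ 2 ^ (-(3 / 2) : ℝ) := by
        rw [show (1 : ℝ) / 4 = 2 ^ (-2 : ℝ) by rw [Real.rpow_neg (by norm_num)]; norm_num]
        exact Real.rpow_le_rpow_of_exponent_le (by norm_num) (by norm_num)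
      have : 0 ≤ (1 + |γ|) ^ (-(3 / 2) : ℝ) := by positivity
      nlinarith
    have hm := mu_nonneg (ρ : ℂ)
    calc mu ρ * (1 + |γ|) ^ (-(3 / 2) : ℝ) ≤ mu ρ * (4 * (1 + |(n : ℝ)|) ^ (-(3 / 2) : ℝ)) := by gcongr
      _ = 2 * 4 * ((1 + |(n : ℝ)|) ^ (-(3 / 2) : ℝ) * (mu ρ * (1 / 2))) := by ring
      _ ≤ _ := by gcongr

open Classical in
lemma STz_eq (hRH : RiemannHypothesis) (u T t : ℝ) : STz u T t = ∑' ρ : ZS,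
    (if 0 < (ρ : ℂ).im ∧ (ρ : ℂ).im ≤ T then ((mu ρ * (2 / (1 + (t - (ρ : ℂ).im) ^ 2)) : ℝ) : ℂ) * Complex.exp (I * (ρ : ℂ).im * u) else 0) := by
  unfold STz
  rw [tsum_subtype (zerosUpTo T) (fun ρ : ℂ => ((zetaMult ρ * (2 / (1 + (t - (ρ : ℂ).im) ^ 2)) : ℝ) : ℂ) * Complex.exp (I * (ρ : ℂ).im * u)),
    tsum_subtype ZS (fun ρ : ℂ => if 0 < (ρ : ℂ).im ∧ (ρ : ℂ).im ≤ T then ((mu ρ * (2 / (1 + (t - (ρ : ℂ).im) ^ 2)) : ℝ) : ℂ) * Complex.exp (I * (ρ : ℂ).im * u) else 0)]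
  refine tsum_congr fun ρ => ?_
  by_cases h : ρ ∈ zerosUpTo T
  · have hz : ρ ∈ ZS := h.1.1
    have hre : ρ.re = 1 / 2 := by
      rcases zero_cases hRH hz with ⟨k, hk⟩ | h2
      · exfalso
        have h3 := h.1.2.1
        rw [hk] at h3
        have h4 : ((-2 * ((k : ℂ) + 1)) : ℂ) = ((-2 * ((k : ℝ) + 1) : ℝ) : ℂ) := by push_cast; ring
        rw [h4, Complex.ofReal_re] at h3
        have : (0 : ℝ) ≤ k := by positivity
        linarith
      · exact h2
    rw [indicator_of_mem h, indicator_of_mem hz, if_pos h.2, mu, if_pos hre]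
  · rw [indicator_of_notMem h]
    by_cases hz : ρ ∈ ZS
    · rw [indicator_of_mem hz]
      split_ifs with h2
      · have hre : ρ.re ≠ 1 / 2 := fun hre => h ⟨⟨hz, by rw [hre]; norm_num, by rw [hre]; norm_num⟩, h2⟩
        rw [mu, if_neg hre]; simp
      · rfl
    · rw [indicator_of_notMem hz]

def rel (T t γ : ℝ) : Prop := ¬ ((0 ≤ t ∧ t ≤ T) ↔ (0 < γ ∧ γ ≤ T))

open Classical in
def DD (T t : ℝ) : ℝ := ∑' ρ : ZS, if rel T t (ρ : ℂ).im then mu ρ * (1 / (1 + (t - (ρ : ℂ).im) ^ 2)) else 0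

open Classical in
lemma DD_summable (hRH : RiemannHypothesis) (T t : ℝ) : Summable (fun ρ : ZS => if rel T t (ρ : ℂ).im then mu ρ * (1 / (1 + (t - (ρ : ℂ).im) ^ 2)) else 0) := by
  refine Summable.of_nonneg_of_le (fun ρ => ?_) (fun ρ => ?_) (mu_summable hRH t) <;>
  · have := mu_nonneg (ρ : ℂ)
    split_ifs <;> first | positivity | exact le_rfl

lemma DD_nonneg (T t : ℝ) : 0 ≤ DD T t := tsum_nonneg fun ρ => by
  have := mu_nonneg (ρ : ℂ)
  split_ifs <;> first | positivity | exact le_rfl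

open Classical in
lemma ST_SS (hRH : RiemannHypothesis) (u T t : ℝ) :
    ‖STz u T t - (if 0 ≤ t ∧ t ≤ T then SS u t else 0)‖ ≤ 2 * DD T t := by
  set g : ZS → ℂ := fun ρ => ((mu ρ * (2 / (1 + (t - (ρ : ℂ).im) ^ 2)) : ℝ) : ℂ) * Complex.exp (I * (ρ : ℂ).im * u) with hg
  have hn : ∀ ρ, ‖g ρ‖ = 2 * (mu ρ * (1 / (1 + (t - (ρ : ℂ).im) ^ 2))) := by
    intro ρ
    have hm := mu_nonneg (ρ : ℂ)
    have he : ‖Complex.exp (I * (ρ : ℂ).im * u)‖ = 1 := by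
      rw [show I * ((ρ : ℂ).im : ℂ) * (u : ℂ) = (((ρ : ℂ).im * u : ℝ) : ℂ) * I by push_cast; ring]
      exact Complex.norm_exp_ofReal_mul_I _
    rw [hg]
    simp only
    rw [norm_mul, he, Complex.norm_real, Real.norm_of_nonneg (by positivity)]
    ring
  have hgs : Summable g := by
    refine Summable.of_norm ?_
    simp_rw [hn]
    exact (mu_summable hRH t).mul_left 2
  have hgs1 : Summable (fun ρ : ZS => if 0 < (ρ : ℂ).im ∧ (ρ : ℂ).im ≤ T then g ρ else 0) := by
    refine Summable.of_norm_bounded hgs.norm fun ρ => ?_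
    split_ifs <;> simp
  have hgs2 : Summable (fun ρ : ZS => if 0 ≤ t ∧ t ≤ T then g ρ else 0) := by
    refine Summable.of_norm_bounded hgs.norm fun ρ => ?_
    split_ifs <;> simp
  have e2 : (if 0 ≤ t ∧ t ≤ T then SS u t else 0) = ∑' ρ : ZS, (if 0 ≤ t ∧ t ≤ T then g ρ else 0) := by
    split_ifs
    · rfl
    · simp
  have e1 : STz u T t = ∑' ρ : ZS, (if 0 < (ρ : ℂ).im ∧ (ρ : ℂ).im ≤ T then g ρ else 0) := by
    rw [STz_eq hRH]
  rw [e1, e2, ← hgs1.tsum_sub hgs2, DD, ← tsum_mul_left]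
  refine tsum_of_norm_bounded ((DD_summable hRH T t).mul_left 2).hasSum fun ρ => ?_
  by_cases h1 : 0 ≤ t ∧ t ≤ T <;> by_cases h2 : 0 < (ρ : ℂ).im ∧ (ρ : ℂ).im ≤ T <;>
    simp only [h1, h2, rel, if_true, if_false, and_self, true_iff, iff_self, not_true, not_false_iff, sub_self, norm_zero, mul_zero, le_refl, sub_zero, zero_sub, norm_neg, hn, iff_true, iff_false]

/-- pointwise kernel inequality -/
lemma rel_kernel {r T t γ : ℝ} (hr : 2 ≤ r) (hT : T = r ^ 10) (h1 : r ^ 9 < |t|) (h2 : r ^ 9 < |t - T|)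
    (h : rel T t γ) : (1 + |γ|) ^ 3 * (t ^ 2 + T ^ 2) ≤ 256 * T ^ 2 * (1 + (t - γ) ^ 2) ^ 2 := by
  have hr9 : (1 : ℝ) ≤ r ^ 9 := one_le_pow₀ (by linarith)
  have hTr : T = r * r ^ 9 := by rw [hT]; ring
  have hT1 : 1 ≤ T := by rw [hT]; exact one_le_pow₀ (by linarith)
  have key : ∀ y, y = |t - γ| → (1 + |γ|) ^ 3 * (t ^ 2 + T ^ 2) ≤ 256 * T ^ 2 * y ^ 4 →
      (1 + |γ|) ^ 3 * (t ^ 2 + T ^ 2) ≤ 256 * T ^ 2 * (1 + (t - γ) ^ 2) ^ 2 := by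
    intro y hy hh
    refine hh.trans ?_
    have : y ^ 4 = ((t - γ) ^ 2) ^ 2 := by rw [hy, ← sq_abs (t - γ)]; ring
    rw [this]
    gcongr
    linarith
  refine key _ rfl ?_
  set y := |t - γ| with hy
  have hy0 : 0 ≤ y := abs_nonneg _
  by_cases ht : 0 ≤ t ∧ t ≤ T
  · have hγ : ¬ (0 < γ ∧ γ ≤ T) := fun hγ => h ⟨fun _ => hγ, fun _ => ht⟩
    rw [abs_of_nonneg ht.1] at h1
    rw [abs_of_nonpos (by linarith [ht.2])] at h2
    have hA : r ^ 9 ≤ y ∧ 1 + |γ| ≤ 2 * r * y := by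
      rcases le_or_gt γ 0 with h0 | h0
      · have : y = t - γ := by rw [hy, abs_of_nonneg (by linarith)]
        rw [abs_of_nonpos h0, this]
        refine ⟨by linarith, ?_⟩
        nlinarith
      · have h3 : T < γ := by by_contra hh; exact hγ ⟨h0, not_lt.1 hh⟩
        have : y = γ - t := by rw [hy, abs_of_nonpos (by linarith [ht.2])]; ring
        rw [abs_of_pos h0, this]
        refine ⟨by linarith, ?_⟩
        nlinarith [ht.2, mul_le_mul_of_nonneg_left (by linarith : r ^ 9 ≤ γ - t) (by linarith : 0 ≤ r)]
    have hy1 : 1 ≤ y := hr9.trans hA.1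
    have hr3 : r ^ 3 ≤ y := le_trans (pow_le_pow_right₀ (by linarith) (by norm_num)) hA.1
    have hs : t ^ 2 + T ^ 2 ≤ 2 * T ^ 2 := by nlinarith [ht.1, ht.2]
    calc (1 + |γ|) ^ 3 * (t ^ 2 + T ^ 2) ≤ (2 * r * y) ^ 3 * (2 * T ^ 2) := by
          have := abs_nonneg γ
          gcongr
          exact hA.2
      _ = 16 * T ^ 2 * (r ^ 3 * y ^ 3) := by ring
      _ ≤ 16 * T ^ 2 * (y * y ^ 3) := by gcongr
      _ ≤ _ := by nlinarith [show 0 ≤ T ^ 2 * y ^ 4 by positivity]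
  · have hγ : 0 < γ ∧ γ ≤ T := by
      by_contra hγ; exact h ⟨fun x => absurd x ht, fun x => absurd x hγ⟩
    have hB : r ^ 9 ≤ y ∧ t ^ 2 ≤ 2 * y ^ 2 + 2 * T ^ 2 := by
      rcases lt_or_ge t 0 with h0 | h0
      · have : y = γ - t := by rw [hy, abs_of_nonpos (by linarith [hγ.1])]; ring
        rw [abs_of_neg h0] at h1
        rw [this]
        refine ⟨by linarith [hγ.1], ?_⟩
        nlinarith [hγ.1]
      · have h3 : T < t := by by_contra hh; exact ht ⟨h0, not_lt.1 hh⟩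
        have : y = t - γ := by rw [hy, abs_of_nonneg (by linarith [hγ.2])]
        rw [abs_of_pos (by linarith)] at h2
        rw [this]
        refine ⟨by linarith [hγ.2], ?_⟩
        nlinarith [hγ.1, hγ.2, sq_nonneg (t - γ - T)]
    have hy1 : 1 ≤ y := hr9.trans hB.1
    have hTy : T ≤ y ^ 2 := by
      calc T = r ^ 10 := hT
        _ ≤ r ^ 18 := pow_le_pow_right₀ (by linarith) (by norm_num)
        _ = (r ^ 9) ^ 2 := by ring
        _ ≤ y ^ 2 := by gcongr; exact hB.1
    have hTy3 : T ^ 3 ≤ y ^ 4 := by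
      calc T ^ 3 = r ^ 30 := by rw [hT]; ring
        _ ≤ r ^ 36 := pow_le_pow_right₀ (by linarith) (by norm_num)
        _ = (r ^ 9) ^ 4 := by ring
        _ ≤ y ^ 4 := by gcongr; exact hB.1
    have hg : (1 + |γ|) ≤ 2 * T := by rw [abs_of_pos hγ.1]; linarith [hγ.2]
    calc (1 + |γ|) ^ 3 * (t ^ 2 + T ^ 2) ≤ (2 * T) ^ 3 * (2 * y ^ 2 + 2 * T ^ 2 + T ^ 2) := by
          have := abs_nonneg γ
          gcongr
          exact hB.2
      _ = 8 * T ^ 2 * (2 * (T * y ^ 2) + 3 * T ^ 3) := by ring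
      _ ≤ 8 * T ^ 2 * (2 * (y ^ 2 * y ^ 2) + 3 * y ^ 4) := by gcongr
      _ = 40 * T ^ 2 * y ^ 4 := by ring
      _ ≤ _ := by nlinarith [show 0 ≤ T ^ 2 * y ^ 4 by positivity]

open Classical in
def GG (r T t : ℝ) : ℝ := (Icc (-r ^ 9) (r ^ 9)).indicator (fun _ => Real.log T ^ 2) t +
  (Icc (T - r ^ 9) (T + r ^ 9)).indicator (fun _ => Real.log T ^ 2) t + T ^ 2 / (t ^ 2 + T ^ 2)

lemma DD_bound (hRH : RiemannHypothesis) : ∃ C : ℝ, 0 ≤ C ∧ ∀ r T t : ℝ, 2 ≤ r → T = r ^ 10 → DD T t ^ 2 ≤ C * GG r T t := by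
  obtain ⟨C, hC, hd⟩ := zero_density hRH
  set Sg := ∑' ρ : ZS, mu ρ * (1 + |(ρ : ℂ).im|) ^ (-(3 / 2) : ℝ) with hSg
  have hSg0 : 0 ≤ Sg := tsum_nonneg fun ρ => by
    have := mu_nonneg (ρ : ℂ)
    positivity
  refine ⟨4 * C ^ 2 + 256 * Sg ^ 2, by positivity, fun r T t hr hT => ?_⟩
  have hr9 : (1 : ℝ) ≤ r ^ 9 := one_le_pow₀ (by linarith)
  have hTr : T = r * r ^ 9 := by rw [hT]; ring
  have hT4 : 4 ≤ T := by
    have : (2 : ℝ) ^ 10 ≤ r ^ 10 := by gcongr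
    rw [hT]; linarith
  have hl : 0 ≤ Real.log T := Real.log_nonneg (by linarith)
  have hD0 := DD_nonneg T t
  have hi1 : 0 ≤ (Icc (-r ^ 9) (r ^ 9)).indicator (fun _ => Real.log T ^ 2) t := indicator_nonneg (fun _ _ => by positivity) _
  have hi2 : 0 ≤ (Icc (T - r ^ 9) (T + r ^ 9)).indicator (fun _ => Real.log T ^ 2) t := indicator_nonneg (fun _ _ => by positivity) _
  have hi3 : 0 ≤ T ^ 2 / (t ^ 2 + T ^ 2) := by positivity
  have near : |t| ≤ 2 * T → Real.log T ^ 2 ≤ GG r T t → DD T t ^ 2 ≤ (4 * C ^ 2 + 256 * Sg ^ 2) * GG r T t := by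
    intro h1 h2
    have h3 : DD T t ≤ C * (2 * Real.log T) := by
      classical
      refine le_trans ?_ ((hd t).trans ?_)
      · refine (DD_summable hRH T t).tsum_le_tsum (fun ρ => ?_) (mu_summable hRH t)
        have := mu_nonneg (ρ : ℂ)
        split_ifs <;> first | positivity | exact le_rfl
      · gcongr
        rw [show 2 * Real.log T = Real.log (T ^ 2) by rw [Real.log_pow]; norm_num]
        apply Real.log_le_log (by positivity)
        nlinarith
    calc DD T t ^ 2 ≤ (C * (2 * Real.log T)) ^ 2 := by gcongr
      _ = 4 * C ^ 2 * Real.log T ^ 2 := by ring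
      _ ≤ (4 * C ^ 2) * GG r T t := by gcongr
      _ ≤ _ := by
        have : 0 ≤ GG r T t := le_trans (by positivity) h2
        nlinarith [mul_nonneg (sq_nonneg Sg) this]
  have hr9T : r ^ 9 ≤ T := by rw [hTr]; nlinarith
  by_cases h1 : |t| ≤ r ^ 9
  · refine near (by linarith) ?_
    rw [GG, indicator_of_mem (by rw [mem_Icc]; exact abs_le.1 h1)]
    linarith
  by_cases h2 : |t - T| ≤ r ^ 9
  · have h2' := abs_le.1 h2
    refine near ?_ ?_
    · rw [abs_le]; constructor <;> linarith
    · rw [GG, indicator_of_mem (s := Icc (T - r ^ 9) (T + r ^ 9)) (by rw [mem_Icc]; constructor <;> linarith)]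
      linarith
  push Not at h1 h2
  have hq : 0 < t ^ 2 + T ^ 2 := by positivity
  have h3 : DD T t ≤ 16 * T / √(t ^ 2 + T ^ 2) * Sg := by
    classical
    rw [hSg, ← tsum_mul_left]
    refine (DD_summable hRH T t).tsum_le_tsum (fun ρ => ?_) ((density_sum hRH).mul_left _)
    have hm := mu_nonneg (ρ : ℂ)
    split_ifs with hrel
    · set γ := (ρ : ℂ).im
      have hk := rel_kernel hr hT h1 h2 hrel
      have : 1 / (1 + (t - γ) ^ 2) ≤ 16 * T / √(t ^ 2 + T ^ 2) * (1 + |γ|) ^ (-(3 / 2) : ℝ) := by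
        refine abs_le_of_sq_le_sq' ?_ (by positivity) |>.2
        have e1 : ((1 + |γ|) ^ (-(3 / 2) : ℝ)) ^ 2 = 1 / (1 + |γ|) ^ 3 := by
          rw [← Real.rpow_natCast, ← Real.rpow_mul (by positivity), show (-(3 / 2) : ℝ) * ((2 : ℕ) : ℝ) = -((3 : ℕ) : ℝ) by norm_num, Real.rpow_neg (by positivity), Real.rpow_natCast, one_div]
        rw [mul_pow, div_pow, div_pow, Real.sq_sqrt hq.le, e1, div_mul_div_comm, div_le_div_iff₀ (by positivity) (by positivity)]
        nlinarith
      calc _ ≤ mu ρ * (16 * T / √(t ^ 2 + T ^ 2) * (1 + |γ|) ^ (-(3 / 2) : ℝ)) := by gcongr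
        _ = _ := by ring
    · positivity
  calc DD T t ^ 2 ≤ (16 * T / √(t ^ 2 + T ^ 2) * Sg) ^ 2 := by gcongr
    _ = 256 * Sg ^ 2 * (T ^ 2 / (t ^ 2 + T ^ 2)) := by
      rw [mul_pow, div_pow, Real.sq_sqrt hq.le]; ring
    _ ≤ (256 * Sg ^ 2) * GG r T t := by
      gcongr
      rw [GG]; linarith
    _ ≤ _ := by
      have : 0 ≤ GG r T t := by rw [GG]; positivity
      nlinarith [mul_nonneg (sq_nonneg C) this]

lemma cauchy_int (T : ℝ) (hT : 0 < T) : Integrable (fun t : ℝ => T ^ 2 / (t ^ 2 + T ^ 2)) ∧ ∫ t : ℝ, T ^ 2 / (t ^ 2 + T ^ 2) = π * T := by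
  have e : (fun t : ℝ => T ^ 2 / (t ^ 2 + T ^ 2)) = fun t => (fun s : ℝ => (1 + s ^ 2)⁻¹) (t / T) := by
    funext t
    simp only
    field_simp
    ring
  rw [e]
  refine ⟨integrable_inv_one_add_sq.comp_div hT.ne', ?_⟩
  rw [Measure.integral_comp_div (fun s : ℝ => (1 + s ^ 2)⁻¹) T, integral_univ_inv_one_add_sq, abs_of_pos hT]
  simp [mul_comm]

lemma GG_int : ∀ r T : ℝ, 2 ≤ r → T = r ^ 10 → Integrable (GG r T) ∧ ∫ t, GG r T t ≤ 400 * r ^ 9 * r + 4 * T + 4 * r ^ 9 * Real.log T ^ 2 := by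
  intro r T hr hT
  have hr9 : (1 : ℝ) ≤ r ^ 9 := one_le_pow₀ (by linarith)
  have hT0 : 0 < T := by rw [hT]; positivity
  obtain ⟨c1, c2⟩ := cauchy_int T hT0
  have i1 : Integrable ((Icc (-r ^ 9) (r ^ 9)).indicator (fun _ : ℝ => Real.log T ^ 2)) :=
    (integrable_indicator_iff measurableSet_Icc).2 (integrableOn_const (by simp))
  have i2 : Integrable ((Icc (T - r ^ 9) (T + r ^ 9)).indicator (fun _ : ℝ => Real.log T ^ 2)) :=
    (integrable_indicator_iff measurableSet_Icc).2 (integrableOn_const (by simp))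
  refine ⟨(i1.add i2).add c1, ?_⟩
  unfold GG
  rw [integral_add (f := fun t => (Icc (-r ^ 9) (r ^ 9)).indicator (fun _ : ℝ => Real.log T ^ 2) t + (Icc (T - r ^ 9) (T + r ^ 9)).indicator (fun _ : ℝ => Real.log T ^ 2) t) (i1.add i2) c1,
    integral_add i1 i2, c2, integral_indicator measurableSet_Icc, integral_indicator measurableSet_Icc, setIntegral_const, setIntegral_const]
  simp only [measureReal_def, Real.volume_Icc, smul_eq_mul]
  rw [ENNReal.toReal_ofReal (by linarith), ENNReal.toReal_ofReal (by linarith)]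
  have := Real.pi_lt_four
  nlinarith [show 0 ≤ r ^ 9 * r by positivity]

lemma GG_int2 (r T : ℝ) (hr : 2 ≤ r) (hT : T = r ^ 10) : Integrable (GG r T) ∧ ∫ t, GG r T t ≤ 30000 * T := by
  obtain ⟨h1, h2⟩ := GG_int r T hr hT
  refine ⟨h1, h2.trans ?_⟩
  have hl : Real.log T ^ 2 ≤ 6400 * r := by
    rw [hT, Real.log_pow, mul_pow]
    have h3 := log_sq_le (by linarith : (1 : ℝ) ≤ r)
    have h4 : r ^ (1 / 4 : ℝ) ≤ r ^ (1 : ℝ) := Real.rpow_le_rpow_of_exponent_le (by linarith) (by norm_num)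
    rw [Real.rpow_one] at h4
    push_cast
    nlinarith
  have hTr : T = r ^ 9 * r := by rw [hT]; ring
  rw [hTr] at hl ⊢
  have : 0 ≤ r ^ 9 := by positivity
  nlinarith [mul_le_mul_of_nonneg_left hl this, show 0 ≤ r ^ 9 * r by positivity]

/-! Part 13 of the proof. -/
lemma AA_continuous {u : ℝ} (hu : 0 ≤ u) : Continuous (AA u) := by
  unfold AA
  refine continuous_tsum (u := an u) (fun n => by fun_prop) (an_summable hu) fun n t => ?_
  have he : ‖Complex.exp (I * t * (u - Real.log n : ℝ))‖ = 1 := by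
    rw [show I * (t : ℂ) * ((u - Real.log n : ℝ) : ℂ) = ((t * (u - Real.log n) : ℝ) : ℂ) * I by push_cast; ring]
    exact Complex.norm_exp_ofReal_mul_I _
  rw [norm_mul, he, Complex.norm_real, Real.norm_of_nonneg (an_nonneg u n), mul_one]

/-- the second main term -/
def BB (u T t : ℝ) : ℂ := (Real.log T : ℂ) * Complex.exp ((-1 + t * I) * u)

lemma norm_exp_aux (u t : ℝ) : ‖Complex.exp ((-1 + t * I) * u)‖ = Real.exp (-u) := by
  rw [Complex.norm_exp, Complex.re_mul_ofReal]; simp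

lemma BB_continuous (u T : ℝ) : Continuous (BB u T) := by unfold BB; fun_prop

def VV (u T t : ℝ) : ℂ := -AA u t + BB u T t

lemma VV_continuous {u : ℝ} (hu : 0 ≤ u) (T : ℝ) : Continuous (VV u T) := (AA_continuous hu).neg.add (BB_continuous u T)

def ERR (u T t : ℝ) : ℂ := STz u T t - (Icc 0 T).indicator (VV u T) t

lemma log_diff_sq {T t : ℝ} (hT : 4 ≤ T) (h0 : 0 ≤ t) (h1 : t ≤ T) :
    (Real.log (t + 2) - Real.log T) ^ 2 ≤ 1 + 64 * (T + 2) ^ (1 / 2 : ℝ) * (t + 2) ^ (-(1 / 2) : ℝ) := by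
  have hp : 0 ≤ 64 * (T + 2) ^ (1 / 2 : ℝ) * (t + 2) ^ (-(1 / 2) : ℝ) := by positivity
  rcases le_total (t + 2) T with h | h
  · have h2 : (1 : ℝ) ≤ (T + 2) / (t + 2) := by rw [le_div_iff₀ (by linarith)]; linarith
    have h3 := log_sq_le h2
    have h4 : ((T + 2) / (t + 2)) ^ (1 / 4 : ℝ) ≤ ((T + 2) / (t + 2)) ^ (1 / 2 : ℝ) :=
      Real.rpow_le_rpow_of_exponent_le h2 (by norm_num)
    rw [Real.div_rpow (by linarith) (by linarith) (1 / 2)] at h4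
    rw [Real.log_div (by linarith) (by linarith)] at h3
    have h5 : Real.log (t + 2) ≤ Real.log T := Real.log_le_log (by linarith) h
    have h6 : Real.log T ≤ Real.log (T + 2) := Real.log_le_log (by linarith) (by linarith)
    have h7 : (Real.log (t + 2) - Real.log T) ^ 2 ≤ (Real.log (T + 2) - Real.log (t + 2)) ^ 2 := by
      apply sq_le_sq'
      · linarith
      · linarith
    rw [Real.rpow_neg (by linarith)]
    rw [div_eq_mul_inv ((T + 2) ^ (1 / 2 : ℝ))] at h4
    linarith
  · have h5 : Real.log T ≤ Real.log (t + 2) := Real.log_le_log (by linarith) h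
    have h6 : Real.log (t + 2) - Real.log T ≤ 1 := by
      rw [← Real.log_div (by linarith) (by linarith)]
      refine (Real.log_le_sub_one_of_pos (by apply div_pos <;> linarith)).trans ?_
      rw [tsub_le_iff_right, div_le_iff₀ (by linarith)]
      linarith
    nlinarith

lemma int_rpow_half (T : ℝ) (hT : 4 ≤ T) : ∫ t in (0 : ℝ)..T, (t + 2) ^ (-(1 / 2) : ℝ) ≤ 2 * (T + 2) ^ (1 / 2 : ℝ) := by
  rw [intervalIntegral.integral_comp_add_right (fun x : ℝ => x ^ (-(1 / 2) : ℝ)), integral_rpow (Or.inl (by norm_num))]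
  have : (0 : ℝ) ≤ (0 + 2) ^ (-(1 / 2) + 1 : ℝ) := by positivity
  rw [div_le_iff₀ (by norm_num)]
  norm_num at this ⊢
  linarith

def HH (C T t : ℝ) : ℝ := (Icc 0 T).indicator (fun t => C ^ 2 + C ^ 2 * T * (1 + t ^ 2)⁻¹ + (1 + 64 * (T + 2) ^ (1 / 2 : ℝ) * (t + 2) ^ (-(1 / 2) : ℝ))) t

lemma HH_int (C T : ℝ) (hT : 4 ≤ T) : Integrable (HH C T) ∧ ∫ t, HH C T t ≤ (5 * C ^ 2 + 300) * T := by
  have c2 : ContinuousOn (fun t : ℝ => (t + 2) ^ (-(1 / 2) : ℝ)) (Icc 0 T) := by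
    refine ContinuousOn.rpow_const (by fun_prop) fun t ht => Or.inl ?_
    have := ht.1
    linarith
  have c1 : Continuous (fun t : ℝ => (1 + t ^ 2)⁻¹) := Continuous.inv₀ (by fun_prop) fun t => by positivity
  have hc : ContinuousOn (fun t => C ^ 2 + C ^ 2 * T * (1 + t ^ 2)⁻¹ + (1 + 64 * (T + 2) ^ (1 / 2 : ℝ) * (t + 2) ^ (-(1 / 2) : ℝ))) (Icc 0 T) :=
    (continuousOn_const.add (continuousOn_const.mul c1.continuousOn)).add (continuousOn_const.add (continuousOn_const.mul c2))
  have hi := hc.integrableOn_Icc (μ := volume)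
  refine ⟨(integrable_indicator_iff measurableSet_Icc).2 hi, ?_⟩
  unfold HH
  rw [integral_indicator measurableSet_Icc, integral_Icc_eq_integral_Ioc, ← intervalIntegral.integral_of_le (by linarith)]
  have j1 : IntervalIntegrable (fun t : ℝ => (1 + t ^ 2)⁻¹) volume 0 T := c1.intervalIntegrable _ _
  have j2 : IntervalIntegrable (fun t : ℝ => (t + 2) ^ (-(1 / 2) : ℝ)) volume 0 T := by
    apply ContinuousOn.intervalIntegrable
    rwa [uIcc_of_le (by linarith)]
  rw [intervalIntegral.integral_add ((intervalIntegrable_const).add (j1.const_mul _)) ((intervalIntegrable_const).add (j2.const_mul _)),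
    intervalIntegral.integral_add intervalIntegrable_const (j1.const_mul _),
    intervalIntegral.integral_add intervalIntegrable_const (j2.const_mul _),
    intervalIntegral.integral_const_mul, intervalIntegral.integral_const_mul, intervalIntegral.integral_const, intervalIntegral.integral_const, integral_inv_one_add_sq]
  have h1 := int_rpow_half T hT
  have h2 : 0 ≤ (T + 2) ^ (1 / 2 : ℝ) := by positivity
  have h3 : (T + 2) ^ (1 / 2 : ℝ) * (T + 2) ^ (1 / 2 : ℝ) = T + 2 := by
    rw [← Real.rpow_add (by linarith)]; norm_num
  have h4 := Real.arctan_lt_pi_div_two T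
  have h5 := Real.pi_lt_four
  have h6 := mul_le_mul_of_nonneg_left h1 h2
  have h7 : C ^ 2 * T * Real.arctan T ≤ C ^ 2 * T * 2 := by
    gcongr
    linarith
  simp only [smul_eq_mul, sub_zero, Real.arctan_zero, mul_one]
  nlinarith [show 0 ≤ C ^ 2 * T by positivity]

theorem ERR_bound (hRH : RiemannHypothesis) : ∃ C : ℝ, 0 ≤ C ∧ ∀ r T u : ℝ, 2 ≤ r → T = r ^ 10 → 0 ≤ u → u ≤ Real.log T →
    Integrable (fun t => ‖ERR u T t‖ ^ 2) ∧ ∫ t, ‖ERR u T t‖ ^ 2 ≤ C * T := by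
  obtain ⟨C1, hC1, hD⟩ := DD_bound hRH
  obtain ⟨C, hC, hS⟩ := S_formula hRH
  refine ⟨16 * C1 * 30000 + 4 * (5 * C ^ 2 + 300), by positivity, fun r T u hr hT hu hu2 => ?_⟩
  have hT4 : 4 ≤ T := by
    have : (2 : ℝ) ^ 10 ≤ r ^ 10 := by gcongr
    rw [hT]; linarith
  obtain ⟨g1, g2⟩ := GG_int2 r T hr hT
  obtain ⟨k1, k2⟩ := HH_int C T hT4
  have hpt : ∀ t, ‖ERR u T t‖ ^ 2 ≤ 16 * C1 * GG r T t + 4 * HH C T t := by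
    intro t
    have h1 := ST_SS hRH u T t
    have h2 := hD r T t hr hT
    have hDn := DD_nonneg T t
    by_cases ht : 0 ≤ t ∧ t ≤ T
    · rw [if_pos ht] at h1
      rw [ERR, HH, indicator_of_mem (show t ∈ Icc 0 T from ht), indicator_of_mem (show t ∈ Icc 0 T from ht)]
      have h3 := hS t u hu
      rw [abs_of_nonneg ht.1] at h3
      have h4 := log_diff_sq hT4 ht.1 ht.2
      set L := Real.log (t + 2) - Real.log T with hL
      have e : STz u T t - VV u T t = (STz u T t - SS u t) + (SS u t + AA u t - (Real.log (t + 2) : ℂ) * Complex.exp ((-1 + t * I) * u))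
          + (L : ℂ) * Complex.exp ((-1 + t * I) * u) := by
        rw [VV, BB, hL]; push_cast; ring
      have h5 : ‖(L : ℂ) * Complex.exp ((-1 + t * I) * u)‖ ≤ |L| := by
        rw [norm_mul, norm_exp_aux, Complex.norm_real, Real.norm_eq_abs]
        have : Real.exp (-u) ≤ 1 := Real.exp_le_one_iff.2 (by linarith)
        nlinarith [abs_nonneg L]
      have h6 : ‖STz u T t - VV u T t‖ ≤ 2 * DD T t + (C + C * Real.exp (u / 2) / (1 + t ^ 2)) + |L| := by
        rw [e]
        exact (norm_add₃_le).trans (add_le_add (add_le_add h1 h3) h5)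
      set q := C * Real.exp (u / 2) / (1 + t ^ 2) with hq
      have hq2 : q ^ 2 ≤ C ^ 2 * T * (1 + t ^ 2)⁻¹ := by
        have e1 : Real.exp (u / 2) ^ 2 ≤ T := by
          rw [← Real.exp_nat_mul]
          rw [← Real.exp_log (by linarith : 0 < T)]
          apply Real.exp_le_exp.2
          push_cast; linarith
        rw [hq, div_pow, mul_pow, ← div_eq_mul_inv]
        have : (1 + t ^ 2) ≤ (1 + t ^ 2) ^ 2 := by nlinarith [sq_nonneg t]
        gcongr
      have h7 : ‖STz u T t - VV u T t‖ ^ 2 ≤ (2 * DD T t + (C + q) + |L|) ^ 2 := by gcongr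
      have h8 : |L| ^ 2 = L ^ 2 := sq_abs L
      have h9 : (2 * DD T t + (C + q) + |L|) ^ 2 ≤ 4 * (4 * DD T t ^ 2 + C ^ 2 + q ^ 2 + |L| ^ 2) := by
        nlinarith [sq_nonneg (2 * DD T t - C), sq_nonneg (2 * DD T t - q), sq_nonneg (2 * DD T t - |L|), sq_nonneg (C - q), sq_nonneg (C - |L|), sq_nonneg (q - |L|)]
      linarith
    · rw [if_neg ht, sub_zero] at h1
      rw [ERR, HH, indicator_of_notMem (show t ∉ Icc 0 T from ht), indicator_of_notMem (show t ∉ Icc 0 T from ht), sub_zero]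
      have : ‖STz u T t‖ ^ 2 ≤ (2 * DD T t) ^ 2 := by gcongr
      have hG : 0 ≤ C1 * GG r T t := le_trans (by positivity) h2
      nlinarith
  have hm : AEStronglyMeasurable (fun t => ‖ERR u T t‖ ^ 2) volume := by
    have : AEStronglyMeasurable (ERR u T) volume :=
      (STz_continuous u T).aestronglyMeasurable.sub ((VV_continuous hu T).aestronglyMeasurable.indicator measurableSet_Icc)
    exact (this.norm.pow 2)
  have hI : Integrable (fun t => 16 * C1 * GG r T t + 4 * HH C T t) := (g1.const_mul _).add (k1.const_mul _)
  have hI2 : Integrable (fun t => ‖ERR u T t‖ ^ 2) := hI.mono' hm (Eventually.of_forall fun t => by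
    rw [Real.norm_of_nonneg (by positivity)]; exact hpt t)
  refine ⟨hI2, (integral_mono hI2 hI hpt).trans ?_⟩
  rw [integral_add (g1.const_mul _) (k1.const_mul _), integral_const_mul, integral_const_mul]
  have := mul_le_mul_of_nonneg_left g2 (by positivity : 0 ≤ 16 * C1)
  linarith

/-! Part 14 of the proof. -/
lemma L2_add {μ : Measure ℝ} {f g : ℝ → ℂ} (hfm : AEStronglyMeasurable f μ) (hgm : AEStronglyMeasurable g μ)
    (hf : Integrable (fun t => ‖f t‖ ^ 2) μ) (hg : Integrable (fun t => ‖g t‖ ^ 2) μ) {s : ℝ} (hs : 0 < s) :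
    |(∫ t, ‖f t + g t‖ ^ 2 ∂μ) - (∫ t, ‖f t‖ ^ 2 ∂μ) - ∫ t, ‖g t‖ ^ 2 ∂μ| ≤ s * (∫ t, ‖f t‖ ^ 2 ∂μ) + (∫ t, ‖g t‖ ^ 2 ∂μ) / s := by
  have hpt : ∀ t, |‖f t + g t‖ ^ 2 - ‖f t‖ ^ 2 - ‖g t‖ ^ 2| ≤ s * ‖f t‖ ^ 2 + ‖g t‖ ^ 2 / s := by
    intro t
    have h1 : ‖f t + g t‖ ≤ ‖f t‖ + ‖g t‖ := norm_add_le _ _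
    have h2 : |‖f t‖ - ‖g t‖| ≤ ‖f t + g t‖ := by
      have := abs_norm_sub_norm_le (f t) (-g t)
      simpa using this
    have h3 : (‖f t‖ - ‖g t‖) ^ 2 ≤ ‖f t + g t‖ ^ 2 := by
      rw [← sq_abs (‖f t‖ - ‖g t‖)]; gcongr
    have h4 : ‖f t + g t‖ ^ 2 ≤ (‖f t‖ + ‖g t‖) ^ 2 := by gcongr
    have h5 : 2 * ‖f t‖ * ‖g t‖ ≤ s * ‖f t‖ ^ 2 + ‖g t‖ ^ 2 / s := by
      have : s * ‖f t‖ ^ 2 + ‖g t‖ ^ 2 / s - 2 * ‖f t‖ * ‖g t‖ = (s * ‖f t‖ - ‖g t‖) ^ 2 / s := by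
        field_simp; ring
      have h6 : 0 ≤ (s * ‖f t‖ - ‖g t‖) ^ 2 / s := by positivity
      linarith
    rw [abs_le]; constructor <;> nlinarith
  have hfg : Integrable (fun t => ‖f t + g t‖ ^ 2) μ := by
    refine Integrable.mono' ((hf.const_mul (1 + s)).add (hg.const_mul (1 + 1 / s))) ((hfm.add hgm).norm.pow 2) (Eventually.of_forall fun t => ?_)
    rw [Real.norm_of_nonneg (by positivity)]
    have := (abs_le.1 (hpt t)).2
    simp only [Pi.add_apply]
    have e : (1 + 1 / s) * ‖g t‖ ^ 2 = ‖g t‖ ^ 2 + ‖g t‖ ^ 2 / s := by ring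
    rw [e]
    linarith
  have hi : Integrable (fun t => s * ‖f t‖ ^ 2 + ‖g t‖ ^ 2 / s) μ := (hf.const_mul s).add (hg.div_const s)
  have e1 : (∫ t, ‖f t + g t‖ ^ 2 ∂μ) - (∫ t, ‖f t‖ ^ 2 ∂μ) - ∫ t, ‖g t‖ ^ 2 ∂μ = ∫ t, (‖f t + g t‖ ^ 2 - ‖f t‖ ^ 2 - ‖g t‖ ^ 2) ∂μ := by
    rw [integral_sub (f := fun t => ‖f t + g t‖ ^ 2 - ‖f t‖ ^ 2) (hfg.sub hf) hg, integral_sub hfg hf]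
  have e2 : s * (∫ t, ‖f t‖ ^ 2 ∂μ) + (∫ t, ‖g t‖ ^ 2 ∂μ) / s = ∫ t, (s * ‖f t‖ ^ 2 + ‖g t‖ ^ 2 / s) ∂μ := by
    rw [integral_add (hf.const_mul s) (hg.div_const s), integral_const_mul, integral_div]
  rw [e1, e2]
  refine (abs_integral_le_integral_abs).trans (integral_mono ((hfg.sub hf).sub hg).abs hi hpt)

lemma exp_small {x : ℝ} (hx : 0 < x) : Real.exp (-x) ≤ 2 / x ^ 2 := by
  rw [Real.exp_neg, ← one_div, div_le_div_iff₀ (Real.exp_pos _) (by positivity)]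
  have := Real.quadratic_le_exp_of_nonneg hx.le
  nlinarith

/-- abstract arithmetic: choice of parameter for the first cross term -/
lemma cross_choice {δ ℓ u m K : ℝ} (hδ : 0 < δ) (hℓ : 0 < ℓ) (hu : 0 ≤ u) (huℓ : u ≤ ℓ) (hK : 0 ≤ K)
    (hm : m = Real.exp (-2 * u) * ℓ) (h1 : 2 * K ≤ δ ^ 2 * ℓ) (h2 : 2 ≤ δ ^ 6 * ℓ) (h3 : K ≤ ℓ) :
    ∃ s, 0 < s ∧ s * ((u + K) / ℓ) + m / s ≤ 3 * δ * (1 + m) := by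
  have hm0 : 0 ≤ m := by rw [hm]; positivity
  rcases le_total u (δ ^ 2 * ℓ / 2) with h | h
  · refine ⟨1 / δ, by positivity, ?_⟩
    have : (u + K) / ℓ ≤ δ ^ 2 := by rw [div_le_iff₀ hℓ]; linarith
    have h4 : 1 / δ * ((u + K) / ℓ) ≤ δ := by
      calc 1 / δ * ((u + K) / ℓ) ≤ 1 / δ * δ ^ 2 := by gcongr
        _ = δ := by field_simp
    have h5 : m / (1 / δ) = δ * m := by field_simp
    rw [h5]
    nlinarith [mul_nonneg hδ.le hm0]
  · refine ⟨δ, hδ, ?_⟩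
    have h4 : (u + K) / ℓ ≤ 2 := by rw [div_le_iff₀ hℓ]; linarith
    have h5 : m / δ ≤ δ := by
      rw [div_le_iff₀ hδ, hm]
      have h6 : Real.exp (-2 * u) ≤ 2 / (δ ^ 2 * ℓ) ^ 2 := by
        refine le_trans (Real.exp_le_exp.2 ?_) (exp_small (by positivity))
        linarith
      calc Real.exp (-2 * u) * ℓ ≤ 2 / (δ ^ 2 * ℓ) ^ 2 * ℓ := by gcongr
        _ = 2 / (δ ^ 4 * ℓ) := by field_simp
        _ ≤ δ * δ := by
          rw [div_le_iff₀ (by positivity)]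
          nlinarith
    nlinarith [mul_nonneg hδ.le hm0]

/-- arithmetic endgame -/
lemma final_arith {δ ℓ T u m K K2 A B N Er S : ℝ} (hδ : 0 < δ) (hδ1 : δ ≤ 1) (hT : 0 < T) (hℓ : 0 < ℓ) (hu : 0 ≤ u) (huℓ : u ≤ ℓ)
    (hK : 0 ≤ K) (hK2 : 0 ≤ K2) (hm0 : 0 ≤ m) (hK3 : K ≤ δ * ℓ) (hK4 : K2 ≤ δ ^ 2 * ℓ)
    (hA : |A - T * u| ≤ K * T) (hB : B = T * ℓ * m)
    {s : ℝ} (hs : 0 < s) (hs2 : s * ((u + K) / ℓ) + m / s ≤ 3 * δ * (1 + m))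
    (hN : |N - A - B| ≤ s * A + B / s) (hE : Er ≤ K2 * T) (hE0 : 0 ≤ Er) (hS : |S - N - Er| ≤ δ * N + Er / δ) :
    |S / (T * ℓ) - u / ℓ - m| ≤ 11 * δ * (1 + m) := by
  have hA' := abs_le.1 hA
  have hTl : 0 < T * ℓ := by positivity
  have c1 : s * A + B / s ≤ T * ℓ * (3 * δ * (1 + m)) := by
    calc s * A + B / s ≤ s * (T * (u + K)) + T * ℓ * m / s := by
          rw [hB]
          have : A ≤ T * (u + K) := by linarith
          have := mul_le_mul_of_nonneg_left this hs.le
          linarith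
      _ = T * ℓ * (s * ((u + K) / ℓ) + m / s) := by field_simp
      _ ≤ _ := by gcongr
  have hKT : K * T ≤ T * ℓ * δ := by
    have := mul_le_mul_of_nonneg_left hK3 hT.le
    linarith
  have hN' := abs_le.1 hN
  have hS' := abs_le.1 hS
  have huT : T * u ≤ T * ℓ := mul_le_mul_of_nonneg_left huℓ hT.le
  have c2 : N ≤ T * ℓ * (5 * (1 + m)) := by
    have : T * ℓ * (3 * δ * (1 + m)) ≤ T * ℓ * (3 * 1 * (1 + m)) := by gcongr
    have : T * ℓ * δ ≤ T * ℓ * 1 := by gcongr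
    have hx : 0 ≤ T * ℓ * m := by positivity
    linarith [hN'.2, hA'.2]
  have c3 : δ * N ≤ T * ℓ * (5 * δ * (1 + m)) := by
    have := mul_le_mul_of_nonneg_left c2 hδ.le
    linarith
  have c4 : Er / δ ≤ T * ℓ * δ := by
    rw [div_le_iff₀ hδ]
    have := mul_le_mul_of_nonneg_left hK4 hT.le
    linarith
  have c5 : Er ≤ T * ℓ * δ := by
    have : Er ≤ Er / δ := by rw [le_div_iff₀ hδ]; nlinarith
    linarith
  have hx : 0 ≤ T * ℓ * δ * m := by positivity
  have e : S / (T * ℓ) - u / ℓ - m = (S - T * u - T * ℓ * m) / (T * ℓ) := by field_simp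
  rw [e, abs_div, abs_of_pos hTl, div_le_iff₀ hTl, abs_le]
  constructor
  · linarith [hN'.1, hA'.1, hS'.1]
  · linarith [hN'.2, hA'.2, hS'.2]

theorem main_asymp (hRH : RiemannHypothesis) (ε : ℝ) (hε : 0 < ε) (δ : ℝ) (hδ : 0 < δ) (hδ1 : δ ≤ 1) :
    ∃ T₀ : ℝ, 2 ≤ T₀ ∧ ∀ T : ℝ, T₀ ≤ T → ∀ α : ℝ, 0 ≤ α → α ≤ 1 - ε →
      |(∫ t, ‖STz (α * Real.log T) T t‖ ^ 2) / (T * Real.log T) - α - Real.exp (-2 * (α * Real.log T)) * Real.log T|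
        ≤ 11 * δ * (1 + Real.exp (-2 * (α * Real.log T)) * Real.log T) := by
  obtain ⟨K2, hK2, hE⟩ := ERR_bound hRH
  obtain ⟨C1, hC1, ha⟩ := an_sq hRH
  obtain ⟨C2, hC2, hA⟩ := AA_mean (η := min (1 / 4) (ε / 4)) (by positivity) (min_le_left _ _)
  set K := C1 + C2 with hKdef
  have hK : 0 ≤ K := by positivity
  set L0 := 1 + 2 * K / δ ^ 2 + 2 / δ ^ 6 + K + K / δ + K2 / δ ^ 2 with hL0
  have L0pos : 0 < L0 := by positivity
  refine ⟨max (2 ^ 10) (Real.exp L0), le_trans (by norm_num) (le_max_left _ _), fun T hT α hα0 hα1 => ?_⟩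
  have hT1 : (2 : ℝ) ^ 10 ≤ T := (le_max_left _ _).trans hT
  have hT0 : 0 < T := lt_of_lt_of_le (by norm_num) hT1
  set ℓ := Real.log T with hℓ
  have hLℓ : L0 ≤ ℓ := by
    rw [hℓ, Real.le_log_iff_exp_le hT0]; exact (le_max_right _ _).trans hT
  have hℓ0 : 0 < ℓ := lt_of_lt_of_le L0pos hLℓ
  have b1 : 0 ≤ 2 * K / δ ^ 2 := by positivity
  have b2 : 0 ≤ 2 / δ ^ 6 := by positivity
  have b3 : 0 ≤ K / δ := by positivity
  have b4 : 0 ≤ K2 / δ ^ 2 := by positivity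
  have h1 : 2 * K ≤ δ ^ 2 * ℓ := by
    have : 2 * K / δ ^ 2 ≤ ℓ := by linarith
    rw [div_le_iff₀ (by positivity)] at this; linarith
  have h2 : 2 ≤ δ ^ 6 * ℓ := by
    have : 2 / δ ^ 6 ≤ ℓ := by linarith
    rw [div_le_iff₀ (by positivity)] at this; linarith
  have h3 : K ≤ ℓ := by linarith
  have h4 : K ≤ δ * ℓ := by
    have : K / δ ≤ ℓ := by linarith
    rw [div_le_iff₀ (by positivity)] at this; linarith
  have h5 : K2 ≤ δ ^ 2 * ℓ := by
    have : K2 / δ ^ 2 ≤ ℓ := by linarith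
    rw [div_le_iff₀ (by positivity)] at this; linarith
  set u := α * ℓ with hu
  have hu0 : 0 ≤ u := by positivity
  have huℓ : u ≤ ℓ := by rw [hu]; nlinarith
  set m := Real.exp (-2 * u) * ℓ with hm
  have hm0 : 0 ≤ m := by positivity
  obtain ⟨s, hs, hs2⟩ := cross_choice hδ hℓ0 hu0 huℓ hK hm h1 h2 h3
  have hr : 2 ≤ T ^ (1 / 10 : ℝ) := by
    have := Real.rpow_le_rpow (by norm_num) hT1 (by norm_num : (0 : ℝ) ≤ 1 / 10)
    rwa [← Real.rpow_natCast, ← Real.rpow_mul (by norm_num), show ((10 : ℕ) : ℝ) * (1 / 10) = 1 by norm_num, Real.rpow_one] at this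
  have hTr : T = (T ^ (1 / 10 : ℝ)) ^ 10 := by
    rw [← Real.rpow_natCast, ← Real.rpow_mul hT0.le]; norm_num
  obtain ⟨hE1, hE2⟩ := hE _ T u hr hTr hu0 huℓ
  -- the first main term
  have iA : ∀ f : ℝ → ℂ, Continuous f → Integrable (fun t => ‖f t‖ ^ 2) (volume.restrict (Icc 0 T)) := fun f hf =>
    (Continuous.continuousOn (by fun_prop)).integrableOn_Icc
  have hAm : |(∫ t in Icc 0 T, ‖AA u t‖ ^ 2) - T * u| ≤ K * T := by
    rw [integral_Icc_eq_integral_Ioc, ← intervalIntegral.integral_of_le hT0.le]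
    have q1 := hA u T hu0 hT0.le
    have q2 := (ha u hu0).2
    have q3 : Real.exp ((1 + 4 * min (1 / 4) (ε / 4)) * u) ≤ T := by
      rw [← Real.le_log_iff_exp_le hT0, ← hℓ, hu]
      have p1 : min (1 / 4) (ε / 4) ≤ ε / 4 := min_le_right _ _
      have p2 : 0 < min (1 / 4) (ε / 4) := by positivity
      have p3 : (1 + 4 * min (1 / 4) (ε / 4)) * α ≤ 1 := by
        calc (1 + 4 * min (1 / 4) (ε / 4)) * α ≤ (1 + ε) * (1 - ε) := by
              refine mul_le_mul (by linarith) hα1 hα0 (by linarith)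
          _ ≤ 1 := by nlinarith
      nlinarith
    have q4 : |T * (∑' n, an u n ^ 2) - T * u| ≤ T * C1 := by
      rw [← mul_sub, abs_mul, abs_of_pos hT0]; gcongr
    have q5 : C2 * Real.exp ((1 + 4 * min (1 / 4) (ε / 4)) * u) ≤ C2 * T := by gcongr
    have := abs_sub_le (∫ t in (0 : ℝ)..T, ‖AA u t‖ ^ 2) (T * (∑' n, an u n ^ 2)) (T * u)
    rw [hKdef]
    linarith
  have hBm : (∫ t in Icc 0 T, ‖BB u T t‖ ^ 2) = T * ℓ * m := by
    have : ∀ t, ‖BB u T t‖ ^ 2 = ℓ * m := by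
      intro t
      rw [BB, norm_mul, norm_exp_aux, Complex.norm_real, ← hℓ, Real.norm_of_nonneg hℓ0.le, hm, mul_pow, ← Real.exp_nat_mul]
      push_cast
      rw [show (2 : ℝ) * -u = -2 * u by ring]; ring
    simp_rw [this]
    rw [setIntegral_const, measureReal_def, Real.volume_Icc, ENNReal.toReal_ofReal (by linarith), smul_eq_mul]
    ring
  have hN := L2_add (μ := volume.restrict (Icc 0 T)) (f := fun t => -AA u t) (g := BB u T)
    (AA_continuous hu0).neg.aestronglyMeasurable (BB_continuous u T).aestronglyMeasurable (iA _ (AA_continuous hu0).neg) (iA _ (BB_continuous u T)) hs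
  simp only [norm_neg] at hN
  have hVi : (fun t => ‖(Icc 0 T).indicator (VV u T) t‖ ^ 2) = (Icc 0 T).indicator (fun t => ‖VV u T t‖ ^ 2) := by
    funext t
    by_cases ht : t ∈ Icc 0 T
    · rw [indicator_of_mem ht, indicator_of_mem ht]
    · rw [indicator_of_notMem ht, indicator_of_notMem ht]; simp
  have hVint : Integrable (fun t => ‖(Icc 0 T).indicator (VV u T) t‖ ^ 2) := by
    rw [hVi, integrable_indicator_iff measurableSet_Icc]
    exact iA _ (VV_continuous hu0 T)
  have hVm : AEStronglyMeasurable ((Icc 0 T).indicator (VV u T)) volume :=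
    ((VV_continuous hu0 T).aestronglyMeasurable.indicator measurableSet_Icc)
  have hEm : AEStronglyMeasurable (ERR u T) volume := (STz_continuous u T).aestronglyMeasurable.sub hVm
  have hS := L2_add hVm hEm hVint hE1 hδ
  have eS : ∀ t, (Icc 0 T).indicator (VV u T) t + ERR u T t = STz u T t := fun t => by rw [ERR]; ring
  simp_rw [eS] at hS
  rw [hVi, integral_indicator measurableSet_Icc] at hS
  have := final_arith hδ hδ1 hT0 hℓ0 hu0 huℓ hK hK2 hm0 h4 h5 hAm hBm hs hs2 hN hE2 (integral_nonneg fun t => by positivity) hS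
  rwa [show u / ℓ = α by rw [hu]; field_simp] at this

theorem FF_part2 (hRH : RiemannHypothesis) (ε : ℝ) (hε : 0 < ε) (δ : ℝ) (hδ : 0 < δ) : ∃ T₀ : ℝ, ∀ T : ℝ, T₀ ≤ T →
      ∀ α : ℝ, 0 ≤ α → α ≤ 1 - ε →
        ‖FF α T - (α : ℂ) - ((T ^ (-2 * α) * Real.log T : ℝ) : ℂ)‖
          ≤ δ + δ * (T ^ (-2 * α) * Real.log T) := by
  obtain ⟨T₀, h2, h⟩ := main_asymp hRH ε hε (min 1 (δ / 11)) (by positivity) (min_le_left _ _)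
  refine ⟨T₀, fun T hT α h0 h1 => ?_⟩
  have hh := h T hT α h0 h1
  have hT0 : 0 < T := by linarith
  have hl : 0 < Real.log T := Real.log_pos (by linarith)
  have e1 : T ^ (-2 * α) = Real.exp (-2 * (α * Real.log T)) := by
    rw [Real.rpow_def_of_pos hT0]; congr 1; ring
  have e2 : FF α T = (((∫ t, ‖STz (α * Real.log T) T t‖ ^ 2) / (T * Real.log T) : ℝ) : ℂ) := by
    rw [FF, (Fxt_eq _ _).2, Real.log_rpow hT0, ← Complex.ofReal_inv, ← Complex.ofReal_mul]
    congr 1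
    have := Real.pi_pos
    field_simp
  rw [e1, e2, ← Complex.ofReal_sub, ← Complex.ofReal_sub, Complex.norm_real, Real.norm_eq_abs]
  refine hh.trans ?_
  have hp : 0 ≤ Real.exp (-2 * (α * Real.log T)) * Real.log T := by positivity
  have hm : min 1 (δ / 11) ≤ δ / 11 := min_le_right _ _
  calc 11 * min 1 (δ / 11) * (1 + Real.exp (-2 * (α * Real.log T)) * Real.log T)
      ≤ 11 * (δ / 11) * (1 + Real.exp (-2 * (α * Real.log T)) * Real.log T) := by gcongr
    _ = _ := by ring

/-- Montgomery's theorem: assuming RH, `F(α,T)` is real, even and non-negative in `α`, and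
uniformly for `0 ≤ α ≤ 1 - ε` one has `F(α) = α + o(1) + (1+o(1)) T^{-2α} log T` as `T → ∞`. -/
theorem montgomery_theorem (hRH : RiemannHypothesis) :
    (∀ T : ℝ, 2 ≤ T → ∀ α : ℝ,
      (FF α T).im = 0 ∧ FF (-α) T = FF α T ∧ 0 ≤ (FF α T).re) ∧
    (∀ ε : ℝ, 0 < ε → ∀ δ : ℝ, 0 < δ → ∃ T₀ : ℝ, ∀ T : ℝ, T₀ ≤ T →
      ∀ α : ℝ, 0 ≤ α → α ≤ 1 - ε →
        ‖FF α T - (α : ℂ) - ((T ^ (-2 * α) * Real.log T : ℝ) : ℂ)‖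
          ≤ δ + δ * (T ^ (-2 * α) * Real.log T)) := by
  exact ⟨fun T hT α => FF_part1 T hT α, fun ε hε δ hδ => FF_part2 hRH ε hε δ hδ⟩
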